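/- There is a universal constant C > 0 such that for every real p with 1 < p ≤ 2, every ε ∈ (0,1), and every dimension d ≥ 1, there exist an integer d' ≤ C·d/ε² and a linear map T : ℝ^d → ℝ^{d'} such that ‖x‖_p ≤ ‖T x‖₁ ≤ (1 + ε)·‖x‖_p for all x ∈ ℝ^d, where ‖x‖_p = (Σ_i |x_i|^p)^{1/p} and ‖v‖₁ = Σ_j |v_j|. -/

import Mathlib

open MeasureTheory ProbabilityTheory Filter Topology

/-- Lévy's continuity theorem: a pointwise limit of characteristic functions of probability
measures that is continuous at `0` is a characteristic function. -/
theorem exists_charFun_eq_of_tendsto {μ : ℕ → Measure ℝ} [∀ n, IsProbabilityMeasure (μ n)]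
    {f : ℝ → ℂ} (hf : ContinuousAt f 0)
    (h : ∀ t, Tendsto (fun n ↦ charFun (μ n) t) atTop (𝓝 (f t))) :
    ∃ ν : Measure ℝ, IsProbabilityMeasure ν ∧ ∀ t, charFun ν t = f t := by
  have htight := isTightMeasureSet_of_tendsto_charFun hf h
  let m : ℕ → ProbabilityMeasure ℝ := fun n ↦ ⟨μ n, inferInstance⟩
  have hc : IsCompact (closure (Set.range m)) := by
    apply isCompact_closure_of_isTightMeasureSet
    convert htight using 1
    ext ν
    constructor
    · rintro ⟨_, ⟨n, rfl⟩, rfl⟩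
      exact ⟨n, rfl⟩
    · rintro ⟨n, rfl⟩
      exact ⟨m n, ⟨n, rfl⟩, rfl⟩
  have : TopologicalSpace.MetrizableSpace (ProbabilityMeasure ℝ) := inferInstance
  let := TopologicalSpace.metrizableSpaceMetric (ProbabilityMeasure ℝ)
  obtain ⟨ν, -, φ, hφ, hν⟩ := hc.tendsto_subseq (x := m) fun n ↦ subset_closure ⟨n, rfl⟩
  refine ⟨ν, inferInstance, fun t ↦ ?_⟩
  have h1 := ProbabilityMeasure.tendsto_iff_tendsto_charFun.1 hν t
  exact tendsto_nhds_unique h1 ((h t).comp hφ.tendsto_atTop)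

/-- If `1 - Re ψ` behaves like `κ |t| ^ p` at `0`, then powers of rescalings of `ψ` converge to
`exp (-κ |t| ^ p)`. -/
theorem tendsto_pow_exp_neg_abs_rpow {p κ : ℝ} (hp : 0 < p) {ψ : ℝ → ℝ} (hψ0 : ψ 0 = 1)
    (hψ : Tendsto (fun t ↦ (1 - ψ t) / |t| ^ p) (𝓝[≠] 0) (𝓝 κ)) (t : ℝ) :
    Tendsto (fun n : ℕ ↦ ψ (t * (n : ℝ) ^ (-(1 / p))) ^ n) atTop
      (𝓝 (Real.exp (-(κ * |t| ^ p)))) := by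
  rcases eq_or_ne t 0 with rfl | ht
  · simp [hψ0, Real.zero_rpow hp.ne']
  have hlim : Tendsto (fun n : ℕ ↦ t * (n : ℝ) ^ (-(1 / p))) atTop (𝓝[≠] 0) := by
    rw [tendsto_nhdsWithin_iff]
    constructor
    · have := (tendsto_rpow_neg_atTop (y := 1 / p) (by positivity)).comp
        (tendsto_natCast_atTop_atTop (R := ℝ))
      simpa using this.const_mul t
    · filter_upwards [eventually_gt_atTop 0] with n hn
      have : (0 : ℝ) < n := by exact_mod_cast hn
      have := Real.rpow_pos_of_pos this (-(1 / p))
      simp only [Set.mem_compl_iff, Set.mem_singleton_iff]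
      positivity
  have h1 : Tendsto (fun n : ℕ ↦ (n : ℝ) * (ψ (t * (n : ℝ) ^ (-(1 / p))) - 1)) atTop
      (𝓝 (-(κ * |t| ^ p))) := by
    have h2 := ((hψ.comp hlim).mul_const (|t| ^ p)).neg
    refine h2.congr' ?_
    filter_upwards [eventually_gt_atTop 0] with n hn
    have hn' : (0 : ℝ) < n := by exact_mod_cast hn
    have h3 : |t * (n : ℝ) ^ (-(1 / p))| ^ p = |t| ^ p / n := by
      rw [abs_mul, Real.mul_rpow (abs_nonneg _) (abs_nonneg _),
        abs_of_pos (Real.rpow_pos_of_pos hn' _), ← Real.rpow_mul hn'.le]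
      rw [show -(1 / p) * p = -1 by field_simp, Real.rpow_neg_one]
      rfl
    have h4 : 0 < |t| ^ p := Real.rpow_pos_of_pos (abs_pos.2 ht) _
    simp only [Function.comp, h3]
    field_simp
    ring
  have := Real.tendsto_one_add_pow_exp_of_tendsto h1
  simpa using this

/-- The symmetrised Pareto law. -/
noncomputable def symmPareto (p : ℝ) : Measure ℝ :=
  (2⁻¹ : NNReal) • paretoMeasure 1 p + (2⁻¹ : NNReal) • (paretoMeasure 1 p).map Neg.neg

theorem isProbabilityMeasure_symmPareto {p : ℝ} (hp : 0 < p) :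
    IsProbabilityMeasure (symmPareto p) := by
  have := isProbabilityMeasure_paretoMeasure one_pos hp
  have : IsProbabilityMeasure ((paretoMeasure 1 p).map Neg.neg) :=
    Measure.isProbabilityMeasure_map (by fun_prop)
  constructor
  simp only [symmPareto, Measure.coe_add, Measure.coe_nnreal_smul_apply, Pi.add_apply, measure_univ]
  rw [mul_one, ← ENNReal.coe_add, ← ENNReal.coe_one]
  congr 1
  ext
  norm_num

theorem charFun_symmPareto {p : ℝ} (hp : 0 < p) (t : ℝ) :
    charFun (symmPareto p) t = ((∫ x, Real.cos (t * x) ∂(paretoMeasure 1 p) : ℝ) : ℂ) := by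
  have := isProbabilityMeasure_paretoMeasure one_pos hp
  have hi (s : ℝ) (ν : Measure ℝ) [IsFiniteMeasure ν] :
      Integrable (fun x : ℝ ↦ Complex.exp (s * x * Complex.I)) ν := by
    refine Integrable.of_bound (C := 1) (by fun_prop) (ae_of_all _ fun x ↦ ?_)
    rw [← Complex.ofReal_mul, Complex.norm_exp_ofReal_mul_I]
  rw [charFun_apply_real, symmPareto, integral_add_measure
    ((hi _ _).smul_measure_nnreal) ((hi _ _).smul_measure_nnreal),
    integral_smul_nnreal_measure, integral_smul_nnreal_measure,
    integral_map (by fun_prop) (by fun_prop), ← smul_add, ← integral_add (hi _ _)]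
  · rw [← integral_complex_ofReal, NNReal.smul_def, ← integral_smul]
    refine integral_congr_ae (ae_of_all _ fun x ↦ ?_)
    simp only [Complex.ofReal_cos, Complex.cos]
    rw [Complex.real_smul]
    push_cast
    ring_nf
  · have := hi (-t) (paretoMeasure 1 p)
    refine this.congr (ae_of_all _ fun x ↦ ?_)
    push_cast
    ring_nf

theorem integral_paretoMeasure_one {p : ℝ} (hp : 0 < p) (f : ℝ → ℝ) :
    ∫ x, f x ∂(paretoMeasure 1 p) = ∫ x in Set.Ioi (1 : ℝ), (p * x ^ (-(p + 1))) * f x := by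
  rw [paretoMeasure]
  have : paretoPDF 1 p = fun x ↦ ENNReal.ofReal (paretoPDFReal 1 p x) := rfl
  rw [this, integral_withDensity_eq_integral_toReal_smul (by fun_prop) (by simp),
    ← integral_Ici_eq_integral_Ioi, ← integral_indicator measurableSet_Ici]
  refine integral_congr_ae (ae_of_all _ fun x ↦ ?_)
  simp only [smul_eq_mul]
  rw [ENNReal.toReal_ofReal (paretoPDFReal_nonneg zero_le_one hp.le x)]
  by_cases hx : 1 ≤ x
  · rw [Set.indicator_of_mem (by simpa using hx), paretoPDFReal, if_pos hx]
    simp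
  · rw [Set.indicator_of_notMem (by simpa using hx), paretoPDFReal, if_neg hx]
    simp

theorem integrableOn_one_sub_cos_mul_rpow {p : ℝ} (hp : 0 < p) (hp2 : p < 2) :
    IntegrableOn (fun u : ℝ ↦ p * u ^ (-(p + 1)) * (1 - Real.cos u)) (Set.Ioi 0) := by
  have hm : Measurable (fun u : ℝ ↦ p * u ^ (-(p + 1)) * (1 - Real.cos u)) := by fun_prop
  rw [← Set.Ioc_union_Ioi_eq_Ioi zero_le_one]
  refine IntegrableOn.union ?_ ?_
  · have h1 : IntegrableOn (fun u : ℝ ↦ p * u ^ (1 - p)) (Set.Ioc 0 1) := by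
      rw [← intervalIntegrable_iff_integrableOn_Ioc_of_le zero_le_one]
      exact (intervalIntegral.intervalIntegrable_rpow' (by linarith)).const_mul p
    refine h1.mono' hm.aestronglyMeasurable ?_
    filter_upwards [ae_restrict_mem measurableSet_Ioc] with u hu
    have hu0 : 0 < u := hu.1
    rw [Real.norm_eq_abs, abs_of_nonneg (by
      have := Real.cos_le_one u
      have : 0 ≤ 1 - Real.cos u := by linarith
      positivity)]
    have h2 : 1 - Real.cos u ≤ u ^ 2 := by
      nlinarith [Real.one_sub_sq_div_two_le_cos (x := u), sq_nonneg u]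
    calc p * u ^ (-(p + 1)) * (1 - Real.cos u) ≤ p * u ^ (-(p + 1)) * u ^ 2 := by gcongr
      _ = p * u ^ (1 - p) := by
        rw [mul_assoc, ← Real.rpow_natCast, ← Real.rpow_add hu0]; congr 2; push_cast; ring
  · have h1 : IntegrableOn (fun u : ℝ ↦ 2 * (p * u ^ (-(p + 1)))) (Set.Ioi 1) :=
      ((integrableOn_Ioi_rpow_of_lt (by linarith) one_pos).const_mul p).const_mul 2
    refine h1.mono' hm.aestronglyMeasurable ?_
    filter_upwards [ae_restrict_mem measurableSet_Ioi] with u hu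
    have hu0 : 0 < u := one_pos.trans hu
    rw [Real.norm_eq_abs, abs_of_nonneg (by
      have := Real.cos_le_one u
      have : 0 ≤ 1 - Real.cos u := by linarith
      positivity)]
    have h2 : 1 - Real.cos u ≤ 2 := by linarith [Real.neg_one_le_cos u]
    calc p * u ^ (-(p + 1)) * (1 - Real.cos u) ≤ p * u ^ (-(p + 1)) * 2 := by gcongr
      _ = _ := by ring

theorem one_sub_integral_cos_paretoMeasure {p : ℝ} (hp : 0 < p) {t : ℝ} (ht : t ≠ 0) :
    (1 - ∫ x, Real.cos (t * x) ∂(paretoMeasure 1 p)) / |t| ^ p =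
      ∫ u in Set.Ioi |t|, p * u ^ (-(p + 1)) * (1 - Real.cos u) := by
  have := isProbabilityMeasure_paretoMeasure one_pos hp
  have hi : Integrable (fun x ↦ Real.cos (t * x)) (paretoMeasure 1 p) :=
    Integrable.of_bound (C := 1) (by fun_prop) (ae_of_all _ fun x ↦ Real.abs_cos_le_one _)
  have h1 : 1 - ∫ x, Real.cos (t * x) ∂(paretoMeasure 1 p) =
      ∫ x, (1 - Real.cos (t * x)) ∂(paretoMeasure 1 p) := by
    rw [integral_sub (integrable_const _) hi]; simp
  have ht' : 0 < |t| := abs_pos.2 ht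
  have hc := integral_comp_mul_left_Ioi
    (fun u ↦ p * u ^ (-(p + 1)) * (1 - Real.cos u)) 1 ht'
  rw [mul_one] at hc
  have hc' : (∫ u in Set.Ioi |t|, p * u ^ (-(p + 1)) * (1 - Real.cos u)) =
      |t| * ∫ x in Set.Ioi (1 : ℝ), p * (|t| * x) ^ (-(p + 1)) * (1 - Real.cos (|t| * x)) := by
    rw [hc, smul_eq_mul, ← mul_assoc, mul_inv_cancel₀ ht'.ne', one_mul]
  rw [h1, integral_paretoMeasure_one hp, hc', ← integral_div, ← integral_const_mul]
  refine setIntegral_congr_fun measurableSet_Ioi fun x hx ↦ ?_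
  have hx0 : (0 : ℝ) < x := one_pos.trans hx
  have h2 : Real.cos (|t| * x) = Real.cos (t * x) := by
    rw [← Real.cos_abs (t * x), abs_mul, abs_of_pos hx0]
  simp only [h2]
  rw [Real.mul_rpow ht'.le hx0.le, show -(p + 1) = -p + (-1) by ring, Real.rpow_add ht',
    Real.rpow_neg ht'.le, Real.rpow_neg_one]
  field_simp

/-- Existence of symmetric `p`-stable laws. -/
theorem exists_stable_law {p : ℝ} (hp : 1 < p) (hp2 : p ≤ 2) :
    ∃ μ : Measure ℝ, IsProbabilityMeasure μ ∧
      ∀ t, charFun μ t = ((Real.exp (-|t| ^ p) : ℝ) : ℂ) := by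
  have hp0 : 0 < p := by linarith
  rcases hp2.lt_or_eq with hp2 | rfl
  · set κ := ∫ u in Set.Ioi (0 : ℝ), p * u ^ (-(p + 1)) * (1 - Real.cos u) with hκ
    have hinteg := integrableOn_one_sub_cos_mul_rpow hp0 hp2
    have hnn : ∀ u ∈ Set.Ioi (0 : ℝ), 0 ≤ p * u ^ (-(p + 1)) * (1 - Real.cos u) := by
      intro u hu
      have hu0 : (0 : ℝ) < u := hu
      have : 0 ≤ 1 - Real.cos u := by linarith [Real.cos_le_one u]
      positivity
    have hκ0 : 0 < κ := by
      rw [hκ, setIntegral_pos_iff_support_of_nonneg_ae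
        ((ae_restrict_iff' measurableSet_Ioi).2 (ae_of_all _ hnn)) hinteg]
      refine lt_of_lt_of_le ?_ (measure_mono (s := Set.Ioo 0 Real.pi) ?_)
      · simp [Real.pi_pos]
      · rintro u ⟨hu0, hu⟩
        refine ⟨?_, hu0⟩
        have h1 : Real.cos u < 1 := by
          rw [← Real.cos_zero]
          exact Real.cos_lt_cos_of_nonneg_of_le_pi le_rfl hu.le hu0
        have : 0 < u ^ (-(p + 1)) := Real.rpow_pos_of_pos hu0 _
        have : 0 < 1 - Real.cos u := by linarith
        simp only [Function.mem_support]
        positivity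
    set ψ : ℝ → ℝ := fun t ↦ ∫ x, Real.cos (t * x) ∂(paretoMeasure 1 p) with hψ
    have hP := isProbabilityMeasure_paretoMeasure one_pos hp0
    have hψ0 : ψ 0 = 1 := by simp [hψ]
    have hlim : Tendsto (fun t ↦ (1 - ψ t) / |t| ^ p) (𝓝[≠] 0) (𝓝 κ) := by
      have h1 : Tendsto (fun t : ℝ ↦ ∫ u in Set.Ioi t, p * u ^ (-(p + 1)) * (1 - Real.cos u))
          (𝓝[>] 0) (𝓝 κ) := by
        have h2 : ∀ t : ℝ, 0 < t → ∫ u in Set.Ioi t, p * u ^ (-(p + 1)) * (1 - Real.cos u) =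
            κ - ∫ u in (0 : ℝ)..t, p * u ^ (-(p + 1)) * (1 - Real.cos u) := by
          intro t ht
          rw [hκ, ← intervalIntegral.integral_Ioi_sub_Ioi hinteg ht.le]
          ring
        have h3 : Tendsto (fun t : ℝ ↦ ∫ u in (0 : ℝ)..t, p * u ^ (-(p + 1)) * (1 - Real.cos u))
            (𝓝[>] 0) (𝓝 0) := by
          have h4 : IntervalIntegrable (fun u : ℝ ↦ p * u ^ (-(p + 1)) * (1 - Real.cos u))
              volume 0 1 := by
            rw [intervalIntegrable_iff_integrableOn_Ioc_of_le zero_le_one]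
            exact hinteg.mono_set Set.Ioc_subset_Ioi_self
          have h5 := (intervalIntegral.continuousOn_primitive_interval' h4
            (Set.left_mem_uIcc)).continuousWithinAt (Set.left_mem_uIcc (a := (0:ℝ)) (b := 1))
          have h6 : Tendsto (fun t : ℝ ↦
              ∫ u in (0 : ℝ)..t, p * u ^ (-(p + 1)) * (1 - Real.cos u))
              (𝓝[Set.uIcc 0 1] 0) (𝓝 0) := by simpa [ContinuousWithinAt] using h5
          refine h6.mono_left (nhdsWithin_le_iff.2 ?_)
          rw [Set.uIcc_of_le zero_le_one]
          exact mem_of_superset (Ioc_mem_nhdsGT one_pos) Set.Ioc_subset_Icc_self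
        have h7 := (tendsto_const_nhds (x := κ)).sub h3
        rw [sub_zero] at h7
        refine h7.congr' ?_
        filter_upwards [self_mem_nhdsWithin] with t ht using (h2 t ht).symm
      have h8 : Tendsto (fun t : ℝ ↦ |t|) (𝓝[≠] 0) (𝓝[>] 0) := tendsto_abs_nhdsNE_zero
      refine (h1.comp h8).congr' ?_
      filter_upwards [self_mem_nhdsWithin] with t ht
      exact (one_sub_integral_cos_paretoMeasure hp0 ht).symm
    have hSP := isProbabilityMeasure_symmPareto hp0
    let c : ℝ := κ ^ (-(1 / p))
    let μ : ℕ → Measure ℝ := fun n ↦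
      ((Measure.pi fun _ : Fin n ↦ symmPareto p).map (fun x ↦ ∑ i, x i)).map
        (fun y ↦ (c * (n : ℝ) ^ (-(1 / p))) * y)
    have hμ : ∀ n, IsProbabilityMeasure (μ n) := fun n ↦ by
      have : IsProbabilityMeasure
          ((Measure.pi fun _ : Fin n ↦ symmPareto p).map (fun x ↦ ∑ i, x i)) :=
        Measure.isProbabilityMeasure_map (by fun_prop)
      exact Measure.isProbabilityMeasure_map (by fun_prop)
    refine exists_charFun_eq_of_tendsto (μ := μ) (f := fun t ↦ ((Real.exp (-|t| ^ p) : ℝ) : ℂ))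
      ?_ fun t ↦ ?_
    · refine Continuous.continuousAt (Complex.continuous_ofReal.comp (Real.continuous_exp.comp ?_))
      exact (continuous_abs.rpow_const fun _ ↦ Or.inr hp0.le).neg
    · have h1 := tendsto_pow_exp_neg_abs_rpow hp0 hψ0 hlim (c * t)
      have h2 : κ * |c * t| ^ p = |t| ^ p := by
        have hc : 0 < c := Real.rpow_pos_of_pos hκ0 _
        rw [abs_mul, Real.mul_rpow (abs_nonneg _) (abs_nonneg _), abs_of_pos hc,
          ← Real.rpow_mul hκ0.le, show -(1 / p) * p = -1 by field_simp, Real.rpow_neg_one,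
          ← mul_assoc, mul_inv_cancel₀ hκ0.ne', one_mul]
      rw [h2] at h1
      have h3 := (Complex.continuous_ofReal.tendsto _).comp h1
      refine h3.congr fun n ↦ ?_
      simp only [Function.comp, μ]
      rw [charFun_map_mul, charFun_map_sum_pi_eq_prod, Finset.prod_apply, Finset.prod_const,
        Finset.card_univ, Fintype.card_fin, charFun_symmPareto hp0]
      simp only [Complex.ofReal_pow, hψ]
      congr 4
      ext x
      ring_nf
  · refine ⟨gaussianReal 0 2, inferInstance, fun t ↦ ?_⟩
    rw [charFun_gaussianReal]
    push_cast
    simp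

/-- `μ` is the symmetric `p`-stable law with characteristic function `exp (-|t| ^ p)`. -/
def IsStableLaw (p : ℝ) (μ : Measure ℝ) : Prop :=
  ∀ t, charFun μ t = ((Real.exp (-|t| ^ p) : ℝ) : ℂ)

/-- A measure on `ℝ` invariant under negation. -/
def IsSymmetricLaw (μ : Measure ℝ) : Prop := μ.map (fun x ↦ -x) = μ

theorem min_one_sq_le_one_sub_sinc (v : ℝ) : min 1 (v ^ 2) ≤ 16 * (1 - Real.sinc v) := by
  wlog hv : 0 ≤ v generalizing v
  · simpa using this (-v) (by linarith)
  rcases hv.eq_or_lt with rfl | hv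
  · simp
  rw [Real.sinc_of_ne_zero hv.ne']
  have hpi : Real.pi < 3.15 := Real.pi_lt_d2
  have hpi3 : 3 < Real.pi := Real.pi_gt_three
  rcases le_total v Real.pi with h | h
  · have key : Real.sin v ≤ v - v ^ 3 / 15 := by
      have hmono : MonotoneOn (fun x : ℝ ↦ x - x ^ 3 / 15 - Real.sin x) (Set.Icc 0 Real.pi) := by
        refine monotoneOn_of_deriv_nonneg (convex_Icc _ _) (by fun_prop) (by fun_prop) ?_
        intro x hx
        rw [interior_Icc] at hx
        have hd : HasDerivAt (fun x : ℝ ↦ x - x ^ 3 / 15 - Real.sin x)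
            (1 - 3 * x ^ 2 / 15 - Real.cos x) x := by
          have := ((hasDerivAt_id x).sub ((hasDerivAt_pow 3 x).div_const 15)).sub
            (Real.hasDerivAt_sin x)
          exact this.congr_deriv (by norm_num)
        rw [hd.deriv]
        have hc := Real.cos_le_one_sub_mul_cos_sq (x := x)
          (by rw [abs_of_pos hx.1]; exact hx.2.le)
        have : (1 : ℝ) / 5 ≤ 2 / Real.pi ^ 2 := by
          rw [div_le_div_iff₀ (by norm_num) (by positivity)]
          nlinarith
        nlinarith [sq_nonneg x]
      have := hmono ⟨le_rfl, Real.pi_pos.le⟩ ⟨hv.le, h⟩ hv.le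
      simp at this
      linarith
    have h2 : Real.sin v / v ≤ 1 - v ^ 2 / 15 := by
      rw [div_le_iff₀ hv]
      nlinarith
    have : min 1 (v ^ 2) ≤ v ^ 2 := min_le_right _ _
    nlinarith [sq_nonneg v]
  · have h2 : Real.sin v / v ≤ 1 / 3 := by
      rw [div_le_div_iff₀ hv (by norm_num)]
      nlinarith [Real.sin_le_one v]
    have : min 1 (v ^ 2) ≤ 1 := min_le_left _ _
    linarith

namespace IsStableLaw

variable {p : ℝ} {μ : Measure ℝ} [IsProbabilityMeasure μ]

theorem isSymmetricLaw (hμ : IsStableLaw p μ) : IsSymmetricLaw μ := by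
  have : IsProbabilityMeasure (μ.map (fun x ↦ -x)) := Measure.isProbabilityMeasure_map (by fun_prop)
  refine Measure.ext_of_charFun (funext fun t ↦ ?_)
  have h : (fun x : ℝ ↦ -x) = fun x ↦ (-1) * x := by ext; ring
  rw [h, charFun_map_mul, hμ, hμ]
  simp

/-- Stability: a linear combination of independent copies is a rescaled copy. -/
theorem map_sum_mul (hμ : IsStableLaw p μ) (hp : 0 < p) {d : ℕ} (x : Fin d → ℝ) :
    (Measure.pi fun _ : Fin d ↦ μ).map (fun a ↦ ∑ i, a i * x i) =
      μ.map (fun s ↦ (∑ i, |x i| ^ p) ^ (1 / p) * s) := by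
  have hm : (Measure.pi fun _ : Fin d ↦ μ).map (fun a ↦ ∑ i, a i * x i) =
      (Measure.pi fun i : Fin d ↦ μ.map (fun s ↦ x i * s)).map (fun b ↦ ∑ i, b i) := by
    have (i : Fin d) : IsProbabilityMeasure (μ.map (fun s ↦ x i * s)) :=
      Measure.isProbabilityMeasure_map (by fun_prop)
    rw [← Measure.pi_map_pi (fun i ↦ by fun_prop), Measure.map_map (by fun_prop) (by fun_prop)]
    congr 1
    ext a
    simp [mul_comm]
  have (i : Fin d) : IsProbabilityMeasure (μ.map (fun s ↦ x i * s)) :=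
    Measure.isProbabilityMeasure_map (by fun_prop)
  have : IsProbabilityMeasure (μ.map (fun s ↦ (∑ i, |x i| ^ p) ^ (1 / p) * s)) :=
    Measure.isProbabilityMeasure_map (by fun_prop)
  rw [hm]
  have : IsProbabilityMeasure ((Measure.pi fun i : Fin d ↦ μ.map (fun s ↦ x i * s)).map
      (fun b ↦ ∑ i, b i)) := Measure.isProbabilityMeasure_map (by fun_prop)
  refine Measure.ext_of_charFun (funext fun t ↦ ?_)
  rw [charFun_map_sum_pi_eq_prod, Finset.prod_apply, charFun_map_mul, hμ]
  simp_rw [charFun_map_mul, hμ _]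
  have hS : 0 ≤ ∑ i, |x i| ^ p := Finset.sum_nonneg fun i _ ↦ by positivity
  rw [abs_mul, Real.mul_rpow (abs_nonneg _) (abs_nonneg _), abs_of_nonneg (by positivity),
    ← Real.rpow_mul hS, one_div, inv_mul_cancel₀ hp.ne', Real.rpow_one, Finset.sum_mul,
    ← Finset.sum_neg_distrib, Real.exp_sum]
  push_cast
  refine Finset.prod_congr rfl fun i _ ↦ ?_
  rw [abs_mul, Real.mul_rpow (abs_nonneg _) (abs_nonneg _)]
  push_cast
  rfl

theorem one_sub_integral_cos (hμ : IsStableLaw p μ) (t : ℝ) :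
    ∫ x, (1 - Real.cos (t * x)) ∂μ = 1 - Real.exp (-|t| ^ p) := by
  have h1 := congr_arg Complex.re (hμ t)
  rw [charFun_apply_real, Complex.ofReal_re] at h1
  have hi : Integrable (fun x : ℝ ↦ Complex.exp (t * x * Complex.I)) μ := by
    refine Integrable.of_bound (C := 1) (by fun_prop) (ae_of_all _ fun x ↦ ?_)
    rw [← Complex.ofReal_mul, Complex.norm_exp_ofReal_mul_I]
  have h2 : ∫ x, Real.cos (t * x) ∂μ = Real.exp (-|t| ^ p) := by
    rw [← h1]
    have := integral_re hi
    simp only [RCLike.re_eq_complex_re] at this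
    rw [← this]
    congr 1
    ext x
    rw [← Complex.ofReal_mul, Complex.exp_ofReal_mul_I_re]
  have hc : Integrable (fun x ↦ Real.cos (t * x)) μ :=
    Integrable.of_bound (C := 1) (by fun_prop) (ae_of_all _ fun x ↦ Real.abs_cos_le_one _)
  rw [integral_sub (integrable_const _) hc, h2]
  simp

/-- The basic truncated second moment bound. -/
theorem integral_min_one_sq_le (hμ : IsStableLaw p μ) (hp : 0 < p) {R : ℝ} (hR : 0 < R) :
    ∫ x, min 1 ((x / R) ^ 2) ∂μ ≤ 16 * R ^ (-p) := by
  have hr : 0 < R⁻¹ := inv_pos.2 hR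
  have h1 := congr_arg Complex.re (integral_charFun_Icc (μ := μ) hr)
  simp_rw [hμ _] at h1
  rw [intervalIntegral.integral_ofReal, Complex.ofReal_re] at h1
  have h2 : (2 * (R⁻¹ : ℝ) * ∫ x, Real.sinc (R⁻¹ * x) ∂μ : ℂ).re =
      2 * R⁻¹ * ∫ x, Real.sinc (R⁻¹ * x) ∂μ := by
    norm_cast
  have hcont : Continuous fun t : ℝ ↦ Real.exp (-|t| ^ p) :=
    Real.continuous_exp.comp (continuous_abs.rpow_const fun _ ↦ Or.inr hp.le).neg
  have h3 : ∫ t in (-R⁻¹)..R⁻¹, (1 - (R⁻¹) ^ p) ≤ ∫ t in (-R⁻¹)..R⁻¹, Real.exp (-|t| ^ p) := by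
    refine intervalIntegral.integral_mono_on (by linarith) (by simp)
      (hcont.intervalIntegrable _ _) fun t ht ↦ ?_
    have h4 : |t| ^ p ≤ (R⁻¹) ^ p :=
      Real.rpow_le_rpow (abs_nonneg _) (abs_le.2 ht) hp.le
    linarith [Real.add_one_le_exp (-|t| ^ p)]
  rw [intervalIntegral.integral_const, h1, smul_eq_mul] at h3
  have h5 : (1 - R⁻¹ ^ p) ≤ ∫ x, Real.sinc (R⁻¹ * x) ∂μ := by
    have h6 : 2 * R⁻¹ * (1 - R⁻¹ ^ p) ≤ 2 * R⁻¹ * ∫ x, Real.sinc (R⁻¹ * x) ∂μ := by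
      refine le_trans (le_of_eq ?_) (h3.trans (le_of_eq ?_))
      · ring
      · exact_mod_cast h2
    exact le_of_mul_le_mul_left h6 (by positivity)
  have hs : Integrable (fun x ↦ Real.sinc (R⁻¹ * x)) μ :=
    Integrable.of_bound (C := 1) (by fun_prop) (ae_of_all _ fun x ↦ Real.abs_sinc_le_one _)
  calc ∫ x, min 1 ((x / R) ^ 2) ∂μ ≤ ∫ x, 16 * (1 - Real.sinc (R⁻¹ * x)) ∂μ := by
        refine integral_mono (Integrable.of_bound (C := 1) (by fun_prop) (ae_of_all _ fun x ↦ ?_))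
          (((integrable_const _).sub hs).const_mul _) fun x ↦ ?_
        · rw [Real.norm_of_nonneg (by positivity)]
          exact min_le_left _ _
        · have := min_one_sq_le_one_sub_sinc (R⁻¹ * x)
          rwa [mul_comm R⁻¹ x] at this ⊢
    _ = 16 * (1 - ∫ x, Real.sinc (R⁻¹ * x) ∂μ) := by
        rw [integral_const_mul, integral_sub (integrable_const _) hs]
        simp
    _ ≤ 16 * R ^ (-p) := by
        rw [Real.inv_rpow hR.le, ← Real.rpow_neg hR.le] at h5
        linarith

theorem integral_min_sq_le (hμ : IsStableLaw p μ) (hp : 0 < p) {R : ℝ} (hR : 0 < R) :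
    ∫ x, min (R ^ 2) (x ^ 2) ∂μ ≤ 16 * R ^ (2 - p) := by
  have h : ∀ x : ℝ, min (R ^ 2) (x ^ 2) = R ^ 2 * min 1 ((x / R) ^ 2) := fun x ↦ by
    rw [mul_min_of_nonneg _ _ (by positivity)]
    congr 1
    · ring
    · field_simp
  simp_rw [h]
  rw [integral_const_mul]
  calc R ^ 2 * ∫ x, min 1 ((x / R) ^ 2) ∂μ ≤ R ^ 2 * (16 * R ^ (-p)) := by
        gcongr
        exact hμ.integral_min_one_sq_le hp hR
    _ = 16 * R ^ (2 - p) := by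
        rw [sub_eq_add_neg, Real.rpow_add hR, Real.rpow_two]
        ring

theorem measureReal_le_abs_le (hμ : IsStableLaw p μ) (hp : 0 < p) {R : ℝ} (hR : 0 < R) :
    μ.real {x | R ≤ |x|} ≤ 16 * R ^ (-p) := by
  refine le_trans ?_ (hμ.integral_min_one_sq_le hp hR)
  have hm : MeasurableSet {x : ℝ | R ≤ |x|} := measurableSet_le (by fun_prop) (by fun_prop)
  rw [← integral_indicator_one hm]
  refine integral_mono ((integrable_const (1 : ℝ)).indicator hm)
    (Integrable.of_bound (C := 1) (by fun_prop) (ae_of_all _ fun x ↦ ?_)) fun x ↦ ?_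
  · rw [Real.norm_of_nonneg (by positivity)]
    exact min_le_left _ _
  · by_cases hx : R ≤ |x|
    · rw [Set.indicator_of_mem (by exact hx), Pi.one_apply, div_pow]
      refine le_min le_rfl ?_
      rw [le_div_iff₀ (by positivity), one_mul]
      exact sq_le_sq' (by linarith [abs_nonneg x]) hx |>.trans (by rw [sq_abs])
    · rw [Set.indicator_of_notMem (by exact hx)]
      positivity

theorem lintegral_excess (ν : Measure ℝ) (R : ℝ) :
    ∫⁻ x, ENNReal.ofReal (max (|x| - R) 0) ∂ν = ∫⁻ t in Set.Ioi R, ν {x | t < |x|} := by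
  rw [lintegral_eq_lintegral_meas_lt ν (ae_of_all _ fun x ↦ le_max_right (|x| - R) 0)
    (by fun_prop)]
  have h := (measurePreserving_add_right (volume : Measure ℝ) R).setLIntegral_comp_preimage_emb
    (MeasurableEquiv.addRight R).measurableEmbedding (fun t ↦ ν {x | t < |x|}) (Set.Ioi R)
  have h2 : (fun x ↦ x + R) ⁻¹' Set.Ioi R = Set.Ioi 0 := by
    ext; simp
  rw [h2] at h
  rw [← h]
  refine setLIntegral_congr_fun measurableSet_Ioi fun t ht ↦ ?_
  have ht : (0 : ℝ) < t := ht
  congr 1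
  ext x
  simp only [lt_sup_iff, Set.mem_ofPred_eq]
  constructor
  · rintro (h | h) <;> linarith
  · intro h
    left
    linarith

theorem lintegral_rpow_Ioi (hp : 1 < p) {R : ℝ} (hR : 0 < R) {c : ℝ} (hc : 0 ≤ c) :
    ∫⁻ t in Set.Ioi R, ENNReal.ofReal (c * t ^ (-p)) =
      ENNReal.ofReal (c * (R ^ (1 - p) / (p - 1))) := by
  rw [← ofReal_integral_eq_lintegral_ofReal]
  · rw [integral_const_mul, integral_Ioi_rpow_of_lt (by linarith) hR]
    congr 2
    rw [show -p + 1 = -(p - 1) by ring, neg_div_neg_eq, show -(p - 1) = 1 - p by ring]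
  · exact (integrableOn_Ioi_rpow_of_lt (by linarith) hR).const_mul c
  · filter_upwards [ae_restrict_mem measurableSet_Ioi] with t ht
    have : 0 < t := hR.trans ht
    simp only [Pi.zero_apply]
    positivity

theorem lintegral_excess_le (hμ : IsStableLaw p μ) (hp : 1 < p) {R : ℝ} (hR : 0 < R) :
    ∫⁻ x, ENNReal.ofReal (max (|x| - R) 0) ∂μ ≤
      ENNReal.ofReal (16 * (R ^ (1 - p) / (p - 1))) := by
  rw [lintegral_excess, ← lintegral_rpow_Ioi hp hR (by norm_num)]
  refine setLIntegral_mono' measurableSet_Ioi fun t ht ↦ ?_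
  have h := hμ.measureReal_le_abs_le (by linarith) (hR.trans ht)
  calc μ {x | t < |x|} ≤ μ {x | t ≤ |x|} :=
        measure_mono fun x (hx : t < |x|) ↦ show t ≤ |x| from hx.le
    _ = ENNReal.ofReal (μ.real {x | t ≤ |x|}) := by simp
    _ ≤ _ := ENNReal.ofReal_le_ofReal h

theorem integrable_excess (hμ : IsStableLaw p μ) (hp : 1 < p) {R : ℝ} (hR : 0 < R) :
    Integrable (fun x ↦ max (|x| - R) 0) μ := by
  refine (lintegral_ofReal_ne_top_iff_integrable (by fun_prop)
    (ae_of_all _ fun x ↦ le_max_right (|x| - R) 0)).1 ?_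
  exact ((hμ.lintegral_excess_le hp hR).trans_lt ENNReal.ofReal_lt_top).ne

theorem integrable_id (hμ : IsStableLaw p μ) (hp : 1 < p) : Integrable (fun x : ℝ ↦ x) μ := by
  refine ((hμ.integrable_excess hp one_pos).add (integrable_const 1)).mono' (by fun_prop)
    (ae_of_all _ fun x ↦ ?_)
  simp only [Pi.add_apply, Real.norm_eq_abs]
  linarith [le_max_left (|x| - 1) 0]

theorem integral_excess_le (hμ : IsStableLaw p μ) (hp : 1 < p) {R : ℝ} (hR : 0 < R) :
    ∫ x, max (|x| - R) 0 ∂μ ≤ 16 * (R ^ (1 - p) / (p - 1)) := by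
  have hn : 0 ≤ 16 * (R ^ (1 - p) / (p - 1)) := by
    have : 0 < p - 1 := by linarith
    positivity
  rw [integral_eq_lintegral_of_nonneg_ae (ae_of_all _ fun x ↦ le_max_right (|x| - R) 0)
    (by fun_prop)]
  exact ENNReal.toReal_le_of_le_ofReal hn (hμ.lintegral_excess_le hp hR)

theorem half_le_integral_abs (hμ : IsStableLaw p μ) (hp : 1 < p) : 1 / 2 ≤ ∫ x, |x| ∂μ := by
  have h1 := hμ.one_sub_integral_cos 1
  have h2 : ∫ x, (1 - Real.cos (1 * x)) ∂μ ≤ ∫ x, |x| ∂μ := by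
    refine integral_mono ((integrable_const _).sub
      (Integrable.of_bound (C := 1) (by fun_prop) (ae_of_all _ fun x ↦ Real.abs_cos_le_one _)))
      (hμ.integrable_id hp).abs fun x ↦ ?_
    have h3 := Real.one_sub_sq_div_two_le_cos (x := x)
    simp only [one_mul]
    rcases le_total |x| 2 with h | h
    · have : x ^ 2 ≤ 2 * |x| := by
        rw [← sq_abs]
        nlinarith [abs_nonneg x]
      linarith
    · linarith [Real.neg_one_le_cos x]
  simp only [abs_one, Real.one_rpow] at h1
  have h4 : Real.exp (-1) ≤ 1 / 2 := by
    rw [Real.exp_neg, ← one_div]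
    exact one_div_le_one_div_of_le (by norm_num) (by linarith [Real.add_one_le_exp (1 : ℝ)])
  linarith

theorem le_measureReal_lt_abs (hμ : IsStableLaw p μ) (hp : 1 < p) (hp' : p ≤ 5 / 4) {s : ℝ}
    (hs : 1 ≤ s) : 1 / 16384 * s ^ (-p) ≤ μ.real {x | s < |x|} := by
  have hs0 : 0 < s := by linarith
  set δ : ℝ := (1 / 4) ^ 4 with hδ
  have hδ0 : 0 < δ := by positivity
  set t : ℝ := δ / s with ht
  have ht0 : 0 < t := by positivity
  have ht1 : t ≤ 1 := by
    rw [ht, div_le_one hs0]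
    norm_num [hδ]
    linarith
  have hm : MeasurableSet {x : ℝ | s < |x|} := measurableSet_lt (by fun_prop) (by fun_prop)
  have h1 : t ^ p / 2 ≤ 1 - Real.exp (-|t| ^ p) := by
    rw [abs_of_pos ht0]
    have h0 : 0 ≤ t ^ p := by positivity
    have h01 : t ^ p ≤ 1 := Real.rpow_le_one ht0.le ht1 (by linarith)
    have : Real.exp (-t ^ p) ≤ 1 / (1 + t ^ p) := by
      rw [Real.exp_neg, ← one_div]
      exact one_div_le_one_div_of_le (by linarith) (by linarith [Real.add_one_le_exp (t ^ p)])
    have : 1 / (1 + t ^ p) ≤ 1 - t ^ p / 2 := by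
      rw [div_le_iff₀ (by linarith)]
      nlinarith
    linarith
  have h2 : ∫ x, (1 - Real.cos (t * x)) ∂μ ≤
      ∫ x, (t ^ 2 / 2 * min (s ^ 2) (x ^ 2) + 2 * {x : ℝ | s < |x|}.indicator 1 x) ∂μ := by
    have hi1 : Integrable (fun x ↦ min (s ^ 2) (x ^ 2)) μ := by
      refine Integrable.of_bound (C := s ^ 2) (by fun_prop) (ae_of_all _ fun x ↦ ?_)
      rw [Real.norm_of_nonneg (by positivity)]
      exact min_le_left _ _
    have hi2 : Integrable ({x : ℝ | s < |x|}.indicator (1 : ℝ → ℝ)) μ :=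
      (integrable_const (1 : ℝ)).indicator hm
    refine integral_mono ((integrable_const _).sub
      (Integrable.of_bound (C := 1) (by fun_prop) (ae_of_all _ fun x ↦ Real.abs_cos_le_one _)))
      ((hi1.const_mul _).add (hi2.const_mul _)) fun x ↦ ?_
    by_cases hx : s < |x|
    · simp only
      rw [Set.indicator_of_mem (by exact hx), Pi.one_apply]
      have : 0 ≤ t ^ 2 / 2 * min (s ^ 2) (x ^ 2) := by positivity
      linarith [Real.neg_one_le_cos (t * x)]
    · simp only
      rw [Set.indicator_of_notMem (by exact hx), min_eq_right]
      · nlinarith [Real.one_sub_sq_div_two_le_cos (x := t * x)]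
      · rw [← sq_abs x]
        exact pow_le_pow_left₀ (abs_nonneg _) (not_lt.1 hx) 2
  have h3 : ∫ x, (t ^ 2 / 2 * min (s ^ 2) (x ^ 2) + 2 * {x : ℝ | s < |x|}.indicator 1 x) ∂μ =
      t ^ 2 / 2 * ∫ x, min (s ^ 2) (x ^ 2) ∂μ + 2 * μ.real {x | s < |x|} := by
    have hi1 : Integrable (fun x ↦ min (s ^ 2) (x ^ 2)) μ := by
      refine Integrable.of_bound (C := s ^ 2) (by fun_prop) (ae_of_all _ fun x ↦ ?_)
      rw [Real.norm_of_nonneg (by positivity)]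
      exact min_le_left _ _
    have hi2 : Integrable ({x : ℝ | s < |x|}.indicator (1 : ℝ → ℝ)) μ :=
      (integrable_const (1 : ℝ)).indicator hm
    rw [integral_add (hi1.const_mul _) (hi2.const_mul _), integral_const_mul, integral_const_mul,
      integral_indicator_one hm]
  rw [hμ.one_sub_integral_cos, h3] at h2
  have h4 := hμ.integral_min_sq_le (by linarith) hs0
  have h5 : t ^ 2 / 2 * ∫ x, min (s ^ 2) (x ^ 2) ∂μ ≤ t ^ 2 / 2 * (16 * s ^ (2 - p)) := by gcongr
  have h6 : t ^ 2 / 2 * (16 * s ^ (2 - p)) = 8 * δ ^ 2 * s ^ (-p) := by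
    rw [ht, show 2 - p = -p + 2 by ring, Real.rpow_add hs0, Real.rpow_two]
    field_simp
    norm_num
  have h7 : t ^ p = δ ^ p * s ^ (-p) := by
    rw [ht, Real.div_rpow hδ0.le hs0.le, Real.rpow_neg hs0.le]
    rfl
  have h8 : (1 / 4 : ℝ) ^ 5 ≤ δ ^ p := by
    have : (1 / 4 : ℝ) ^ 5 = δ ^ (5 / 4 : ℝ) := by
      rw [hδ, ← Real.rpow_natCast, ← Real.rpow_natCast, ← Real.rpow_mul (by norm_num)]
      norm_num
    rw [this]
    exact Real.rpow_le_rpow_of_exponent_ge hδ0 (by norm_num [hδ]) hp'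
  have h9 : 0 < s ^ (-p) := Real.rpow_pos_of_pos hs0 _
  rw [h7] at h1
  have h10 : (1 / 4 : ℝ) ^ 5 * s ^ (-p) ≤ δ ^ p * s ^ (-p) := by gcongr
  rw [h6] at h5
  norm_num [hδ] at h5 h10 ⊢
  linarith

theorem le_integral_excess (hμ : IsStableLaw p μ) (hp : 1 < p) (hp' : p ≤ 5 / 4) {R : ℝ}
    (hR : 1 ≤ R) : 1 / 16384 * (R ^ (1 - p) / (p - 1)) ≤ ∫ x, max (|x| - R) 0 ∂μ := by
  have hR0 : 0 < R := by linarith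
  rw [integral_eq_lintegral_of_nonneg_ae (ae_of_all _ fun x ↦ le_max_right (|x| - R) 0)
    (by fun_prop)]
  refine (ENNReal.ofReal_le_iff_le_toReal
    ((hμ.lintegral_excess_le hp hR0).trans_lt ENNReal.ofReal_lt_top).ne).1 ?_
  rw [lintegral_excess, ← lintegral_rpow_Ioi hp hR0 (by norm_num)]
  refine setLIntegral_mono' measurableSet_Ioi fun t ht ↦ ?_
  refine (ENNReal.ofReal_le_ofReal (hμ.le_measureReal_lt_abs hp hp'
    (hR.trans (le_of_lt ht)))).trans ?_
  simp

theorem le_integral_abs (hμ : IsStableLaw p μ) (hp : 1 < p) (hp' : p ≤ 5 / 4) :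
    1 / 16384 * (1 / (p - 1)) ≤ ∫ x, |x| ∂μ := by
  have h := hμ.le_integral_excess hp hp' le_rfl
  rw [Real.one_rpow] at h
  refine h.trans (integral_mono (hμ.integrable_excess hp one_pos) (hμ.integrable_id hp).abs
    fun x ↦ ?_)
  exact max_le (by linarith) (abs_nonneg _)

end IsStableLaw

/-- Integer points of the `ℓ_p` ball of radius `2 ^ b`. -/
noncomputable def latticeBall (p : ℝ) (d b : ℕ) : Finset (Fin d → ℤ) :=
  {k ∈ Fintype.piFinset fun _ ↦ Finset.Icc (-(2 ^ b : ℤ)) (2 ^ b) |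
    ∑ i, |(k i : ℝ)| ^ p ≤ ((2 : ℝ) ^ b) ^ p}

/-- The dyadic point `k / 2 ^ b`. -/
noncomputable def dyadicPoint {d : ℕ} (b : ℕ) (k : Fin d → ℤ) : Fin d → ℝ :=
  fun i ↦ (k i : ℝ) / 2 ^ b

/-- Coordinatewise division by two, rounding towards zero. -/
def halve {d : ℕ} (k : Fin d → ℤ) : Fin d → ℤ := fun i ↦ (k i).tdiv 2

/-- The predecessor of `dyadicPoint b k` in the dyadic chain. -/
noncomputable def dyadicPred {d : ℕ} (b : ℕ) (k : Fin d → ℤ) : Fin d → ℝ :=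
  fun i ↦ 2 * (halve k i : ℝ) / 2 ^ b

theorem mem_latticeBall {p : ℝ} {d b : ℕ} (hp : 0 < p) {k : Fin d → ℤ} :
    k ∈ latticeBall p d b ↔ ∑ i, |(k i : ℝ)| ^ p ≤ ((2 : ℝ) ^ b) ^ p := by
  rw [latticeBall, Finset.mem_filter, and_iff_right_iff_imp, Fintype.mem_piFinset]
  intro h i
  have h1 : |(k i : ℝ)| ^ p ≤ ((2 : ℝ) ^ b) ^ p :=
    (Finset.single_le_sum (f := fun i ↦ |(k i : ℝ)| ^ p) (fun i _ ↦ by positivity)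
      (Finset.mem_univ i)).trans h
  have h2 : |(k i : ℝ)| ≤ (2 : ℝ) ^ b :=
    (Real.rpow_le_rpow_iff (by positivity) (by positivity) hp).1 h1
  rw [Finset.mem_Icc, ← abs_le]
  exact_mod_cast h2

theorem abs_two_mul_tdiv_le (k : ℤ) : |2 * (k.tdiv 2 : ℝ)| ≤ |(k : ℝ)| := by
  have : |2 * k.tdiv 2| ≤ |k| := by
    rcases le_total 0 k with h | h
    · rw [Int.tdiv_eq_ediv_of_nonneg h, abs_of_nonneg h, abs_of_nonneg] <;> omega
    · obtain ⟨m, rfl⟩ : ∃ m, k = -m := ⟨-k, by ring⟩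
      have hm : 0 ≤ m := by omega
      rw [Int.neg_tdiv, Int.tdiv_eq_ediv_of_nonneg hm, mul_neg, abs_neg, abs_neg,
        abs_of_nonneg hm, abs_of_nonneg] <;> omega
  exact_mod_cast this

theorem abs_sub_two_mul_tdiv (k : ℤ) : k = 2 * k.tdiv 2 ∨
    (|(k : ℝ) - 2 * (k.tdiv 2 : ℝ)| = 1 ∧ 0 ≤ (k.tdiv 2 : ℝ) * ((k : ℝ) - 2 * (k.tdiv 2 : ℝ)) ∧
      1 ≤ |(k : ℝ)|) := by
  suffices h : k = 2 * k.tdiv 2 ∨ (|k - 2 * k.tdiv 2| = 1 ∧ 0 ≤ k.tdiv 2 * (k - 2 * k.tdiv 2) ∧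
      1 ≤ |k|) by exact_mod_cast h
  rcases le_total 0 k with h | h
  · rw [Int.tdiv_eq_ediv_of_nonneg h]
    have : k % 2 = 0 ∨ k % 2 = 1 := by omega
    rcases this with h1 | h1
    · left; omega
    · right
      rw [show k - 2 * (k / 2) = 1 by omega, abs_of_nonneg h]
      refine ⟨rfl, by omega, by omega⟩
  · obtain ⟨m, rfl⟩ : ∃ m, k = -m := ⟨-k, by ring⟩
    have hm : 0 ≤ m := by omega
    rw [Int.neg_tdiv, Int.tdiv_eq_ediv_of_nonneg hm]
    have : m % 2 = 0 ∨ m % 2 = 1 := by omega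
    rcases this with h1 | h1
    · left; omega
    · right
      rw [show -m - 2 * -(m / 2) = -1 by omega, abs_neg, abs_one, abs_neg, abs_of_nonneg hm]
      refine ⟨rfl, by omega, by omega⟩

theorem halve_mem_latticeBall {p : ℝ} {d b : ℕ} (hp : 0 < p) {k : Fin d → ℤ}
    (hk : k ∈ latticeBall p d (b + 1)) : halve k ∈ latticeBall p d b := by
  rw [mem_latticeBall hp] at hk ⊢
  have h2 : (0 : ℝ) < 2 ^ p := by positivity
  have h : 2 ^ p * ∑ i, |(halve k i : ℝ)| ^ p ≤ 2 ^ p * ((2 : ℝ) ^ b) ^ p := by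
    rw [← Real.mul_rpow (by norm_num) (by positivity), ← pow_succ', Finset.mul_sum]
    refine le_trans (Finset.sum_le_sum fun i _ ↦ ?_) hk
    rw [← Real.mul_rpow (by norm_num) (abs_nonneg _)]
    refine Real.rpow_le_rpow (by positivity) ?_ hp.le
    have := abs_two_mul_tdiv_le (k i)
    rwa [abs_mul, abs_two] at this
  exact le_of_mul_le_mul_left h h2

theorem dyadicPred_succ {d : ℕ} (b : ℕ) (k : Fin d → ℤ) :
    dyadicPred (b + 1) k = dyadicPoint b (halve k) := by
  ext i
  simp only [dyadicPred, dyadicPoint, pow_succ]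
  field_simp

theorem dyadicPred_zero {p : ℝ} {d : ℕ} {k : Fin d → ℤ} (hk : k ∈ latticeBall p d 0) :
    dyadicPred 0 k = 0 := by
  ext i
  rw [latticeBall, Finset.mem_filter, Fintype.mem_piFinset] at hk
  have := Finset.mem_Icc.1 (hk.1 i)
  have h2 : halve k i = 0 := by
    simp only [halve]
    have h3 : k i = -1 ∨ k i = 0 ∨ k i = 1 := by omega
    rcases h3 with h | h | h <;> rw [h] <;> rfl
  simp [dyadicPred, h2]

/-- One link of the dyadic chain: `x'` lies in the unit ball and is obtained from `x` by moving
the coordinates in `S` away from zero by `2 ^ (-b)`. -/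
structure IsDyadicStep (p : ℝ) {d : ℕ} (b : ℕ) (x x' : Fin d → ℝ) (S : Finset (Fin d)) : Prop where
  sum_le : ∑ i, |x' i| ^ p ≤ 1
  eq_of_notMem : ∀ i ∉ S, x' i = x i
  abs_sub : ∀ i ∈ S, |x' i - x i| = ((2 : ℝ) ^ b)⁻¹
  mul_nonneg : ∀ i ∈ S, 0 ≤ x i * (x' i - x i)
  card_le : (S.card : ℝ) ≤ ((2 : ℝ) ^ b) ^ p

theorem isDyadicStep_of_mem {p : ℝ} {d b : ℕ} (hp : 0 < p) {k : Fin d → ℤ}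
    (hk : k ∈ latticeBall p d b) :
    ∃ S, IsDyadicStep p b (dyadicPred b k) (dyadicPoint b k) S := by
  rw [mem_latticeBall hp] at hk
  have hb : (0 : ℝ) < 2 ^ b := by positivity
  refine ⟨Finset.univ.filter fun i ↦ k i ≠ 2 * halve k i, ?_, ?_, ?_, ?_, ?_⟩
  · simp only [dyadicPoint, abs_div, abs_of_pos hb]
    simp_rw [Real.div_rpow (abs_nonneg _) hb.le]
    rw [← Finset.sum_div, div_le_one (by positivity)]
    exact hk
  · intro i hi
    have hi : k i = 2 * halve k i := by simpa using hi
    simp only [dyadicPoint, dyadicPred]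
    congr 1
    exact_mod_cast hi
  · intro i hi
    have hi : k i ≠ 2 * halve k i := by simpa using hi
    have h := ((abs_sub_two_mul_tdiv (k i)).resolve_left hi).1
    simp only [dyadicPoint, dyadicPred, ← sub_div, abs_div, abs_of_pos hb]
    rw [show halve k i = (k i).tdiv 2 from rfl, h, one_div]
  · intro i hi
    have hi : k i ≠ 2 * halve k i := by simpa using hi
    have h := ((abs_sub_two_mul_tdiv (k i)).resolve_left hi).2.1
    simp only [dyadicPoint, dyadicPred, ← sub_div]
    rw [show halve k i = (k i).tdiv 2 from rfl, div_mul_div_comm, mul_assoc]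
    positivity
  · refine le_trans ?_ hk
    rw [Finset.card_eq_sum_ones, Nat.cast_sum]
    refine le_trans (Finset.sum_le_sum fun i hi ↦ ?_)
      (Finset.sum_le_sum_of_subset_of_nonneg (Finset.subset_univ _) fun i _ _ ↦ by positivity)
    have hi : k i ≠ 2 * halve k i := by simpa using hi
    have h := ((abs_sub_two_mul_tdiv (k i)).resolve_left hi).2.2
    simpa using Real.one_le_rpow h hp.le

/-- Dyadic points exhaust the unit ball. -/
theorem exists_dyadicPoint_near {p : ℝ} {d : ℕ} (hp : 0 < p) {x : Fin d → ℝ}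
    (hx : ∑ i, |x i| ^ p ≤ 1) (b : ℕ) :
    ∃ k ∈ latticeBall p d b, ∀ i, |dyadicPoint b k i - x i| ≤ ((2 : ℝ) ^ b)⁻¹ := by
  have hb : (0 : ℝ) < 2 ^ b := by positivity
  have key : ∀ y : ℝ, ∃ n : ℤ, |(n : ℝ)| ≤ |2 ^ b * y| ∧ |(n : ℝ) - 2 ^ b * y| ≤ 1 := by
    intro y
    rcases le_total 0 (2 ^ b * y) with h | h
    · refine ⟨⌊2 ^ b * y⌋, ?_, ?_⟩
      · rw [abs_of_nonneg h, abs_of_nonneg (by exact_mod_cast Int.floor_nonneg.2 h)]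
        exact Int.floor_le _
      · rw [abs_le]
        constructor <;> linarith [Int.floor_le (2 ^ b * y), Int.lt_floor_add_one (2 ^ b * y)]
    · refine ⟨⌈2 ^ b * y⌉, ?_, ?_⟩
      · have : ((⌈2 ^ b * y⌉ : ℤ) : ℝ) ≤ 0 := by exact_mod_cast Int.ceil_le.2 (by simpa using h)
        rw [abs_of_nonpos h, abs_of_nonpos this]
        linarith [Int.le_ceil (2 ^ b * y)]
      · rw [abs_le]
        constructor <;> linarith [Int.le_ceil (2 ^ b * y), Int.ceil_lt_add_one (2 ^ b * y)]
  choose n hn1 hn2 using key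
  refine ⟨fun i ↦ n (x i), ?_, fun i ↦ ?_⟩
  · rw [mem_latticeBall hp]
    calc ∑ i, |(n (x i) : ℝ)| ^ p ≤ ∑ i, ((2 : ℝ) ^ b) ^ p * |x i| ^ p := by
          refine Finset.sum_le_sum fun i _ ↦ ?_
          rw [← Real.mul_rpow hb.le (abs_nonneg _)]
          refine Real.rpow_le_rpow (abs_nonneg _) ?_ hp.le
          have := hn1 (x i)
          rwa [abs_mul, abs_of_pos hb] at this
      _ ≤ ((2 : ℝ) ^ b) ^ p := by
          rw [← Finset.mul_sum]
          exact mul_le_of_le_one_right (by positivity) hx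
  · have := hn2 (x i)
    simp only [dyadicPoint]
    rw [show (n (x i) : ℝ) / 2 ^ b - x i = ((n (x i) : ℝ) - 2 ^ b * x i) / 2 ^ b by field_simp,
      abs_div, abs_of_pos hb, ← one_div]
    gcongr

/-- The deterministic part of the chaining argument. -/
theorem abs_le_of_dyadic_increments {p : ℝ} {d : ℕ} (hp : 0 < p) {g : (Fin d → ℝ) → ℝ} {K : ℝ}
    (hg0 : g 0 = 0) (hg : ∀ x y, |g x - g y| ≤ K * ∑ i, |x i - y i|) {τ : ℕ → ℝ} {T : ℝ}
    (hT : ∀ n, ∑ b ∈ Finset.range n, τ b ≤ T)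
    (h : ∀ b, ∀ k ∈ latticeBall p d b, |g (dyadicPoint b k) - g (dyadicPred b k)| ≤ τ b)
    {x : Fin d → ℝ} (hx : ∑ i, |x i| ^ p ≤ 1) : |g x| ≤ T := by
  have h1 : ∀ b, ∀ k ∈ latticeBall p d b,
      |g (dyadicPoint b k)| ≤ ∑ j ∈ Finset.range (b + 1), τ j := by
    intro b
    induction b with
    | zero =>
      intro k hk
      have := h 0 k hk
      rw [dyadicPred_zero hk, hg0, sub_zero] at this
      simpa using this
    | succ b ih =>
      intro k hk
      have h2 := h _ k hk
      rw [dyadicPred_succ] at h2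
      have h3 := ih _ (halve_mem_latticeBall hp hk)
      rw [Finset.sum_range_succ]
      have h4 := abs_sub_abs_le_abs_sub (g (dyadicPoint (b + 1) k)) (g (dyadicPoint b (halve k)))
      linarith
  have h5 : ∀ b : ℕ, |g x| ≤ T + K * d * ((2 : ℝ) ^ b)⁻¹ := by
    intro b
    obtain ⟨k, hk, hkx⟩ := exists_dyadicPoint_near hp hx b
    have h6 := (h1 b k hk).trans (hT _)
    have h7 := hg x (dyadicPoint b k)
    rcases Nat.eq_zero_or_pos d with rfl | hd
    · have : x = 0 := Subsingleton.elim _ _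
      rw [this, hg0]
      have := hT 0
      simpa using this
    have hK : 0 ≤ K := by
      have h8 := (abs_nonneg _).trans (hg (fun _ ↦ 1) 0)
      simp only [Pi.zero_apply, sub_zero, abs_one, Finset.sum_const, Finset.card_univ,
        Fintype.card_fin, nsmul_eq_mul, mul_one] at h8
      exact nonneg_of_mul_nonneg_left h8 (by exact_mod_cast hd)
    have h9 : ∑ i, |x i - dyadicPoint b k i| ≤ d * ((2 : ℝ) ^ b)⁻¹ := by
      refine (Finset.sum_le_sum fun i _ ↦ (abs_sub_comm _ _).trans_le (hkx i)).trans ?_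
      simp
    have h10 := abs_sub_abs_le_abs_sub (g x) (g (dyadicPoint b k))
    have h11 := mul_le_mul_of_nonneg_left h9 hK
    linarith
  have h12 : Tendsto (fun b : ℕ ↦ T + K * d * ((2 : ℝ) ^ b)⁻¹) atTop (𝓝 T) := by
    have h13 : Tendsto (fun b : ℕ ↦ ((2 : ℝ) ^ b)⁻¹) atTop (𝓝 0) :=
      (tendsto_pow_atTop_atTop_of_one_lt one_lt_two).inv_tendsto_atTop
    simpa using (h13.const_mul (K * d)).const_add T
  exact ge_of_tendsto' h12 h5

/-- Chernoff-type bound for the number of lattice points. -/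
theorem card_latticeBall_le {p : ℝ} (hp : 1 ≤ p) (d b : ℕ) {s : ℝ} (hs : 0 < s) :
    ((latticeBall p d b).card : ℝ) ≤
      Real.exp (s * ((2 : ℝ) ^ b) ^ p) * (1 + 2 / (Real.exp s - 1)) ^ d := by
  have hgeom : ∀ n : ℕ, ∑ j ∈ Finset.Icc (-(n : ℤ)) n, Real.exp (-s * |(j : ℝ)|) ≤
      1 + 2 / (Real.exp s - 1) := by
    intro n
    have hes : 0 < Real.exp s - 1 := by linarith [Real.add_one_lt_exp hs.ne']
    suffices h : ∑ j ∈ Finset.Icc (-(n : ℤ)) n, Real.exp (-s * |(j : ℝ)|) ≤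
        1 + 2 / (Real.exp s - 1) * (1 - Real.exp (-s * n)) by
      refine h.trans ?_
      have : 0 ≤ 2 / (Real.exp s - 1) := by positivity
      nlinarith [Real.exp_pos (-s * n)]
    induction n with
    | zero => simp
    | succ n ih =>
      have hset : Finset.Icc (-((n + 1 : ℕ) : ℤ)) ((n + 1 : ℕ) : ℤ) =
          insert (-((n + 1 : ℕ) : ℤ)) (insert (((n + 1 : ℕ) : ℤ)) (Finset.Icc (-(n : ℤ)) n)) := by
        ext j
        simp only [Finset.mem_insert, Finset.mem_Icc]
        omega
      rw [hset, Finset.sum_insert, Finset.sum_insert]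
      · have e1 : Real.exp (-s * ((n + 1 : ℕ) : ℝ)) = Real.exp (-s * n) / Real.exp s := by
          rw [← Real.exp_sub]
          congr 1
          push_cast
          ring
        have e2 : |((-((n + 1 : ℕ) : ℤ) : ℤ) : ℝ)| = ((n + 1 : ℕ) : ℝ) := by
          push_cast
          rw [abs_neg, abs_of_nonneg (by positivity)]
        have e3 : |((((n + 1 : ℕ) : ℤ) : ℤ) : ℝ)| = ((n + 1 : ℕ) : ℝ) := by
          push_cast
          rw [abs_of_nonneg (by positivity)]
        rw [e2, e3, e1]
        have e4 : 2 / (Real.exp s - 1) * (1 - Real.exp (-s * n) / Real.exp s) =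
            2 / (Real.exp s - 1) * (1 - Real.exp (-s * n)) +
              2 * (Real.exp (-s * n) / Real.exp s) := by
          field_simp
          ring
        linarith
      · simp
      · simp only [Finset.mem_insert, Finset.mem_Icc]
        omega
  have hle : ∀ k ∈ latticeBall p d b,
      (1 : ℝ) ≤ Real.exp (s * ((2 : ℝ) ^ b) ^ p) * ∏ i, Real.exp (-s * |(k i : ℝ)|) := by
    intro k hk
    rw [mem_latticeBall (by linarith)] at hk
    rw [← Real.exp_sum, ← Real.exp_add]
    refine Real.one_le_exp ?_
    rw [← Finset.mul_sum]
    have : ∑ i, |(k i : ℝ)| ≤ ∑ i, |(k i : ℝ)| ^ p := by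
      refine Finset.sum_le_sum fun i _ ↦ ?_
      rcases eq_or_ne (k i) 0 with h | h
      · simp [h, Real.zero_rpow (by linarith : p ≠ 0)]
      · have h1 : (1 : ℝ) ≤ |(k i : ℝ)| := by exact_mod_cast Int.one_le_abs h
        calc |(k i : ℝ)| = |(k i : ℝ)| ^ (1 : ℝ) := (Real.rpow_one _).symm
          _ ≤ _ := Real.rpow_le_rpow_of_exponent_le h1 hp
    nlinarith
  calc ((latticeBall p d b).card : ℝ) = ∑ k ∈ latticeBall p d b, (1 : ℝ) := by simp
    _ ≤ ∑ k ∈ latticeBall p d b,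
        Real.exp (s * ((2 : ℝ) ^ b) ^ p) * ∏ i, Real.exp (-s * |(k i : ℝ)|) :=
        Finset.sum_le_sum hle
    _ ≤ ∑ k ∈ Fintype.piFinset fun _ : Fin d ↦ Finset.Icc (-(2 ^ b : ℤ)) (2 ^ b),
        Real.exp (s * ((2 : ℝ) ^ b) ^ p) * ∏ i, Real.exp (-s * |(k i : ℝ)|) :=
        Finset.sum_le_sum_of_subset_of_nonneg (Finset.filter_subset _ _)
          fun k _ _ ↦ by positivity
    _ = Real.exp (s * ((2 : ℝ) ^ b) ^ p) *
        ∏ _i : Fin d, ∑ j ∈ Finset.Icc (-(2 ^ b : ℤ)) (2 ^ b), Real.exp (-s * |(j : ℝ)|) := by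
        rw [← Finset.mul_sum, Finset.prod_univ_sum]
    _ ≤ _ := by
        rw [Finset.prod_const, Finset.card_univ, Fintype.card_fin]
        have := hgeom (2 ^ b)
        push_cast at this
        gcongr

/-- The exponent bounding the metric entropy at relative scale `β`. -/
noncomputable def entropyBound (p : ℝ) (d : ℕ) (β : ℝ) : ℝ :=
  d * (min 1 (β ^ p) * (4 + 2 * |Real.log β|))

theorem card_latticeBall_le_exp {p : ℝ} (hp : 1 ≤ p) (hp2 : p ≤ 2) {d : ℕ} (hd : 1 ≤ d) (b : ℕ) :
    ((latticeBall p d b).card : ℝ) ≤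
      Real.exp (entropyBound p d (2 ^ b / (d : ℝ) ^ (1 / p))) := by
  have hd0 : (0 : ℝ) < d := by exact_mod_cast hd
  set D : ℝ := (d : ℝ) ^ (1 / p) with hD
  have hD0 : 0 < D := by positivity
  have hDp : D ^ p = d := by
    rw [hD, ← Real.rpow_mul hd0.le, one_div, inv_mul_cancel₀ (by linarith), Real.rpow_one]
  set β : ℝ := 2 ^ b / D with hβ
  have hβ0 : 0 < β := by positivity
  have hm : ((2 : ℝ) ^ b) ^ p = d * β ^ p := by
    rw [hβ, Real.div_rpow (by positivity) hD0.le, hDp]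
    field_simp
  have hlog : Real.log (β ^ p) = p * Real.log β := Real.log_rpow hβ0 p
  have hβp : 0 < β ^ p := by positivity
  rw [entropyBound]
  rcases le_total β 1 with h | h
  · have hβp1 : β ^ p ≤ 1 := Real.rpow_le_one hβ0.le h (by linarith)
    have hs : 0 < Real.log (1 + 1 / β ^ p) := Real.log_pos (by
      have : 0 < 1 / β ^ p := by positivity
      linarith)
    refine (card_latticeBall_le hp d b hs).trans ?_
    rw [Real.exp_log (by positivity), hm, min_eq_right hβp1,
      abs_of_nonpos (Real.log_nonpos hβ0.le h)]
    have hsimp : 2 / (1 + 1 / β ^ p - 1) = 2 * β ^ p := by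
      rw [add_sub_cancel_left]
      field_simp
    have h1 : (1 + 2 / (1 + 1 / β ^ p - 1)) ^ d ≤ Real.exp (d * (2 * β ^ p)) := by
      rw [Real.exp_nat_mul, hsimp]
      refine pow_le_pow_left₀ (by positivity) ?_ d
      linarith [Real.add_one_le_exp (2 * β ^ p)]
    have h2 : Real.log (1 + 1 / β ^ p) ≤ 1 - 2 * Real.log β := by
      have h3 : 1 + 1 / β ^ p ≤ 2 * (β ^ p)⁻¹ := by
        rw [one_div]
        have := (one_le_inv₀ hβp).2 hβp1
        linarith
      calc Real.log (1 + 1 / β ^ p) ≤ Real.log (2 * (β ^ p)⁻¹) :=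
            Real.log_le_log (by positivity) h3
        _ = Real.log 2 - p * Real.log β := by
            rw [Real.log_mul (by norm_num) (by positivity), Real.log_inv, hlog]
            ring
        _ ≤ 1 - 2 * Real.log β := by
            nlinarith [Real.log_two_lt_d9, Real.log_nonpos hβ0.le h]
    calc _ ≤ Real.exp ((1 - 2 * Real.log β) * (d * β ^ p)) * Real.exp (d * (2 * β ^ p)) := by
          refine mul_le_mul ?_ h1 (by rw [hsimp]; positivity) (by positivity)
          gcongr
      _ ≤ _ := by
          rw [← Real.exp_add]
          refine Real.exp_le_exp.2 ?_
          have h4 : 0 < d * β ^ p := by positivity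
          nlinarith
  · have hβp1 : 1 ≤ β ^ p := Real.one_le_rpow h (by linarith)
    have hs : 0 < 1 / β ^ p := by positivity
    refine (card_latticeBall_le hp d b hs).trans ?_
    rw [hm, min_eq_left hβp1, abs_of_nonneg (Real.log_nonneg h)]
    have h1 : 1 + 2 / (Real.exp (1 / β ^ p) - 1) ≤ Real.exp (2 + 2 * Real.log β) := by
      have h2 : 1 / β ^ p ≤ Real.exp (1 / β ^ p) - 1 := by
        linarith [Real.add_one_le_exp (1 / β ^ p)]
      have h3 : 2 / (Real.exp (1 / β ^ p) - 1) ≤ 2 * β ^ p := by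
        calc _ ≤ 2 / (1 / β ^ p) := by gcongr
          _ = _ := by field_simp
      have h4 : β ^ p ≤ Real.exp (2 * Real.log β) := by
        rw [← Real.exp_log hβp, hlog]
        refine Real.exp_le_exp.2 ?_
        nlinarith [Real.log_nonneg h]
      rw [Real.exp_add]
      have h5 : 3 ≤ Real.exp 2 := by linarith [Real.add_one_le_exp (2 : ℝ)]
      nlinarith [Real.exp_pos (2 * Real.log β)]
    calc _ ≤ Real.exp (1 / β ^ p * (d * β ^ p)) * Real.exp (2 + 2 * Real.log β) ^ d := by
          have : 0 < Real.exp (1 / β ^ p) - 1 := by linarith [Real.add_one_lt_exp hs.ne']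
          gcongr
      _ ≤ _ := by
          rw [← Real.exp_nat_mul, ← Real.exp_add]
          refine Real.exp_le_exp.2 ?_
          have : 1 / β ^ p * (d * β ^ p) = d := by field_simp
          rw [this]
          have := Real.log_nonneg h
          nlinarith

theorem le_entropyBound {p : ℝ} (hp : 1 ≤ p) {d : ℕ} (hd : 1 ≤ d) (b : ℕ) :
    3 + b * Real.log 2 ≤ entropyBound p d (2 ^ b / (d : ℝ) ^ (1 / p)) := by
  have hd0 : (0 : ℝ) < d := by exact_mod_cast hd
  have hd1 : (1 : ℝ) ≤ d := by exact_mod_cast hd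
  set D : ℝ := (d : ℝ) ^ (1 / p) with hD
  have hD0 : 0 < D := by positivity
  have hDp : D ^ p = d := by
    rw [hD, ← Real.rpow_mul hd0.le, one_div, inv_mul_cancel₀ (by linarith), Real.rpow_one]
  set β : ℝ := 2 ^ b / D with hβ
  have hβ0 : 0 < β := by positivity
  have hm : ((2 : ℝ) ^ b) ^ p = d * β ^ p := by
    rw [hβ, Real.div_rpow (by positivity) hD0.le, hDp]
    field_simp
  rw [entropyBound]
  have hlog2 : Real.log 2 ≤ 1 := by linarith [Real.log_two_lt_d9]
  rcases le_total β 1 with h | h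
  · have hβp1 : β ^ p ≤ 1 := Real.rpow_le_one hβ0.le h (by linarith)
    rw [min_eq_right hβp1, ← mul_assoc, ← hm]
    have h1 : (1 : ℝ) + b ≤ ((2 : ℝ) ^ b) ^ p := by
      have h2 : (2 : ℝ) ^ b ≤ ((2 : ℝ) ^ b) ^ p := by
        calc (2 : ℝ) ^ b = ((2 : ℝ) ^ b) ^ (1 : ℝ) := (Real.rpow_one _).symm
          _ ≤ _ := Real.rpow_le_rpow_of_exponent_le (one_le_pow₀ one_le_two) hp
      have h3 : ((b + 1 : ℕ) : ℝ) ≤ (2 : ℝ) ^ b := by exact_mod_cast Nat.lt_two_pow_self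
      push_cast at h3
      linarith
    have h4 : (0 : ℝ) ≤ b := by positivity
    have h5 := abs_nonneg (Real.log β)
    nlinarith
  · have hβp1 : 1 ≤ β ^ p := Real.one_le_rpow h (by linarith)
    rw [min_eq_left hβp1, abs_of_nonneg (Real.log_nonneg h), one_mul]
    have h1 : Real.log β = b * Real.log 2 - 1 / p * Real.log d := by
      rw [hβ, Real.log_div (by positivity) hD0.ne', Real.log_pow, hD, Real.log_rpow hd0]
    have h2 : Real.log d ≤ d - 1 := Real.log_le_sub_one_of_pos hd0
    have h3 : 0 ≤ Real.log d := Real.log_nonneg hd1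
    have h4 : 1 / p ≤ 1 := by rw [div_le_one (by linarith)]; exact hp
    have h5 : 1 / p * Real.log d ≤ Real.log d := mul_le_of_le_one_left h3 h4
    have h6 := Real.log_nonneg h
    nlinarith

theorem entropyBound_pos {p : ℝ} {d : ℕ} (hd : 1 ≤ d) {β : ℝ} (hβ : 0 < β) :
    0 < entropyBound p d β := by
  have hd0 : (0 : ℝ) < d := by exact_mod_cast hd
  have := abs_nonneg (Real.log β)
  have : 0 < min 1 (β ^ p) := lt_min one_pos (by positivity)
  rw [entropyBound]
  positivity

/-- Two-sided geometric sums over dyadic scales. -/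
theorem sum_min_rpow_le {β₀ s : ℝ} (hβ : 0 < β₀) (hs : 0 < s) (hs1 : s ≤ 1) (n : ℕ) :
    ∑ b ∈ Finset.range n, (min (2 ^ b * β₀) (2 ^ b * β₀)⁻¹) ^ s ≤ 4 / s := by
  set y : ℝ := (1 / 2) ^ s with hy
  have hy0 : 0 < y := by positivity
  have hy1 : y ≤ 1 - s / 2 := by
    have := rpow_one_add_le_one_add_mul_self (s := -(1 / 2)) (by norm_num) hs.le hs1
    rw [hy]
    norm_num at this ⊢
    linarith
  have hy2 : 0 < 1 - y := by linarith
  let Φ : ℝ → ℝ := fun β ↦ if β ≤ 1 then y * β ^ s / (1 - y) else (2 - (β⁻¹) ^ s) / (1 - y)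
  have hΦ : ∀ β, 0 < β → Φ β ≤ 2 / (1 - y) := by
    intro β hβ
    simp only [Φ]
    split_ifs with h
    · have : β ^ s ≤ 1 := Real.rpow_le_one hβ.le h hs.le
      have : 0 < β ^ s := by positivity
      gcongr
      nlinarith
    · have : 0 < (β⁻¹) ^ s := by positivity
      gcongr
      linarith
  have hΦ0 : ∀ β, 0 < β → 0 ≤ Φ β := by
    intro β hβ
    simp only [Φ]
    split_ifs with h
    · positivity
    · have : (β⁻¹) ^ s ≤ 1 :=
        Real.rpow_le_one (by positivity) (inv_le_one_of_one_le₀ (by linarith)) hs.le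
      have : 0 ≤ 2 - (β⁻¹) ^ s := by linarith
      positivity
  have hstep : ∀ β, 0 < β → Φ β + (min β β⁻¹) ^ s ≤ Φ (2 * β) := by
    intro β hβ
    have e1 : β ^ s = y * (2 * β) ^ s := by
      rw [hy, ← Real.mul_rpow (by norm_num) (by positivity)]
      congr 1
      ring
    have e2 : ((2 * β)⁻¹) ^ s = y * (β⁻¹) ^ s := by
      rw [hy, ← Real.mul_rpow (by norm_num) (by positivity)]
      congr 1
      rw [mul_inv]
      norm_num
    simp only [Φ]
    split_ifs with h h' h'
    · have : min β β⁻¹ = β := min_eq_left (h.trans ((one_le_inv₀ hβ).2 h))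
      rw [this, ← e1]
      apply le_of_eq
      field_simp
      ring
    · have : min β β⁻¹ = β := min_eq_left (h.trans ((one_le_inv₀ hβ).2 h))
      rw [this]
      have h1 : β ^ s ≤ 1 := Real.rpow_le_one hβ.le h hs.le
      have h2 : ((2 * β)⁻¹) ^ s ≤ 1 :=
        Real.rpow_le_one (by positivity) (inv_le_one_of_one_le₀ (by linarith)) hs.le
      rw [div_add' _ _ _ hy2.ne']
      gcongr
      linarith
    · linarith
    · have : min β β⁻¹ = β⁻¹ :=
        min_eq_right ((inv_le_one_of_one_le₀ (by linarith)).trans (by linarith))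
      rw [this, e2]
      apply le_of_eq
      field_simp
      ring
  have key : ∀ n : ℕ, ∑ b ∈ Finset.range n, (min (2 ^ b * β₀) (2 ^ b * β₀)⁻¹) ^ s ≤
      Φ (2 ^ n * β₀) := by
    intro n
    induction n with
    | zero => simpa using hΦ0 β₀ hβ
    | succ n ih =>
      rw [Finset.sum_range_succ, pow_succ', mul_assoc]
      exact (add_le_add_left ih _).trans (hstep _ (by positivity))
  refine (key n).trans ((hΦ _ (by positivity)).trans ?_)
  rw [div_le_div_iff₀ hy2 hs]
  linarith

theorem exp_le_one_add_add_sq_mul_exp_abs (x : ℝ) :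
    Real.exp x ≤ 1 + x + x ^ 2 * Real.exp |x| := by
  rcases le_or_gt x (-1) with h | h
  · have h1 : Real.exp x ≤ 1 := Real.exp_le_one_iff.2 (by linarith)
    have h2 : 1 ≤ Real.exp |x| := Real.one_le_exp (abs_nonneg x)
    nlinarith [sq_nonneg x]
  · rcases le_or_gt x 1 with h' | h'
    · have h1 := Real.abs_exp_sub_one_sub_id_le (x := x) (abs_le.2 ⟨h.le, h'⟩)
      have h2 : 1 ≤ Real.exp |x| := Real.one_le_exp (abs_nonneg x)
      have h3 := (abs_le.1 h1).2
      nlinarith [sq_nonneg x]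
    · rw [abs_of_pos (by linarith)]
      have h1 : 1 ≤ x ^ 2 := by nlinarith
      nlinarith [Real.exp_pos x]

section Concentration

variable {Ω : Type*} [MeasurableSpace Ω] {ν : Measure Ω} [IsProbabilityMeasure ν]

theorem integral_exp_mul_le {f : Ω → ℝ} (hf : Measurable f) {K : ℝ} (hK : ∀ ω, |f ω| ≤ K)
    {lam V t : ℝ} (hV : ∫ ω, f ω ^ 2 * Real.exp (lam * |f ω|) ∂ν ≤ V) (ht : |t| ≤ lam) :
    ∫ ω, Real.exp (t * f ω) ∂ν ≤ Real.exp (t * ∫ ω, f ω ∂ν + t ^ 2 * V) := by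
  have hinteg : Integrable f ν :=
    Integrable.of_bound hf.aestronglyMeasurable K (ae_of_all _ hK)
  have hlam : 0 ≤ lam := (abs_nonneg t).trans ht
  have hint2 : Integrable (fun ω ↦ f ω ^ 2 * Real.exp (lam * |f ω|)) ν := by
    refine Integrable.of_bound (by fun_prop) (K ^ 2 * Real.exp (lam * K)) (ae_of_all _ fun ω ↦ ?_)
    rw [Real.norm_of_nonneg (by positivity), ← sq_abs]
    have := hK ω
    gcongr
  have hint3 : Integrable (fun ω ↦ Real.exp (t * f ω)) ν := by
    refine Integrable.of_bound (by fun_prop) (Real.exp (lam * K)) (ae_of_all _ fun ω ↦ ?_)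
    rw [Real.norm_of_nonneg (by positivity)]
    refine Real.exp_le_exp.2 ((le_abs_self _).trans ?_)
    rw [abs_mul]
    exact mul_le_mul ht (hK ω) (abs_nonneg _) hlam
  calc ∫ ω, Real.exp (t * f ω) ∂ν
      ≤ ∫ ω, (1 + t * f ω) + t ^ 2 * (f ω ^ 2 * Real.exp (lam * |f ω|)) ∂ν := by
        refine integral_mono hint3 (((integrable_const _).add (hinteg.const_mul t)).add
          (hint2.const_mul _)) fun ω ↦ ?_
        refine (exp_le_one_add_add_sq_mul_exp_abs _).trans ?_
        rw [mul_pow, mul_assoc, abs_mul]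
        gcongr
    _ = 1 + t * ∫ ω, f ω ∂ν + t ^ 2 * ∫ ω, f ω ^ 2 * Real.exp (lam * |f ω|) ∂ν := by
        have h1 : Integrable (fun ω ↦ 1 + t * f ω) ν :=
          (integrable_const _).add (hinteg.const_mul t)
        rw [integral_add h1 (hint2.const_mul _),
          integral_add (integrable_const _) (hinteg.const_mul t), integral_const_mul,
          integral_const_mul]
        simp
    _ ≤ 1 + (t * ∫ ω, f ω ∂ν + t ^ 2 * V) := by
        rw [add_assoc]
        gcongr
    _ ≤ _ := by linarith [Real.add_one_le_exp (t * ∫ ω, f ω ∂ν + t ^ 2 * V)]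

theorem measureReal_le_average_sub_le {f : Ω → ℝ} (hf : Measurable f) {K : ℝ}
    (hK : ∀ ω, |f ω| ≤ K) {lam V L : ℝ} (hlam : 0 < lam) (hV0 : 0 < V) (hL : 0 < L)
    (hV : ∫ ω, f ω ^ 2 * Real.exp (lam * |f ω|) ∂ν ≤ V) {N : ℕ} (hN : 1 ≤ N) :
    (Measure.pi fun _ : Fin N ↦ ν).real
      {ω | √(8 * V * L / N) + 4 * L / (N * lam) ≤ (∑ j, f (ω j)) / N - ∫ ω, f ω ∂ν} ≤
      Real.exp (-(2 * L)) := by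
  have hN0 : (0 : ℝ) < N := by exact_mod_cast hN
  set t : ℝ := min lam √(2 * L / (N * V)) with ht
  have ht0 : 0 < t := lt_min hlam (by positivity)
  set m := ∫ ω, f ω ∂ν with hm
  set τ := √(8 * V * L / N) + 4 * L / (N * lam) with hτ
  have hmgf := integral_exp_mul_le hf hK hV (t := t) (by rw [abs_of_pos ht0]; exact min_le_left _ _)
  have hinteg : Integrable (fun ω : Fin N → Ω ↦ Real.exp (t * ∑ j, f (ω j)))
      (Measure.pi fun _ : Fin N ↦ ν) := by
    refine Integrable.of_bound (Measurable.aestronglyMeasurable (by fun_prop))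
      (Real.exp (t * ∑ j : Fin N, K))
      (ae_of_all _ fun ω ↦ ?_)
    rw [Real.norm_of_nonneg (by positivity)]
    gcongr
    exact (le_abs_self _).trans (hK _)
  have hset : {ω : Fin N → Ω | τ ≤ (∑ j, f (ω j)) / N - m} =
      {ω : Fin N → Ω | N * (τ + m) ≤ ∑ j, f (ω j)} := by
    ext ω
    change τ ≤ (∑ j, f (ω j)) / N - m ↔ N * (τ + m) ≤ ∑ j, f (ω j)
    rw [le_sub_iff_add_le, le_div_iff₀ hN0, mul_comm]
  rw [hset]
  refine (measure_ge_le_exp_mul_mgf _ ht0.le hinteg).trans ?_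
  have hprod : mgf (fun ω : Fin N → Ω ↦ ∑ j, f (ω j)) (Measure.pi fun _ : Fin N ↦ ν) t =
      (∫ ω, Real.exp (t * f ω) ∂ν) ^ N := by
    simp only [mgf, Finset.mul_sum, Real.exp_sum]
    rw [integral_fintype_prod_eq_prod (fun (_ : Fin N) ω ↦ Real.exp (t * f ω))]
    simp
  rw [hprod]
  calc Real.exp (-t * (N * (τ + m))) * (∫ ω, Real.exp (t * f ω) ∂ν) ^ N
      ≤ Real.exp (-t * (N * (τ + m))) * Real.exp (t * m + t ^ 2 * V) ^ N := by
        gcongr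
    _ = Real.exp (-(N * t * τ - N * t ^ 2 * V)) := by
        rw [← Real.exp_nat_mul, ← Real.exp_add]
        congr 1
        ring
    _ ≤ _ := by
        refine Real.exp_le_exp.2 (neg_le_neg ?_)
        have hs1 : 0 ≤ √(8 * V * L / N) := Real.sqrt_nonneg _
        have hs2 : 0 ≤ 4 * L / (N * lam) := by positivity
        rcases le_total lam √(2 * L / (N * V)) with h | h
        · rw [ht, min_eq_left h]
          have h1 : lam ^ 2 ≤ 2 * L / (N * V) := by
            rw [← Real.sq_sqrt (show 0 ≤ 2 * L / (N * V) by positivity)]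
            gcongr
          rw [le_div_iff₀ (by positivity)] at h1
          have h2 : N * lam * (4 * L / (N * lam)) = 4 * L := by field_simp
          have h3 : 0 ≤ N * lam * √(8 * V * L / N) := by positivity
          rw [hτ, mul_add, h2]
          linarith
        · rw [ht, min_eq_right h]
          have h1 : √(2 * L / (N * V)) ^ 2 = 2 * L / (N * V) := Real.sq_sqrt (by positivity)
          have h2 : √(2 * L / (N * V)) * √(8 * V * L / N) = 4 * L / N := by
            rw [← Real.sqrt_mul (by positivity), Real.sqrt_eq_iff_mul_self_eq (by positivity)
              (by positivity)]
            field_simp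
            ring
          have h3 : 0 ≤ N * √(2 * L / (N * V)) * (4 * L / (N * lam)) := by positivity
          have h4 : N * √(2 * L / (N * V)) * √(8 * V * L / N) = 4 * L := by
            rw [mul_assoc, h2]
            field_simp
          have h5 : N * (2 * L / (N * V)) * V = 2 * L := by field_simp
          rw [hτ, mul_add, h1, h4, h5]
          linarith

theorem measureReal_lt_abs_average_sub_le {f : Ω → ℝ} (hf : Measurable f) {K : ℝ}
    (hK : ∀ ω, |f ω| ≤ K) {lam V L : ℝ} (hlam : 0 < lam) (hV0 : 0 < V) (hL : 0 < L)
    (hV : ∫ ω, f ω ^ 2 * Real.exp (lam * |f ω|) ∂ν ≤ V) {N : ℕ} (hN : 1 ≤ N) :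
    (Measure.pi fun _ : Fin N ↦ ν).real
      {ω | √(8 * V * L / N) + 4 * L / (N * lam) < |(∑ j, f (ω j)) / N - ∫ ω, f ω ∂ν|} ≤
      2 * Real.exp (-(2 * L)) := by
  have h1 := measureReal_le_average_sub_le hf hK hlam hV0 hL hV hN
  have h2 := measureReal_le_average_sub_le (ν := ν) (f := fun ω ↦ -f ω) (by fun_prop)
    (by simpa using hK) hlam hV0 hL (by simpa using hV) hN
  refine (measureReal_mono ?_).trans ((measureReal_union_le _ _).trans
    ((add_le_add h1 h2).trans_eq (by ring)))
  intro ω hω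
  change (_ : ℝ) < |(_ : ℝ)| at hω
  rcases lt_abs.1 hω with h | h
  · exact Or.inl h.le
  · right
    change (_ : ℝ) ≤ _
    rw [integral_neg, Finset.sum_neg_distrib, neg_div]
    linarith

/-- Chaining bound for the empirical process indexed by the `ℓ_p` ball. -/
theorem exists_sample_abs_average_sub_le {p : ℝ} (hp : 1 ≤ p) (hp2 : p ≤ 2) {d : ℕ} (hd : 1 ≤ d)
    {F : Ω → (Fin d → ℝ) → ℝ} (hF : ∀ x, Measurable fun ω ↦ F ω x) (hF0 : ∀ ω, F ω 0 = 0) {K : ℝ}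
    (hFK : ∀ ω x y, |F ω x - F ω y| ≤ K * ∑ i, |x i - y i|) {V lam : ℕ → ℝ} (hV : ∀ b, 0 < V b)
    (hlam : ∀ b, 0 < lam b)
    (hstep : ∀ b x x' S, IsDyadicStep p b x x' S →
      ∫ ω, (F ω x' - F ω x) ^ 2 * Real.exp (lam b * |F ω x' - F ω x|) ∂ν ≤ V b)
    {N : ℕ} (hN : 1 ≤ N) {H : (Fin N → Ω) → ENNReal} (hH : Measurable H)
    (hH2 : ∫⁻ ω, H ω ∂(Measure.pi fun _ : Fin N ↦ ν) ≤ 1 / 2) :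
    ∃ ω : Fin N → Ω, H ω ≤ 1 ∧ ∀ T : ℝ,
      (∀ n, ∑ b ∈ Finset.range n,
        (√(8 * V b * entropyBound p d (2 ^ b / (d : ℝ) ^ (1 / p)) / N) +
          4 * entropyBound p d (2 ^ b / (d : ℝ) ^ (1 / p)) / (N * lam b)) ≤ T) →
      ∀ x : Fin d → ℝ, ∑ i, |x i| ^ p ≤ 1 →
        |(∑ j, F (ω j) x) / N - ∫ ω, F ω x ∂ν| ≤ T := by
  have hN0 : (0 : ℝ) < N := by exact_mod_cast hN
  have hd0 : (0 : ℝ) < d := by exact_mod_cast hd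
  set L : ℕ → ℝ := fun b ↦ entropyBound p d (2 ^ b / (d : ℝ) ^ (1 / p)) with hL
  have hL0 : ∀ b, 0 < L b := fun b ↦ entropyBound_pos hd (by positivity)
  set τ : ℕ → ℝ := fun b ↦ √(8 * V b * L b / N) + 4 * L b / (N * lam b) with hτ
  set P := Measure.pi fun _ : Fin N ↦ ν with hP
  have hbound : ∀ x ω, |F ω x| ≤ K * ∑ i, |x i| := by
    intro x ω
    simpa [hF0] using hFK ω x 0
  have hinteg : ∀ x, Integrable (fun ω ↦ F ω x) ν := fun x ↦
    Integrable.of_bound (hF x).aestronglyMeasurable _ (ae_of_all _ (hbound x))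
  set g : (Fin N → Ω) → (Fin d → ℝ) → ℝ := fun ω x ↦ (∑ j, F (ω j) x) / N - ∫ ω, F ω x ∂ν with hg
  have hgsub : ∀ ω x y, g ω x - g ω y =
      (∑ j, (F (ω j) x - F (ω j) y)) / N - ∫ ω, (F ω x - F ω y) ∂ν := by
    intro ω x y
    rw [integral_sub (hinteg x) (hinteg y), Finset.sum_sub_distrib, sub_div]
    ring
  set bad : ℕ → (Fin d → ℤ) → Set (Fin N → Ω) := fun b k ↦
    {ω | τ b < |g ω (dyadicPoint b k) - g ω (dyadicPred b k)|} with hbad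
  have hbad1 : ∀ b, ∀ k ∈ latticeBall p d b, P (bad b k) ≤
      ENNReal.ofReal (2 * Real.exp (-(2 * L b))) := by
    intro b k hk
    obtain ⟨S, hS⟩ := isDyadicStep_of_mem (by linarith) hk
    have hm : Measurable fun ω ↦ F ω (dyadicPoint b k) - F ω (dyadicPred b k) :=
      (hF (dyadicPoint b k)).sub (hF (dyadicPred b k))
    have h1 := measureReal_lt_abs_average_sub_le (ν := ν) hm (fun ω ↦ hFK ω _ _)
      (hlam b) (hV b) (hL0 b) (hstep b _ _ S hS) hN
    rw [← ofReal_measureReal]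
    refine ENNReal.ofReal_le_ofReal (le_trans (le_of_eq ?_) h1)
    congr 1
    ext ω
    change τ b < |(_ : ℝ)| ↔ (_ : ℝ) < |(_ : ℝ)|
    rw [hgsub]
  have hbad2 : ∀ b, P (⋃ k ∈ latticeBall p d b, bad b k) ≤
      ENNReal.ofReal (2 * Real.exp (-3) * (1 / 2) ^ b) := by
    intro b
    refine (measure_biUnion_finset_le _ _).trans ((Finset.sum_le_sum (hbad1 b)).trans ?_)
    rw [Finset.sum_const, nsmul_eq_mul, ← ENNReal.ofReal_natCast,
      ← ENNReal.ofReal_mul (by positivity)]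
    refine ENNReal.ofReal_le_ofReal ?_
    calc ((latticeBall p d b).card : ℝ) * (2 * Real.exp (-(2 * L b)))
        ≤ Real.exp (L b) * (2 * Real.exp (-(2 * L b))) := by
          gcongr
          exact card_latticeBall_le_exp hp hp2 hd b
      _ = 2 * Real.exp (-L b) := by
          rw [mul_left_comm, ← Real.exp_add]
          ring_nf
      _ ≤ 2 * Real.exp (-(3 + b * Real.log 2)) := by
          have := le_entropyBound hp hd b
          gcongr
      _ = _ := by
          rw [neg_add, Real.exp_add, ← mul_neg, Real.exp_nat_mul, Real.exp_neg (Real.log 2),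
            Real.exp_log two_pos]
          ring
  have hbad3 : P (⋃ b, ⋃ k ∈ latticeBall p d b, bad b k) ≤ ENNReal.ofReal (4 * Real.exp (-3)) := by
    refine (measure_iUnion_le _).trans ((ENNReal.tsum_le_tsum hbad2).trans ?_)
    rw [← ENNReal.ofReal_tsum_of_nonneg (fun b ↦ by positivity)
      (summable_geometric_two.mul_left _), tsum_mul_left, tsum_geometric_two]
    exact ENNReal.ofReal_le_ofReal (by linarith)
  have hbad4 : P (⋃ b, ⋃ k ∈ latticeBall p d b, bad b k) < 1 / 2 := by
    refine hbad3.trans_lt ?_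
    rw [show (1 / 2 : ENNReal) = ENNReal.ofReal (1 / 2) by
      rw [ENNReal.ofReal_div_of_pos two_pos]; simp]
    refine (ENNReal.ofReal_lt_ofReal_iff (by norm_num)).2 ?_
    have h8 : (8 : ℝ) < Real.exp 3 := by
      have h1 : (2.7 : ℝ) < Real.exp 1 := by linarith [Real.exp_one_gt_d9]
      calc (8 : ℝ) < 2.7 ^ 3 := by norm_num
        _ < Real.exp 1 ^ 3 := by gcongr
        _ = _ := by rw [← Real.exp_nat_mul]; norm_num
    rw [Real.exp_neg, ← div_eq_mul_inv, div_lt_div_iff₀ (by positivity) two_pos]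
    linarith
  have hH3 : P {ω | 1 ≤ H ω} ≤ 1 / 2 := by
    have := mul_meas_ge_le_lintegral hH (μ := P) 1
    rw [one_mul] at this
    exact this.trans hH2
  obtain ⟨ω, hω⟩ : ∃ ω, ω ∉ {ω | 1 ≤ H ω} ∪ ⋃ b, ⋃ k ∈ latticeBall p d b, bad b k := by
    by_contra! hall
    have h1 : P Set.univ ≤ P {ω | 1 ≤ H ω} + P (⋃ b, ⋃ k ∈ latticeBall p d b, bad b k) :=
      (measure_mono fun ω _ ↦ hall ω).trans (measure_union_le _ _)
    have h2 : P {ω | 1 ≤ H ω} + P (⋃ b, ⋃ k ∈ latticeBall p d b, bad b k) < 1 / 2 + 1 / 2 :=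
      ENNReal.add_lt_add_of_le_of_lt (by finiteness) hH3 hbad4
    rw [measure_univ, ENNReal.add_halves] at *
    exact absurd (h1.trans_lt h2) (lt_irrefl _)
  rw [Set.mem_union, not_or] at hω
  have hω1 : H ω ≤ 1 := (not_le.1 hω.1).le
  refine ⟨ω, hω1, fun T hT x hx ↦ ?_⟩
  refine abs_le_of_dyadic_increments (g := g ω) (K := 2 * K) (by linarith) ?_ ?_ hT ?_ hx
  · simp [hg, hF0]
  · intro x y
    rw [hgsub]
    have h1 : |(∑ j, (F (ω j) x - F (ω j) y)) / N| ≤ K * ∑ i, |x i - y i| := by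
      rw [abs_div, abs_of_pos hN0, div_le_iff₀ hN0]
      refine (Finset.abs_sum_le_sum_abs _ _).trans
        ((Finset.sum_le_sum fun j _ ↦ hFK (ω j) x y).trans ?_)
      simp [mul_comm]
    have h2 : |∫ ω, (F ω x - F ω y) ∂ν| ≤ K * ∑ i, |x i - y i| := by
      have := norm_integral_le_of_norm_le_const (μ := ν) (f := fun ω ↦ F ω x - F ω y)
        (C := K * ∑ i, |x i - y i|) (ae_of_all _ fun ω ↦ hFK ω x y)
      simpa using this
    have := abs_sub ((∑ j, (F (ω j) x - F (ω j) y)) / N) (∫ ω, (F ω x - F ω y) ∂ν)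
    linarith
  · intro b k hk
    by_contra! hlt
    exact hω.2 (Set.mem_iUnion.2 ⟨b, Set.mem_biUnion (by exact hk) hlt⟩)

end Concentration

theorem sq_mul_exp_abs_le (t : ℝ) :
    t ^ 2 * Real.exp |t| ≤ Real.exp (2 * t) + Real.exp (-(2 * t)) - 2 := by
  wlog ht : 0 ≤ t generalizing t
  · have := this (-t) (by linarith)
    rw [abs_neg] at this
    convert this using 1
    · ring
    · ring_nf
  rw [abs_of_nonneg ht]
  have h1 : t ≤ Real.exp (t / 2) - Real.exp (-(3 * t / 2)) := by
    have h2 := Real.quadratic_le_exp_of_nonneg (show 0 ≤ t / 2 by positivity)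
    have h3 : Real.exp (-(3 * t / 2)) ≤ 1 / (1 + 3 * t / 2) := by
      rw [Real.exp_neg, ← one_div]
      have := Real.add_one_le_exp (3 * t / 2)
      gcongr
      linarith
    have h4 : 1 / (1 + 3 * t / 2) ≤ 1 - t / 2 + t ^ 2 / 8 := by
      rw [div_le_iff₀ (by positivity)]
      nlinarith [mul_nonneg ht (sq_nonneg (t - 5 / 3)), mul_nonneg ht ht]
    nlinarith
  have h5 : t ^ 2 ≤ (Real.exp (t / 2) - Real.exp (-(3 * t / 2))) ^ 2 := by gcongr
  calc t ^ 2 * Real.exp t ≤ (Real.exp (t / 2) - Real.exp (-(3 * t / 2))) ^ 2 * Real.exp t := by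
        gcongr
    _ = (Real.exp (t / 2) * Real.exp (t / 2) * Real.exp t) -
        2 * (Real.exp (t / 2) * Real.exp (-(3 * t / 2)) * Real.exp t) +
        Real.exp (-(3 * t / 2)) * Real.exp (-(3 * t / 2)) * Real.exp t := by ring
    _ = _ := by
        simp only [← Real.exp_add]
        rw [show t / 2 + t / 2 + t = 2 * t by ring, show t / 2 + -(3 * t / 2) + t = 0 by ring,
          show -(3 * t / 2) + -(3 * t / 2) + t = -(2 * t) by ring, Real.exp_zero]
        ring

/-- A scaled form of `sq_mul_exp_abs_le`. -/
theorem sq_mul_exp_mul_abs_le {lam : ℝ} (hlam : 0 < lam) (t : ℝ) :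
    t ^ 2 * Real.exp (lam * |t|) ≤
      (lam ^ 2)⁻¹ * (Real.exp (2 * lam * t) + Real.exp (-(2 * lam * t)) - 2) := by
  have h := sq_mul_exp_abs_le (lam * t)
  rw [abs_mul, abs_of_pos hlam] at h
  rw [inv_mul_eq_div, le_div_iff₀ (by positivity)]
  calc _ = (lam * t) ^ 2 * Real.exp (lam * |t|) := by ring
    _ ≤ _ := by rwa [mul_assoc]

theorem entropyBound_le {p : ℝ} {d : ℕ} {β : ℝ} (hβ : 0 < β) :
    entropyBound p d β ≤ 16 * d * min 1 (β ^ p) * (min β β⁻¹) ^ (-(1 / 8) : ℝ) := by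
  set m := min β β⁻¹ with hm
  have hm0 : 0 < m := lt_min hβ (by positivity)
  have hlog : |Real.log β| = -Real.log m := by
    rcases le_total β 1 with h | h
    · rw [hm, min_eq_left (h.trans ((one_le_inv₀ hβ).2 h)),
        abs_of_nonpos (Real.log_nonpos hβ.le h)]
    · rw [hm, min_eq_right ((inv_le_one_of_one_le₀ h).trans h), Real.log_inv,
        abs_of_nonneg (Real.log_nonneg h), neg_neg]
  have h1 : 4 + 2 * |Real.log β| ≤ 16 * m ^ (-(1 / 8) : ℝ) := by
    have h2 := Real.add_one_le_exp (-(1 / 8) * Real.log m)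
    rw [hlog, Real.rpow_def_of_pos hm0, mul_comm (Real.log m)]
    have h3 : 0 ≤ -Real.log m := hlog ▸ abs_nonneg _
    linarith
  have h4 : 0 ≤ min 1 (β ^ p) := le_min zero_le_one (by positivity)
  rw [entropyBound]
  calc _ ≤ d * (min 1 (β ^ p) * (16 * m ^ (-(1 / 8) : ℝ))) := by gcongr
    _ = _ := by ring

theorem measurePreserving_withDensity {Ω : Type*} [MeasurableSpace Ω] {ν : Measure Ω} {g : Ω → Ω}
    (hg : MeasurePreserving g ν ν) {w : Ω → ENNReal} (hw : Measurable w)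
    (h : ∀ a, w (g a) = w a) :
    MeasurePreserving g (ν.withDensity w) (ν.withDensity w) := by
  refine ⟨hg.measurable, Measure.ext fun s hs ↦ ?_⟩
  rw [Measure.map_apply hg.measurable hs, withDensity_apply _ hs,
    withDensity_apply _ (hg.measurable hs), ← hg.setLIntegral_comp_preimage hs hw]
  simp only [h]

theorem IsSymmetricLaw.measurePreserving_pi_sign {μ : Measure ℝ} [IsProbabilityMeasure μ]
    (hμ : IsSymmetricLaw μ) {d : ℕ} {σ : Fin d → ℝ} (hσ : ∀ i, σ i = 1 ∨ σ i = -1) :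
    MeasurePreserving (fun (a : Fin d → ℝ) i ↦ σ i * a i) (Measure.pi fun _ ↦ μ)
      (Measure.pi fun _ ↦ μ) := by
  refine measurePreserving_pi (f := fun i s ↦ σ i * s) _ _ fun i ↦ ?_
  rcases hσ i with h | h
  · simp only [h, one_mul]
    exact MeasurePreserving.id μ
  · simp only [h, neg_one_mul]
    exact ⟨by fun_prop, hμ⟩

theorem measurePreserving_pi_swap (μ : Measure ℝ) [IsProbabilityMeasure μ] {d : ℕ} (i j : Fin d) :
    MeasurePreserving (fun (a : Fin d → ℝ) k ↦ a (Equiv.swap i j k)) (Measure.pi fun _ ↦ μ)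
      (Measure.pi fun _ ↦ μ) := by
  exact measurePreserving_arrowCongr' (fun _ ↦ μ) (fun _ ↦ μ) (Equiv.swap i j)
    (MeasurableEquiv.refl ℝ) fun _ ↦ MeasurePreserving.id μ

/-- Sub-Gaussian bound for linear forms invariant under sign changes. -/
theorem integral_exp_sum_le_of_sign_invariant {d : ℕ} {Q : Measure (Fin d → ℝ)}
    [IsProbabilityMeasure Q]
    (hQ : ∀ σ : Fin d → ℝ, (∀ i, σ i = 1 ∨ σ i = -1) →
      MeasurePreserving (fun (a : Fin d → ℝ) i ↦ σ i * a i) Q Q)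
    {u : (Fin d → ℝ) → Fin d → ℝ} (hu : ∀ i, Measurable fun a ↦ u a i) (hu1 : ∀ a i, |u a i| ≤ 1)
    (hus : ∀ σ : Fin d → ℝ, (∀ i, σ i = 1 ∨ σ i = -1) →
      ∀ a i, u (fun i ↦ σ i * a i) i = σ i * u a i) (v : Fin d → ℝ) :
    ∫ a, Real.exp (∑ i, u a i * v i) ∂Q ≤ ∫ a, Real.exp (∑ i, (u a i * v i) ^ 2 / 2) ∂Q := by
  set signs : Finset (Fin d → ℝ) := Fintype.piFinset fun _ ↦ {1, -1} with hsigns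
  have hcard : (signs.card : ℝ) = 2 ^ d := by
    rw [hsigns, Fintype.card_piFinset_const, Finset.card_pair (by norm_num)]
    simp
  have hbound : ∀ σ : Fin d → ℝ, (∀ i, σ i = 1 ∨ σ i = -1) → ∀ a,
      ∑ i, σ i * (u a i * v i) ≤ ∑ i, |v i| := by
    intro σ hσ a
    refine Finset.sum_le_sum fun i _ ↦ (le_abs_self _).trans ?_
    have : |σ i| = 1 := by rcases hσ i with h | h <;> simp [h]
    rw [abs_mul, abs_mul, this, one_mul]
    exact mul_le_of_le_one_left (abs_nonneg _) (hu1 a i)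
  have hσ1 : ∀ σ ∈ signs, ∀ i, σ i = 1 ∨ σ i = -1 := by
    intro σ hσ i
    simpa using Fintype.mem_piFinset.1 hσ i
  have heq : ∀ σ ∈ signs, ∫ a, Real.exp (∑ i, u a i * v i) ∂Q =
      ∫ a, Real.exp (∑ i, σ i * (u a i * v i)) ∂Q := by
    intro σ hσ
    rw [← (hQ σ (hσ1 σ hσ)).map_eq, integral_map (hQ σ (hσ1 σ hσ)).measurable.aemeasurable
      (Measurable.aestronglyMeasurable (by fun_prop)), (hQ σ (hσ1 σ hσ)).map_eq]
    simp only [hus σ (hσ1 σ hσ), mul_assoc]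
  have hinteg : ∀ σ ∈ signs, Integrable (fun a ↦ Real.exp (∑ i, σ i * (u a i * v i))) Q := by
    intro σ hσ
    refine Integrable.of_bound (Measurable.aestronglyMeasurable (by fun_prop))
      (Real.exp (∑ i, |v i|)) (ae_of_all _ fun a ↦ ?_)
    rw [Real.norm_of_nonneg (Real.exp_pos _).le]
    exact Real.exp_le_exp.2 (hbound σ (hσ1 σ hσ) a)
  have hint2 : Integrable (fun a ↦ Real.exp (∑ i, (u a i * v i) ^ 2 / 2)) Q := by
    refine Integrable.of_bound (Measurable.aestronglyMeasurable (by fun_prop))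
      (Real.exp (∑ i, v i ^ 2 / 2)) (ae_of_all _ fun a ↦ ?_)
    rw [Real.norm_of_nonneg (Real.exp_pos _).le]
    refine Real.exp_le_exp.2 (Finset.sum_le_sum fun i _ ↦ ?_)
    rw [mul_pow]
    refine div_le_div_of_nonneg_right ?_ two_pos.le
    exact mul_le_of_le_one_left (sq_nonneg _) ((sq_le_one_iff_abs_le_one _).2 (hu1 a i))
  have h2 : (2 : ℝ) ^ d * ∫ a, Real.exp (∑ i, u a i * v i) ∂Q =
      ∫ a, ∏ i, (Real.exp (u a i * v i) + Real.exp (-(u a i * v i))) ∂Q := by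
    rw [← hcard, ← nsmul_eq_mul, ← Finset.sum_const, Finset.sum_congr rfl heq,
      ← integral_finsetSum _ hinteg]
    congr 1
    ext a
    have h3 : ∀ i, Real.exp (u a i * v i) + Real.exp (-(u a i * v i)) =
        ∑ s ∈ ({1, -1} : Finset ℝ), Real.exp (s * (u a i * v i)) := by
      intro i
      rw [Finset.sum_pair (by norm_num)]
      simp
    simp only [h3]
    rw [Finset.prod_univ_sum]
    simp only [Real.exp_sum]
    rfl
  have h4 : (2 : ℝ) ^ d * ∫ a, Real.exp (∑ i, u a i * v i) ∂Q ≤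
      2 ^ d * ∫ a, Real.exp (∑ i, (u a i * v i) ^ 2 / 2) ∂Q := by
    rw [h2, ← integral_const_mul]
    refine integral_mono_of_nonneg (ae_of_all _ fun a ↦ by positivity) (hint2.const_mul _)
      (ae_of_all _ fun a ↦ ?_)
    have h5 : ∀ i, Real.exp (u a i * v i) + Real.exp (-(u a i * v i)) ≤
        2 * Real.exp ((u a i * v i) ^ 2 / 2) := by
      intro i
      have := Real.cosh_le_exp_half_sq (u a i * v i)
      rw [Real.cosh_eq] at this
      linarith
    calc ∏ i, (Real.exp (u a i * v i) + Real.exp (-(u a i * v i)))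
        ≤ ∏ i, 2 * Real.exp ((u a i * v i) ^ 2 / 2) :=
          Finset.prod_le_prod (fun i _ ↦ by positivity) fun i _ ↦ h5 i
      _ = _ := by
          rw [Finset.prod_mul_distrib, ← Real.exp_sum]
          simp
  exact le_of_mul_le_mul_left h4 (by positivity)

/-- The Euclidean length of a vector. -/
noncomputable def euclideanLength {d : ℕ} (a : Fin d → ℝ) : ℝ := √(∑ i, a i ^ 2)

/-- The direction of a vector, equal to zero at zero. -/
noncomputable def direction {d : ℕ} (a : Fin d → ℝ) (i : Fin d) : ℝ := a i / euclideanLength a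

section Direction

variable {d : ℕ}

theorem measurable_euclideanLength : Measurable (euclideanLength : (Fin d → ℝ) → ℝ) := by
  unfold euclideanLength
  fun_prop

theorem measurable_direction (i : Fin d) : Measurable fun a : Fin d → ℝ ↦ direction a i :=
  (measurable_pi_apply i).div measurable_euclideanLength

theorem euclideanLength_nonneg (a : Fin d → ℝ) : 0 ≤ euclideanLength a := Real.sqrt_nonneg _

theorem sq_euclideanLength (a : Fin d → ℝ) : euclideanLength a ^ 2 = ∑ i, a i ^ 2 :=
  Real.sq_sqrt (Finset.sum_nonneg fun _ _ ↦ sq_nonneg _)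

theorem abs_le_euclideanLength (a : Fin d → ℝ) (i : Fin d) : |a i| ≤ euclideanLength a :=
  Real.abs_le_sqrt (Finset.single_le_sum (f := fun i ↦ a i ^ 2) (fun _ _ ↦ sq_nonneg _)
    (Finset.mem_univ i))

theorem euclideanLength_mul_direction (a : Fin d → ℝ) (i : Fin d) :
    euclideanLength a * direction a i = a i := by
  rcases (euclideanLength_nonneg a).eq_or_lt with h | h
  · have := abs_le_euclideanLength a i
    rw [← h] at this ⊢
    rw [zero_mul, abs_nonpos_iff.1 this]
  · exact mul_div_cancel₀ _ h.ne'

theorem sum_direction_sq_le (a : Fin d → ℝ) : ∑ i, direction a i ^ 2 ≤ 1 := by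
  simp only [direction, div_pow]
  rw [← Finset.sum_div, ← sq_euclideanLength]
  exact div_self_le_one _

theorem abs_direction_le (a : Fin d → ℝ) (i : Fin d) : |direction a i| ≤ 1 := by
  rw [← sq_le_one_iff_abs_le_one]
  exact (Finset.single_le_sum (f := fun i ↦ direction a i ^ 2) (fun i _ ↦ sq_nonneg _)
    (Finset.mem_univ i)).trans (sum_direction_sq_le a)

theorem euclideanLength_sign_mul {σ : Fin d → ℝ} (hσ : ∀ i, σ i = 1 ∨ σ i = -1) (a : Fin d → ℝ) :
    euclideanLength (fun i ↦ σ i * a i) = euclideanLength a := by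
  unfold euclideanLength
  congr 1
  refine Finset.sum_congr rfl fun i _ ↦ ?_
  rcases hσ i with h | h <;> simp [h]

theorem euclideanLength_swap (i j : Fin d) (a : Fin d → ℝ) :
    euclideanLength (fun k ↦ a (Equiv.swap i j k)) = euclideanLength a := by
  unfold euclideanLength
  congr 1
  exact Equiv.sum_comp (Equiv.swap i j) fun k ↦ a k ^ 2

theorem euclideanLength_le {D : ℝ} (hD : 0 < D) (a : Fin d → ℝ) :
    euclideanLength a ≤
      (D + D⁻¹ * ∑ i, min (D ^ 2) (a i ^ 2)) + ∑ i, max (|a i| - D) 0 := by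
  set c : Fin d → ℝ := fun i ↦ min D |a i| with hc
  set e : Fin d → ℝ := fun i ↦ max (|a i| - D) 0 with he
  have hc0 : ∀ i, 0 ≤ c i := fun i ↦ le_min hD.le (abs_nonneg _)
  have he0 : ∀ i, 0 ≤ e i := fun i ↦ le_max_right _ _
  have hce : ∀ i, |a i| = c i + e i := by
    intro i
    simp only [hc, he]
    rcases le_total D |a i| with h | h
    · rw [min_eq_left h, max_eq_left (by linarith)]
      ring
    · rw [min_eq_right h, max_eq_right (by linarith)]
      ring
  have hcs : ∀ i, min (D ^ 2) (a i ^ 2) = c i ^ 2 := by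
    intro i
    simp only [hc]
    rw [← sq_abs (a i)]
    rcases le_total D |a i| with h | h
    · rw [min_eq_left h, min_eq_left (by gcongr)]
    · rw [min_eq_right h, min_eq_right (by gcongr)]
  simp only [hcs]
  set s := ∑ i, c i ^ 2 with hs
  have hs0 : 0 ≤ s := Finset.sum_nonneg fun i _ ↦ sq_nonneg _
  set B := D + D⁻¹ * s with hB
  have hB0 : 0 < B := by positivity
  have hsB : s ≤ B ^ 2 := by
    have h1 : D * (D⁻¹ * s) = s := by field_simp
    nlinarith [sq_nonneg D, sq_nonneg (D⁻¹ * s)]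
  have hcB : ∀ i, c i ≤ B := by
    intro i
    refine abs_le_of_sq_le_sq' ?_ hB0.le |>.2
    exact (Finset.single_le_sum (f := fun i ↦ c i ^ 2) (fun i _ ↦ sq_nonneg _)
      (Finset.mem_univ i)).trans hsB
  have hE0 : 0 ≤ ∑ i, e i := Finset.sum_nonneg fun i _ ↦ he0 i
  have hE2 : ∑ i, e i ^ 2 ≤ (∑ i, e i) ^ 2 :=
    Finset.sum_sq_le_sq_sum_of_nonneg fun i _ ↦ he0 i
  refine Real.sqrt_le_iff.2 ⟨by positivity, ?_⟩
  calc ∑ i, a i ^ 2 = ∑ i, (c i ^ 2 + 2 * (c i * e i) + e i ^ 2) := by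
        refine Finset.sum_congr rfl fun i _ ↦ ?_
        rw [← sq_abs, hce]
        ring
    _ ≤ ∑ i, (c i ^ 2 + 2 * (B * e i) + e i ^ 2) := by
        refine Finset.sum_le_sum fun i _ ↦ ?_
        have := mul_le_mul_of_nonneg_right (hcB i) (he0 i)
        linarith
    _ = s + 2 * (B * ∑ i, e i) + ∑ i, e i ^ 2 := by
        rw [Finset.sum_add_distrib, Finset.sum_add_distrib, ← Finset.mul_sum, ← Finset.mul_sum]
    _ ≤ _ := by nlinarith

end Direction

theorem integrable_eval_pi {μ : Measure ℝ} [IsProbabilityMeasure μ] {d : ℕ} {f : ℝ → ℝ}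
    (hf : Integrable f μ) (i : Fin d) :
    Integrable (fun a : Fin d → ℝ ↦ f (a i)) (Measure.pi fun _ ↦ μ) :=
  integrable_comp_eval (μ := fun _ : Fin d ↦ μ) hf

theorem integral_eval_pi {μ : Measure ℝ} [IsProbabilityMeasure μ] {d : ℕ} {f : ℝ → ℝ}
    (hf : Measurable f) (i : Fin d) :
    ∫ a : Fin d → ℝ, f (a i) ∂(Measure.pi fun _ ↦ μ) = ∫ x, f x ∂μ :=
  integral_comp_eval (μ := fun _ : Fin d ↦ μ) hf.aestronglyMeasurable

namespace IsStableLaw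

variable {p : ℝ} {μ : Measure ℝ} [IsProbabilityMeasure μ]

theorem integrable_linear (hμ : IsStableLaw p μ) (hp : 1 < p) {d : ℕ} (x : Fin d → ℝ) :
    Integrable (fun a : Fin d → ℝ ↦ ∑ i, a i * x i) (Measure.pi fun _ ↦ μ) :=
  integrable_finsetSum _ fun i _ ↦ (integrable_eval_pi (hμ.integrable_id hp) i).mul_const _

theorem integral_abs_linear (hμ : IsStableLaw p μ) (hp : 0 < p) {d : ℕ} (x : Fin d → ℝ) :
    ∫ a : Fin d → ℝ, |∑ i, a i * x i| ∂(Measure.pi fun _ ↦ μ) =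
      (∫ s, |s| ∂μ) * (∑ i, |x i| ^ p) ^ (1 / p) := by
  have h := hμ.map_sum_mul hp x
  have h1 : ∫ s, |s| ∂((Measure.pi fun _ : Fin d ↦ μ).map (fun a ↦ ∑ i, a i * x i)) =
      ∫ a : Fin d → ℝ, |∑ i, a i * x i| ∂(Measure.pi fun _ ↦ μ) :=
    integral_map (Measurable.aemeasurable (by fun_prop)) (by fun_prop)
  rw [← h1, h, integral_map (by fun_prop) (by fun_prop)]
  have h2 : 0 ≤ (∑ i, |x i| ^ p) ^ (1 / p) := by positivity
  simp only [abs_mul, abs_of_nonneg h2]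
  rw [integral_const_mul, mul_comm]

theorem integrable_min_sq (R : ℝ) : Integrable (fun x : ℝ ↦ min (R ^ 2) (x ^ 2)) μ := by
  refine Integrable.of_bound (by fun_prop) (R ^ 2) (ae_of_all _ fun x ↦ ?_)
  rw [Real.norm_of_nonneg (le_min (sq_nonneg _) (sq_nonneg _))]
  exact min_le_left _ _

theorem integrable_euclideanLength (hμ : IsStableLaw p μ) (hp : 1 < p) (d : ℕ) :
    Integrable (euclideanLength : (Fin d → ℝ) → ℝ) (Measure.pi fun _ ↦ μ) := by
  refine Integrable.mono' (((integrable_const 1).add (Integrable.const_mul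
    (integrable_finsetSum Finset.univ fun i _ ↦ integrable_eval_pi (integrable_min_sq 1) i)
    (1 : ℝ)⁻¹)).add (integrable_finsetSum Finset.univ fun i _ ↦
      integrable_eval_pi (hμ.integrable_excess hp one_pos) i))
    measurable_euclideanLength.aestronglyMeasurable (ae_of_all _ fun a ↦ ?_)
  rw [Real.norm_of_nonneg (euclideanLength_nonneg a)]
  exact euclideanLength_le one_pos a

theorem integral_euclideanLength_le (hμ : IsStableLaw p μ) (hp : 5 / 4 ≤ p) {d : ℕ} (hd : 1 ≤ d) :
    ∫ a : Fin d → ℝ, euclideanLength a ∂(Measure.pi fun _ ↦ μ) ≤ 81 * (d : ℝ) ^ (1 / p) := by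
  have hp1 : 1 < p := by linarith
  have hd0 : (0 : ℝ) < d := by exact_mod_cast hd
  set D : ℝ := (d : ℝ) ^ (1 / p) with hD
  have hD0 : 0 < D := by positivity
  have hDp : D ^ p = d := by
    rw [hD, ← Real.rpow_mul hd0.le, one_div, inv_mul_cancel₀ (by linarith), Real.rpow_one]
  have i1 : Integrable (fun a : Fin d → ℝ ↦ ∑ i, min (D ^ 2) (a i ^ 2)) (Measure.pi fun _ ↦ μ) :=
    integrable_finsetSum Finset.univ fun i _ ↦ integrable_eval_pi (integrable_min_sq D) i
  have i2 : Integrable (fun a : Fin d → ℝ ↦ ∑ i, max (|a i| - D) 0) (Measure.pi fun _ ↦ μ) :=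
    integrable_finsetSum Finset.univ fun i _ ↦ integrable_eval_pi (hμ.integrable_excess hp1 hD0) i
  have i3 : Integrable (fun a : Fin d → ℝ ↦ D + D⁻¹ * ∑ i, min (D ^ 2) (a i ^ 2))
      (Measure.pi fun _ ↦ μ) := (integrable_const D).add (i1.const_mul _)
  have e1 : ∫ a : Fin d → ℝ, ∑ i, min (D ^ 2) (a i ^ 2) ∂(Measure.pi fun _ ↦ μ) ≤ 16 * D ^ 2 := by
    rw [integral_finsetSum _ fun i _ ↦ integrable_eval_pi (integrable_min_sq D) i]
    simp only [integral_eval_pi (f := fun x : ℝ ↦ min (D ^ 2) (x ^ 2)) (by fun_prop),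
      Finset.sum_const, Finset.card_univ, Fintype.card_fin, nsmul_eq_mul]
    calc _ ≤ d * (16 * D ^ (2 - p)) := by
          gcongr
          exact hμ.integral_min_sq_le (by linarith) hD0
      _ = 16 * (D ^ p * D ^ (2 - p)) := by rw [hDp]; ring
      _ = _ := by rw [← Real.rpow_add hD0]; norm_num
  have e2 : ∫ a : Fin d → ℝ, ∑ i, max (|a i| - D) 0 ∂(Measure.pi fun _ ↦ μ) ≤ 64 * D := by
    rw [integral_finsetSum _ fun i _ ↦ integrable_eval_pi (hμ.integrable_excess hp1 hD0) i]
    simp only [integral_eval_pi (f := fun x : ℝ ↦ max (|x| - D) 0) (by fun_prop),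
      Finset.sum_const, Finset.card_univ, Fintype.card_fin, nsmul_eq_mul]
    calc _ ≤ d * (16 * (D ^ (1 - p) / (p - 1))) := by
          gcongr
          exact hμ.integral_excess_le hp1 hD0
      _ ≤ d * (16 * (D ^ (1 - p) * 4)) := by
          rw [div_eq_mul_inv]
          gcongr
          exact inv_le_of_inv_le₀ (by norm_num) (by linarith)
      _ = 64 * (D ^ p * D ^ (1 - p)) := by rw [hDp]; ring
      _ = _ := by rw [← Real.rpow_add hD0]; norm_num
  calc _ ≤ ∫ a : Fin d → ℝ, (D + D⁻¹ * ∑ i, min (D ^ 2) (a i ^ 2)) +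
        ∑ i, max (|a i| - D) 0 ∂(Measure.pi fun _ ↦ μ) :=
        integral_mono (hμ.integrable_euclideanLength hp1 d) (i3.add i2)
          fun a ↦ euclideanLength_le hD0 a
    _ ≤ D + D⁻¹ * (16 * D ^ 2) + 64 * D := by
        rw [integral_add i3 i2, integral_add (integrable_const _) (i1.const_mul _),
          integral_const_mul]
        simp only [integral_const, probReal_univ, one_smul]
        gcongr
    _ = _ := by
        field_simp
        ring

theorem half_le_integral_euclideanLength (hμ : IsStableLaw p μ) (hp : 1 < p) {d : ℕ}
    (hd : 1 ≤ d) :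
    1 / 2 ≤ ∫ a : Fin d → ℝ, euclideanLength a ∂(Measure.pi fun _ ↦ μ) := by
  refine (hμ.half_le_integral_abs hp).trans ?_
  rw [← integral_eval_pi (f := fun x : ℝ ↦ |x|) (by fun_prop) (⟨0, hd⟩ : Fin d)]
  exact integral_mono (integrable_eval_pi (hμ.integrable_id hp).abs _)
    (hμ.integrable_euclideanLength hp d) fun a ↦ abs_le_euclideanLength a _

end IsStableLaw

/-- The law of a stable vector reweighted by its Euclidean length. -/
noncomputable def lengthBiased (μ : Measure ℝ) (d : ℕ) : Measure (Fin d → ℝ) :=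
  (Measure.pi fun _ ↦ μ).withDensity fun a ↦ ENNReal.ofReal
    (euclideanLength a / ∫ a : Fin d → ℝ, euclideanLength a ∂(Measure.pi fun _ ↦ μ))

theorem lengthBiased_density_measurable (d : ℕ) (M : ℝ) :
    Measurable fun a : Fin d → ℝ ↦ ENNReal.ofReal (euclideanLength a / M) :=
  (measurable_euclideanLength.div_const M).ennreal_ofReal

theorem IsSymmetricLaw.measurePreserving_lengthBiased_sign {μ : Measure ℝ}
    [IsProbabilityMeasure μ] (hμ : IsSymmetricLaw μ) {d : ℕ} {σ : Fin d → ℝ}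
    (hσ : ∀ i, σ i = 1 ∨ σ i = -1) :
    MeasurePreserving (fun (a : Fin d → ℝ) i ↦ σ i * a i) (lengthBiased μ d)
      (lengthBiased μ d) :=
  measurePreserving_withDensity (hμ.measurePreserving_pi_sign hσ)
    (lengthBiased_density_measurable d _) fun a ↦ by rw [euclideanLength_sign_mul hσ]

theorem measurePreserving_lengthBiased_swap (μ : Measure ℝ) [IsProbabilityMeasure μ] {d : ℕ}
    (i j : Fin d) :
    MeasurePreserving (fun (a : Fin d → ℝ) k ↦ a (Equiv.swap i j k)) (lengthBiased μ d)
      (lengthBiased μ d) :=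
  measurePreserving_withDensity (measurePreserving_pi_swap μ i j)
    (lengthBiased_density_measurable d _) fun a ↦ by rw [euclideanLength_swap]

theorem integral_lengthBiased (μ : Measure ℝ) [IsProbabilityMeasure μ] {d : ℕ}
    (G : (Fin d → ℝ) → ℝ) :
    ∫ a, G a ∂(lengthBiased μ d) =
      (∫ a : Fin d → ℝ, euclideanLength a * G a ∂(Measure.pi fun _ ↦ μ)) /
        ∫ a : Fin d → ℝ, euclideanLength a ∂(Measure.pi fun _ ↦ μ) := by
  rw [lengthBiased, integral_withDensity_eq_integral_toReal_smul
    (lengthBiased_density_measurable d _) (ae_of_all _ fun _ ↦ ENNReal.ofReal_lt_top),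
    ← integral_div]
  refine integral_congr_ae (ae_of_all _ fun a ↦ ?_)
  have h1 : 0 ≤ ∫ a : Fin d → ℝ, euclideanLength a ∂(Measure.pi fun _ ↦ μ) :=
    integral_nonneg fun a ↦ euclideanLength_nonneg a
  simp only [smul_eq_mul]
  rw [ENNReal.toReal_ofReal (div_nonneg (euclideanLength_nonneg a) h1)]
  ring

/-- The directional linear form. -/
noncomputable def directionForm {d : ℕ} (a x : Fin d → ℝ) : ℝ := ∑ i, direction a i * x i

theorem measurable_directionForm {d : ℕ} (x : Fin d → ℝ) :
    Measurable fun a ↦ directionForm a x :=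
  Finset.measurable_fun_sum _ fun i _ ↦ (measurable_direction i).mul_const _

theorem directionForm_sub {d : ℕ} (a x y : Fin d → ℝ) :
    directionForm a (fun i ↦ x i - y i) = directionForm a x - directionForm a y := by
  simp only [directionForm, mul_sub, Finset.sum_sub_distrib]

theorem abs_directionForm_le {d : ℕ} (a x : Fin d → ℝ) : |directionForm a x| ≤ ∑ i, |x i| := by
  refine (Finset.abs_sum_le_sum_abs _ _).trans (Finset.sum_le_sum fun i _ ↦ ?_)
  rw [abs_mul]
  exact mul_le_of_le_one_left (abs_nonneg _) (abs_direction_le a i)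

theorem abs_abs_directionForm_sub_le {d : ℕ} (a x y : Fin d → ℝ) :
    |(|directionForm a x| - |directionForm a y|)| ≤ |directionForm a fun i ↦ x i - y i| := by
  rw [directionForm_sub]
  exact abs_abs_sub_abs_le _ _

namespace IsStableLaw

variable {p : ℝ} {μ : Measure ℝ} [IsProbabilityMeasure μ]

theorem isProbabilityMeasure_lengthBiased (hμ : IsStableLaw p μ) (hp : 1 < p) {d : ℕ}
    (hd : 1 ≤ d) : IsProbabilityMeasure (lengthBiased μ d) := by
  have hM := hμ.half_le_integral_euclideanLength hp hd
  refine ⟨?_⟩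
  rw [lengthBiased, withDensity_apply _ MeasurableSet.univ, Measure.restrict_univ,
    ← ofReal_integral_eq_lintegral_ofReal ((hμ.integrable_euclideanLength hp d).div_const _)
      (ae_of_all _ fun a ↦ div_nonneg (euclideanLength_nonneg a) (by linarith)),
    integral_div, div_self (by linarith), ENNReal.ofReal_one]

theorem integral_abs_directionForm (hμ : IsStableLaw p μ) (hp : 0 < p) {d : ℕ} (x : Fin d → ℝ) :
    ∫ a, |directionForm a x| ∂(lengthBiased μ d) =
      (∫ s, |s| ∂μ) * (∑ i, |x i| ^ p) ^ (1 / p) /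
        ∫ a : Fin d → ℝ, euclideanLength a ∂(Measure.pi fun _ ↦ μ) := by
  rw [integral_lengthBiased, ← hμ.integral_abs_linear hp]
  congr 2
  ext a
  have h : euclideanLength a * |directionForm a x| = |euclideanLength a * directionForm a x| := by
    rw [abs_mul, abs_of_nonneg (euclideanLength_nonneg a)]
  rw [h, directionForm, Finset.mul_sum]
  simp only [← mul_assoc, euclideanLength_mul_direction]

theorem integral_direction_sq_le (hμ : IsStableLaw p μ) (hp : 1 < p) {d : ℕ} (i : Fin d) :
    ∫ a, direction a i ^ 2 ∂(lengthBiased μ d) ≤ 1 / d := by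
  have hd : 1 ≤ d := i.pos
  have hd0 : (0 : ℝ) < d := by exact_mod_cast hd
  have := hμ.isProbabilityMeasure_lengthBiased hp hd
  have hinteg : ∀ j : Fin d, Integrable (fun a ↦ direction a j ^ 2) (lengthBiased μ d) := by
    intro j
    refine Integrable.of_bound ((measurable_direction j).pow_const 2).aestronglyMeasurable 1
      (ae_of_all _ fun a ↦ ?_)
    rw [Real.norm_of_nonneg (sq_nonneg _)]
    exact (sq_le_one_iff_abs_le_one _).2 (abs_direction_le a j)
  have heq : ∀ j, ∫ a, direction a j ^ 2 ∂(lengthBiased μ d) =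
      ∫ a, direction a i ^ 2 ∂(lengthBiased μ d) := by
    intro j
    have h := measurePreserving_lengthBiased_swap μ i j
    have hi := integral_map (μ := lengthBiased μ d) h.measurable.aemeasurable
      ((measurable_direction j).pow_const 2).aestronglyMeasurable
    rw [h.map_eq] at hi
    rw [hi]
    simp only [direction, euclideanLength_swap, Equiv.swap_apply_right]
  have hsum : ∑ j : Fin d, ∫ a, direction a j ^ 2 ∂(lengthBiased μ d) ≤ 1 := by
    rw [← integral_finsetSum _ fun j _ ↦ hinteg j]
    refine (integral_mono (integrable_finsetSum _ fun j _ ↦ hinteg j) (integrable_const 1)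
      fun a ↦ sum_direction_sq_le a).trans ?_
    simp
  rw [Finset.sum_congr rfl fun j _ ↦ heq j, Finset.sum_const, Finset.card_univ, Fintype.card_fin,
    nsmul_eq_mul] at hsum
  rw [le_div_iff₀ hd0, mul_comm]
  exact hsum

theorem integral_directionForm_step_le (hμ : IsStableLaw p μ) (hp : 1 < p) {d : ℕ} (hd : 1 ≤ d)
    {b : ℕ} {x x' : Fin d → ℝ} {S : Finset (Fin d)} (hS : IsDyadicStep p b x x' S) :
    ∫ a, (|directionForm a x'| - |directionForm a x|) ^ 2 *
      Real.exp (2 ^ b / 2 * |(|directionForm a x'| - |directionForm a x|)|) ∂(lengthBiased μ d) ≤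
      8 * ((2 ^ b) ^ 2)⁻¹ * min 1 ((2 ^ b / (d : ℝ) ^ (1 / p)) ^ p) := by
  have hprob := hμ.isProbabilityMeasure_lengthBiased hp hd
  have hd0 : (0 : ℝ) < d := by exact_mod_cast hd
  set Q := lengthBiased μ d with hQ
  set Δ : Fin d → ℝ := fun i ↦ x' i - x i with hΔ
  have h2b : (0 : ℝ) < 2 ^ b := by positivity
  set lam : ℝ := 2 ^ b / 2 with hlam
  have hlam0 : 0 < lam := by positivity
  have hmΔ := measurable_directionForm Δ
  have hie : ∀ c : ℝ, Integrable (fun a ↦ Real.exp (c * directionForm a Δ)) Q := by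
    intro c
    refine Integrable.of_bound (Measurable.aestronglyMeasurable (by fun_prop))
      (Real.exp (|c| * ∑ i, |Δ i|)) (ae_of_all _ fun a ↦ ?_)
    rw [Real.norm_of_nonneg (Real.exp_pos _).le]
    refine Real.exp_le_exp.2 ((le_abs_self _).trans ?_)
    rw [abs_mul]
    gcongr
    exact abs_directionForm_le a Δ
  have hsub : ∀ v : Fin d → ℝ, ∫ a, Real.exp (directionForm a v) ∂Q ≤
      ∫ a, Real.exp (∑ i, (direction a i * v i) ^ 2 / 2) ∂Q := by
    intro v
    refine integral_exp_sum_le_of_sign_invariant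
      (fun σ hσ ↦ hμ.isSymmetricLaw.measurePreserving_lengthBiased_sign hσ)
      measurable_direction abs_direction_le (fun σ hσ a i ↦ ?_) v
    rw [direction, euclideanLength_sign_mul hσ, mul_div_assoc, direction]
  have hdir2 : ∀ i, Integrable (fun a ↦ direction a i ^ 2) Q := by
    intro i
    refine Integrable.of_bound ((measurable_direction i).pow_const 2).aestronglyMeasurable 1
      (ae_of_all _ fun a ↦ ?_)
    rw [Real.norm_of_nonneg (sq_nonneg _)]
    exact (sq_le_one_iff_abs_le_one _).2 (abs_direction_le a i)
  have hexp : ∀ c : ℝ, |c| = 2 * lam → ∫ a, Real.exp (c * directionForm a Δ) ∂Q ≤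
      1 + S.card / d := by
    intro c hc
    have h1 : ∀ a, c * directionForm a Δ = directionForm a fun i ↦ c * Δ i := by
      intro a
      rw [directionForm, directionForm, Finset.mul_sum]
      exact Finset.sum_congr rfl fun i _ ↦ by ring
    simp only [h1]
    refine (hsub _).trans ?_
    have h2 : ∀ a, ∑ i, (direction a i * (c * Δ i)) ^ 2 / 2 = (∑ i ∈ S, direction a i ^ 2) / 2 := by
      intro a
      rw [Finset.sum_div, ← Finset.sum_subset (Finset.subset_univ S)]
      · refine Finset.sum_congr rfl fun i hi ↦ ?_
        have h3 : (c * Δ i) ^ 2 = 1 := by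
          rw [← sq_abs, abs_mul, hc, hΔ, hS.abs_sub i hi, hlam]
          field_simp
        rw [mul_pow, h3, mul_one]
      · intro i _ hi
        simp [hΔ, hS.eq_of_notMem i hi]
    have h4 : ∀ a, Real.exp (∑ i, (direction a i * (c * Δ i)) ^ 2 / 2) ≤
        1 + ∑ i ∈ S, direction a i ^ 2 := by
      intro a
      rw [h2]
      have h5 : ∑ i ∈ S, direction a i ^ 2 ≤ 1 :=
        (Finset.sum_le_sum_of_subset_of_nonneg (Finset.subset_univ S)
          fun i _ _ ↦ sq_nonneg _).trans (sum_direction_sq_le a)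
      have h6 : 0 ≤ ∑ i ∈ S, direction a i ^ 2 := Finset.sum_nonneg fun i _ ↦ sq_nonneg _
      have h7 := Real.abs_exp_sub_one_sub_id_le (x := (∑ i ∈ S, direction a i ^ 2) / 2)
        (by rw [abs_of_nonneg (by positivity)]; linarith)
      have h8 := (abs_le.1 h7).2
      nlinarith
    calc _ ≤ ∫ a, (1 + ∑ i ∈ S, direction a i ^ 2) ∂Q :=
          integral_mono_of_nonneg (ae_of_all _ fun a ↦ (Real.exp_pos _).le)
            ((integrable_const _).add (integrable_finsetSum _ fun i _ ↦ hdir2 i))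
            (ae_of_all _ h4)
      _ = 1 + ∑ i ∈ S, ∫ a, direction a i ^ 2 ∂Q := by
          rw [integral_add (integrable_const _) (integrable_finsetSum _ fun i _ ↦ hdir2 i),
            integral_finsetSum _ fun i _ ↦ hdir2 i]
          simp
      _ ≤ 1 + ∑ _i ∈ S, 1 / (d : ℝ) := by
          gcongr with i
          exact hμ.integral_direction_sq_le hp i
      _ = _ := by
          rw [Finset.sum_const, nsmul_eq_mul]
          ring
  have hcard : (S.card : ℝ) / d ≤ min 1 ((2 ^ b / (d : ℝ) ^ (1 / p)) ^ p) := by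
    refine le_min ?_ ?_
    · rw [div_le_one hd0]
      exact_mod_cast (Finset.card_le_univ S).trans_eq (Fintype.card_fin d)
    · rw [Real.div_rpow h2b.le (by positivity), ← Real.rpow_mul hd0.le, one_div,
        inv_mul_cancel₀ (by linarith), Real.rpow_one]
      gcongr
      exact hS.card_le
  calc _ ≤ ∫ a, (lam ^ 2)⁻¹ * (Real.exp (2 * lam * directionForm a Δ) +
        Real.exp (-(2 * lam) * directionForm a Δ) - 2) ∂Q := by
        refine integral_mono_of_nonneg (ae_of_all _ fun a ↦ by positivity)
          ((((hie _).add (hie _)).sub (integrable_const _)).const_mul _) (ae_of_all _ fun a ↦ ?_)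
        have h1 : |(|directionForm a x'| - |directionForm a x|)| ≤ |directionForm a Δ| :=
          abs_abs_directionForm_sub_le a x' x
        have h2 := sq_mul_exp_mul_abs_le hlam0 (directionForm a Δ)
        simp only [neg_mul]
        refine le_trans ?_ h2
        rw [← sq_abs, ← sq_abs (directionForm a Δ)]
        gcongr
    _ = (lam ^ 2)⁻¹ * (∫ a, Real.exp (2 * lam * directionForm a Δ) ∂Q +
        ∫ a, Real.exp (-(2 * lam) * directionForm a Δ) ∂Q - 2) := by
        have i1 : Integrable (fun a ↦ Real.exp (2 * lam * directionForm a Δ) +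
          Real.exp (-(2 * lam) * directionForm a Δ)) Q := (hie _).add (hie _)
        rw [integral_const_mul, integral_sub i1 (integrable_const _), integral_add (hie _) (hie _)]
        simp
    _ ≤ (lam ^ 2)⁻¹ * ((1 + S.card / d) + (1 + S.card / d) - 2) := by
        gcongr
        · exact hexp _ (abs_of_pos (by positivity))
        · exact hexp _ (by rw [abs_neg, abs_of_pos (by positivity)])
    _ = 8 * ((2 ^ b) ^ 2)⁻¹ * (S.card / d) := by
        rw [hlam]
        field_simp
        ring
    _ ≤ _ := by gcongr

end IsStableLaw

theorem min_one_rpow_le_mul {p β : ℝ} (hp : 5 / 4 ≤ p) (hβ : 0 < β) :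
    min 1 (β ^ p) ≤ β * (min β β⁻¹) ^ (1 / 4 : ℝ) := by
  rcases le_total β 1 with h | h
  · rw [min_eq_left (h.trans ((one_le_inv₀ hβ).2 h))]
    refine (min_le_right _ _).trans ?_
    nth_rw 2 [← Real.rpow_one β]
    rw [← Real.rpow_add hβ]
    exact Real.rpow_le_rpow_of_exponent_ge hβ h (by linarith)
  · have h1 : β⁻¹ ≤ 1 := inv_le_one_of_one_le₀ h
    rw [min_eq_right (h1.trans h)]
    refine (min_le_left _ _).trans ?_
    have h2 : β⁻¹ ^ (1 : ℝ) ≤ β⁻¹ ^ (1 / 4 : ℝ) :=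
      Real.rpow_le_rpow_of_exponent_ge (by positivity) h1 (by norm_num)
    rw [Real.rpow_one] at h2
    calc (1 : ℝ) = β * β⁻¹ := (mul_inv_cancel₀ hβ.ne').symm
      _ ≤ _ := by gcongr

theorem direction_chain_step_le {p : ℝ} (hp : 5 / 4 ≤ p) {d : ℕ} {β D ε N : ℝ} (hβ : 0 < β)
    (hD : 0 < D) (hε : 0 < ε) (hε1 : ε ≤ 1) (hN : 0 < N) (hdN : d ≤ ε ^ 2 * N) :
    √(8 * (8 * ((β * D) ^ 2)⁻¹ * min 1 (β ^ p)) * entropyBound p d β / N) +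
      4 * entropyBound p d β / (N * (β * D / 2)) ≤
      160 * ε / D * (min β β⁻¹) ^ (1 / 8 : ℝ) := by
  set w := min 1 (β ^ p) with hw
  set m := min β β⁻¹ with hm
  have hm0 : 0 < m := lt_min hβ (by positivity)
  have hm1 : m ≤ 1 := by
    rcases le_total β 1 with h | h
    · exact (min_le_left _ _).trans h
    · exact (min_le_right _ _).trans (inv_le_one_of_one_le₀ h)
  have hw0 : 0 < w := lt_min one_pos (by positivity)
  have hwm : w ≤ β * m ^ (1 / 4 : ℝ) := min_one_rpow_le_mul hp hβ
  have hL : entropyBound p d β ≤ 16 * d * w * m ^ (-(1 / 8) : ℝ) := entropyBound_le hβ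
  have hL2 : entropyBound p d β ≤ 16 * (ε ^ 2 * N) * w * m ^ (-(1 / 8) : ℝ) :=
    hL.trans (by gcongr)
  have e1 : m ^ (1 / 4 : ℝ) * m ^ (-(1 / 8) : ℝ) = m ^ (1 / 8 : ℝ) := by
    rw [← Real.rpow_add hm0]
    norm_num
  have hpos : 0 < m ^ (1 / 8 : ℝ) := by positivity
  have hpos' : 0 < m ^ (-(1 / 8) : ℝ) := by positivity
  have h8 : m ^ (1 / 4 : ℝ) ≤ m ^ (1 / 8 : ℝ) :=
    Real.rpow_le_rpow_of_exponent_ge hm0 hm1 (by norm_num)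
  have h1 : √(8 * (8 * ((β * D) ^ 2)⁻¹ * w) * entropyBound p d β / N) ≤
      32 * ε / D * m ^ (1 / 8 : ℝ) := by
    refine Real.sqrt_le_iff.2 ⟨by positivity, ?_⟩
    calc 8 * (8 * ((β * D) ^ 2)⁻¹ * w) * entropyBound p d β / N
        ≤ 8 * (8 * ((β * D) ^ 2)⁻¹ * w) *
          (16 * (ε ^ 2 * N) * w * m ^ (-(1 / 8) : ℝ)) / N := by gcongr
      _ = 1024 * (ε / (β * D)) ^ 2 * (w * (w * m ^ (-(1 / 8) : ℝ))) := by
          field_simp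
          norm_num
      _ ≤ 1024 * (ε / (β * D)) ^ 2 * ((β * m ^ (1 / 4 : ℝ)) *
          ((β * m ^ (1 / 4 : ℝ)) * m ^ (-(1 / 8) : ℝ))) := by gcongr
      _ = 1024 * (ε / D) ^ 2 * (m ^ (1 / 4 : ℝ) * m ^ (1 / 8 : ℝ)) := by
          rw [mul_assoc β (m ^ (1 / 4 : ℝ)) (m ^ (-(1 / 8) : ℝ)), e1]
          field_simp
      _ ≤ 1024 * (ε / D) ^ 2 * (m ^ (1 / 8 : ℝ) * m ^ (1 / 8 : ℝ)) := by gcongr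
      _ = _ := by ring
  have h2 : 4 * entropyBound p d β / (N * (β * D / 2)) ≤ 128 * ε / D * m ^ (1 / 8 : ℝ) := by
    calc 4 * entropyBound p d β / (N * (β * D / 2))
        ≤ 4 * (16 * (ε ^ 2 * N) * (β * m ^ (1 / 4 : ℝ)) * m ^ (-(1 / 8) : ℝ)) /
          (N * (β * D / 2)) := by
          gcongr
          exact hL2.trans (by gcongr)
      _ = 128 * (ε * ε) / D * (m ^ (1 / 4 : ℝ) * m ^ (-(1 / 8) : ℝ)) := by
          field_simp
          norm_num
      _ ≤ 128 * (ε * 1) / D * m ^ (1 / 8 : ℝ) := by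
          rw [e1]
          gcongr
      _ = _ := by ring
  calc _ ≤ 32 * ε / D * m ^ (1 / 8 : ℝ) + 128 * ε / D * m ^ (1 / 8 : ℝ) := add_le_add h1 h2
    _ = _ := by ring

/-- A universal-constant approximate embedding for `p` away from `1`. -/
theorem exists_approx_embedding_of_five_fourths_le :
    ∃ C : ℝ, 0 < C ∧ ∀ p : ℝ, 5 / 4 ≤ p → p ≤ 2 → ∀ ε : ℝ, 0 < ε → ε ≤ 1 → ∀ d : ℕ, 1 ≤ d →
      ∃ d' : ℕ, (d' : ℝ) ≤ C * d / ε ^ 2 ∧ ∃ T : (Fin d → ℝ) →ₗ[ℝ] (Fin d' → ℝ), ∃ κ : ℝ, 0 < κ ∧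
        ∀ x : Fin d → ℝ, ∑ i, |x i| ^ p ≤ 1 →
          |∑ j, |T x j| - κ * (∑ i, |x i| ^ p) ^ (1 / p)| ≤ C * κ * ε := by
  refine ⟨829440, by norm_num, fun p hp hp2 ε hε hε1 d hd ↦ ?_⟩
  have hp1 : 1 < p := by linarith
  obtain ⟨μ, hprob, hμ⟩ := exists_stable_law hp1 hp2
  replace hμ : IsStableLaw p μ := hμ
  have hd0 : (0 : ℝ) < d := by exact_mod_cast hd
  have hd1 : (1 : ℝ) ≤ d := by exact_mod_cast hd
  set D : ℝ := (d : ℝ) ^ (1 / p) with hD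
  have hD0 : 0 < D := by positivity
  set N : ℕ := ⌈(d : ℝ) / ε ^ 2⌉₊ with hN
  have hdε : 1 ≤ (d : ℝ) / ε ^ 2 := by
    rw [le_div_iff₀ (by positivity)]
    nlinarith
  have hN1 : 1 ≤ N := Nat.one_le_ceil_iff.2 (by positivity)
  have hN0 : (0 : ℝ) < N := by exact_mod_cast hN1
  have hdN : (d : ℝ) ≤ ε ^ 2 * N := by
    have := Nat.le_ceil ((d : ℝ) / ε ^ 2)
    rwa [div_le_iff₀ (by positivity), mul_comm] at this
  have hNle : (N : ℝ) ≤ 829440 * d / ε ^ 2 := by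
    have := Nat.ceil_lt_add_one (show 0 ≤ (d : ℝ) / ε ^ 2 by positivity)
    rw [mul_div_assoc]
    linarith
  have hprobQ := hμ.isProbabilityMeasure_lengthBiased hp1 hd
  obtain ⟨ω, -, hω⟩ := exists_sample_abs_average_sub_le (ν := lengthBiased μ d) hp1.le hp2 hd
    (F := fun a x ↦ |directionForm a x|) (fun x ↦ (measurable_directionForm x).abs)
    (fun a ↦ by simp [directionForm]) (K := 1)
    (fun a x y ↦ by
      rw [one_mul]
      exact (abs_abs_directionForm_sub_le a x y).trans (abs_directionForm_le _ _))
    (V := fun b ↦ 8 * (((2 : ℝ) ^ b) ^ 2)⁻¹ * min 1 ((2 ^ b / D) ^ p))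
    (lam := fun b ↦ 2 ^ b / 2)
    (fun b ↦ by
      have : 0 < min 1 (((2 : ℝ) ^ b / D) ^ p) := lt_min one_pos (by positivity)
      positivity)
    (fun b ↦ by positivity)
    (fun b x x' S hS ↦ hμ.integral_directionForm_step_le hp1 hd hS) hN1 (H := fun _ ↦ 0)
    measurable_const (by simp)
  set M : ℝ := ∫ a : Fin d → ℝ, euclideanLength a ∂(Measure.pi fun _ ↦ μ) with hM
  have hM0 : 1 / 2 ≤ M := hμ.half_le_integral_euclideanLength hp1 hd
  have hM1 : M ≤ 81 * D := hμ.integral_euclideanLength_le hp hd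
  set κ : ℝ := ∫ s, |s| ∂μ with hκ
  have hκ0 : 1 / 2 ≤ κ := hμ.half_le_integral_abs hp1
  refine ⟨N, hNle, LinearMap.pi fun j ↦ (M / N) •
    ∑ i, direction (ω j) i • (LinearMap.proj i : (Fin d → ℝ) →ₗ[ℝ] ℝ), κ, by linarith,
    fun x hx ↦ ?_⟩
  have hT := hω (5120 * ε / D) (fun n ↦ ?_) x hx
  · rw [hμ.integral_abs_directionForm (by linarith)] at hT
    have h1 : ∀ j, |(LinearMap.pi fun j ↦ (M / N) •
        ∑ i, direction (ω j) i • (LinearMap.proj i : (Fin d → ℝ) →ₗ[ℝ] ℝ)) x j| =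
        M / N * |directionForm (ω j) x| := by
      intro j
      simp only [LinearMap.pi_apply, LinearMap.smul_apply, LinearMap.sum_apply,
        LinearMap.proj_apply, smul_eq_mul, abs_mul]
      rw [abs_of_nonneg (show 0 ≤ M / N by positivity)]
      rfl
    rw [Finset.sum_congr rfl fun j _ ↦ h1 j, ← Finset.mul_sum]
    have h2 : M / N * ∑ j, |directionForm (ω j) x| - κ * (∑ i, |x i| ^ p) ^ (1 / p) =
        M * ((∑ j, |directionForm (ω j) x|) / N - κ * (∑ i, |x i| ^ p) ^ (1 / p) / M) := by
      field_simp
    rw [h2, abs_mul, abs_of_nonneg (by linarith : 0 ≤ M)]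
    calc _ ≤ 81 * D * (5120 * ε / D) := by gcongr
      _ = 829440 * (1 / 2) * ε := by
          field_simp
          norm_num
      _ ≤ _ := by gcongr
  · calc _ ≤ ∑ b ∈ Finset.range n, 160 * ε / D *
          (min (2 ^ b * D⁻¹) (2 ^ b * D⁻¹)⁻¹) ^ (1 / 8 : ℝ) := by
          refine Finset.sum_le_sum fun b _ ↦ ?_
          have := direction_chain_step_le hp (β := 2 ^ b / D) (by positivity) hD0 hε hε1 hN0 hdN
          rwa [div_mul_cancel₀ _ hD0.ne', ← div_eq_mul_inv] at *
      _ ≤ 160 * ε / D * (4 / (1 / 8)) := by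
          rw [← Finset.mul_sum]
          gcongr
          exact sum_min_rpow_le (by positivity) (by norm_num) (by norm_num) n
      _ = _ := by ring

theorem abs_abs_add_add_sub_le {w a b : ℝ} (hab : 0 ≤ a * b) :
    |(|w + a + b| - |w + a| - |b|)| ≤ 2 * min |w| |b| := by
  have h1 : |w + a + b| ≤ |w + a| + |b| := abs_add_le _ _
  have h2 : |w + a| ≤ |w + a + b| + |b| := by
    have := abs_sub (w + a + b) b
    rwa [add_sub_cancel_right] at this
  have h3 : |a + b| = |a| + |b| := abs_add_eq_add_abs_iff a b |>.2 (by
    rcases lt_trichotomy a 0 with h | h | h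
    · exact Or.inr ⟨h.le, by nlinarith⟩
    · rcases le_total 0 b with h' | h'
      · exact Or.inl ⟨h.ge, h'⟩
      · exact Or.inr ⟨h.le, h'⟩
    · exact Or.inl ⟨h.le, by nlinarith⟩)
  have h4 : |a + b| ≤ |w + a + b| + |w| := by
    have := abs_sub (w + a + b) w
    rwa [show w + a + b - w = a + b by ring] at this
  have h5 : |w + a| ≤ |w| + |a| := abs_add_le _ _
  rw [abs_of_nonpos (by linarith)]
  rcases le_total |w| |b| with h | h
  · rw [min_eq_left h]
    linarith
  · rw [min_eq_right h]
    linarith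

/-- Adding terms of matching signs to a sum increases its absolute value additively, up to the
interaction with the remaining summands. -/
theorem abs_abs_sum_add_sub_le {d : ℕ} (α β : Fin d → ℝ) (h : ∀ i, 0 ≤ α i * β i) :
    |(|∑ i, (α i + β i)| - |∑ i, α i| - ∑ i, |β i|)| ≤
      2 * ∑ i, min |∑ l ∈ Finset.univ.erase i, if l < i then α l + β l else α l| |β i| := by
  set P : ℕ → ℝ := fun k ↦ ∑ l : Fin d, if (l : ℕ) < k then α l + β l else α l with hP
  set W : Fin d → ℝ := fun i ↦
    ∑ l ∈ Finset.univ.erase i, if l < i then α l + β l else α l with hW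
  have h0 : P 0 = ∑ i, α i := by simp [hP]
  have hd : P d = ∑ i, (α i + β i) := by simp [hP]
  have hi : ∀ i : Fin d, P i = W i + α i := by
    intro i
    simp only [hP, hW]
    rw [← Finset.sum_erase_add _ _ (Finset.mem_univ i)]
    simp
  have hi' : ∀ i : Fin d, P (i + 1) = W i + α i + β i := by
    intro i
    simp only [hP, hW]
    rw [← Finset.sum_erase_add _ _ (Finset.mem_univ i), add_assoc]
    congr 1
    · refine Finset.sum_congr rfl fun l hl ↦ ?_
      have h1 : (l : ℕ) ≠ i := fun h ↦ Finset.ne_of_mem_erase hl (Fin.ext h)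
      have h2 : ((l : ℕ) < i + 1) ↔ l < i := by
        rw [Fin.lt_def]
        lia
      simp only [h2]
    · simp
  have htel : |P d| - |P 0| = ∑ i : Fin d, (|P (i + 1)| - |P i|) := by
    rw [Fin.sum_univ_eq_sum_range (fun k ↦ |P (k + 1)| - |P k|), Finset.sum_range_sub fun k ↦ |P k|]
  rw [← h0, ← hd, htel, ← Finset.sum_sub_distrib, Finset.mul_sum]
  refine (Finset.abs_sum_le_sum_abs _ _).trans (Finset.sum_le_sum fun i _ ↦ ?_)
  rw [hi, hi']
  exact abs_abs_add_add_sub_le (h i)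

theorem sq_mul_exp_add_le {s t lam : ℝ} (hlam : 0 ≤ lam) :
    (s + t) ^ 2 * Real.exp (lam * |s + t|) ≤
      4 * (s ^ 2 * Real.exp (2 * lam * |s|)) + 4 * (t ^ 2 * Real.exp (2 * lam * |t|)) := by
  wlog h : |s| ≤ |t| generalizing s t
  · rw [add_comm s t, add_comm (4 * _)]
    exact this (le_of_not_ge h)
  have h1 : |s + t| ≤ 2 * |t| := (abs_add_le s t).trans (by linarith)
  have h2 : 0 ≤ 4 * (s ^ 2 * Real.exp (2 * lam * |s|)) := by positivity
  have h3 : (s + t) ^ 2 * Real.exp (lam * |s + t|) ≤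
      4 * (t ^ 2 * Real.exp (2 * lam * |t|)) := by
    calc (s + t) ^ 2 * Real.exp (lam * |s + t|)
        ≤ (2 * |t|) ^ 2 * Real.exp (lam * (2 * |t|)) := by
          rw [← sq_abs (s + t)]
          gcongr
      _ = _ := by
          rw [mul_pow, sq_abs]
          ring_nf
  linarith

theorem sq_sum_min_le {ι : Type*} [DecidableEq ι] (S : Finset ι) {w c : ι → ℝ}
    (hc : ∀ i ∈ S, 0 ≤ c i) :
    (∑ i ∈ S, min |w i| (c i)) ^ 2 ≤
      ∑ i ∈ S, |w i| * c i + ∑ i ∈ S, ∑ l ∈ S.erase i, c i * c l := by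
  rw [sq, Finset.sum_mul_sum, ← Finset.sum_add_distrib]
  refine Finset.sum_le_sum fun i hi ↦ ?_
  have h0 : ∀ i ∈ S, 0 ≤ min |w i| (c i) := fun i hi ↦ le_min (abs_nonneg _) (hc i hi)
  rw [← Finset.add_sum_erase _ _ hi]
  refine add_le_add (mul_le_mul (min_le_left _ _) (min_le_right _ _) (h0 i hi) (abs_nonneg _)) ?_
  refine Finset.sum_le_sum fun l hl ↦ ?_
  exact mul_le_mul (min_le_right _ _) (min_le_right _ _) (h0 l (Finset.mem_of_mem_erase hl))
    (hc i hi)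

theorem abs_sum_le_of_truncation {ι : Type*} (S : Finset ι) (w : ι → ℝ) :
    |∑ l ∈ S, w l| ≤ 1 + (∑ l ∈ S, if |w l| ≤ 1 then w l else 0) ^ 2 +
      ∑ l ∈ S, if |w l| ≤ 1 then 0 else |w l| := by
  have h1 : ∑ l ∈ S, w l = (∑ l ∈ S, if |w l| ≤ 1 then w l else 0) +
      ∑ l ∈ S, if |w l| ≤ 1 then 0 else w l := by
    rw [← Finset.sum_add_distrib]
    exact Finset.sum_congr rfl fun l _ ↦ by split_ifs <;> simp
  rw [h1]
  refine (abs_add_le _ _).trans (add_le_add ?_ ((Finset.abs_sum_le_sum_abs _ _).trans_eq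
    (Finset.sum_congr rfl fun l _ ↦ by split_ifs <;> simp)))
  set s := ∑ l ∈ S, if |w l| ≤ 1 then w l else 0
  rw [← sq_abs]
  nlinarith [sq_nonneg (|s| - 1), abs_nonneg s]

theorem IsSymmetricLaw.integral_odd_eq_zero {μ : Measure ℝ} (hμ : IsSymmetricLaw μ) {f : ℝ → ℝ}
    (hf : Measurable f) (hodd : ∀ t, f (-t) = -f t) : ∫ t, f t ∂μ = 0 := by
  have h := integral_map (μ := μ) measurable_neg.aemeasurable (f := f) hf.aestronglyMeasurable
  rw [show μ.map (fun x : ℝ ↦ -x) = μ from hμ] at h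
  simp only [hodd, integral_neg] at h
  linarith

section Independent

variable {d : ℕ} {ν : Fin d → Measure ℝ} [∀ i, IsProbabilityMeasure (ν i)]

theorem integral_abs_sum_erase_le (hν : ∀ i, IsSymmetricLaw (ν i)) {w : Fin d → ℝ → ℝ}
    (hw : ∀ l, Measurable (w l)) (hodd : ∀ l t, w l (-t) = -w l t)
    (hinteg : ∀ l, Integrable (w l) (ν l)) (i : Fin d) :
    ∫ a, |∑ l ∈ Finset.univ.erase i, w l (a l)| ∂(Measure.pi ν) ≤
      1 + ∑ l, ∫ t, min (w l t ^ 2) |w l t| ∂(ν l) := by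
  set Y : Fin d → ℝ → ℝ := fun l t ↦ if |w l t| ≤ 1 then w l t else 0 with hY
  set Z : Fin d → ℝ → ℝ := fun l t ↦ if |w l t| ≤ 1 then 0 else |w l t| with hZ
  have hset : ∀ l, MeasurableSet {t | |w l t| ≤ 1} := fun l ↦ (hw l).abs measurableSet_Iic
  have hYm : ∀ l, Measurable (Y l) := fun l ↦ Measurable.ite (hset l) (hw l) measurable_const
  have hZm : ∀ l, Measurable (Z l) := fun l ↦ Measurable.ite (hset l) measurable_const (hw l).abs
  have hY1 : ∀ l t, |Y l t| ≤ 1 := by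
    intro l t
    simp only [hY]
    split_ifs with h
    · exact h
    · simp
  set X : Fin d → ℝ → ℝ := fun l ↦ if l = i then 0 else Y l with hX
  have hX1 : ∀ l t, |X l t| ≤ 1 := by
    intro l t
    simp only [hX]
    split_ifs
    · simp
    · exact hY1 l t
  have hXm : ∀ l, Measurable (X l) := by
    intro l
    simp only [hX]
    split_ifs
    · exact measurable_const
    · exact hYm l
  have hXL : ∀ l, MemLp (X l) 2 (ν l) := fun l ↦
    MemLp.of_bound (hXm l).aestronglyMeasurable 1 (ae_of_all _ (hX1 l))
  have hX0 : ∀ l, ∫ t, X l t ∂(ν l) = 0 := by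
    intro l
    refine (hν l).integral_odd_eq_zero (hXm l) fun t ↦ ?_
    simp only [hX]
    split_ifs
    · simp
    · simp only [hY, hodd, abs_neg]
      split_ifs <;> simp
  have hsumX : ∀ a : Fin d → ℝ, ∑ l ∈ Finset.univ.erase i, Y l (a l) = ∑ l, X l (a l) := by
    intro a
    rw [← Finset.sum_erase_add _ _ (Finset.mem_univ i)]
    simp only [hX, if_pos, Pi.zero_apply, add_zero]
    exact Finset.sum_congr rfl fun l hl ↦ by rw [if_neg (Finset.ne_of_mem_erase hl)]
  have hZi : ∀ l, Integrable (Z l) (ν l) := fun l ↦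
    (hinteg l).mono (hZm l).aestronglyMeasurable (ae_of_all _ fun t ↦ by
      simp only [hZ]
      split_ifs <;> simp)
  have hSL : MemLp (fun a : Fin d → ℝ ↦ ∑ l, X l (a l)) 2 (Measure.pi ν) := by
    refine MemLp.of_bound (Measurable.aestronglyMeasurable
      (Finset.measurable_fun_sum _ fun l _ ↦ (hXm l).comp (measurable_pi_apply l))) d
      (ae_of_all _ fun a ↦ ?_)
    refine (Finset.abs_sum_le_sum_abs _ _).trans ((Finset.sum_le_sum fun l _ ↦ hX1 l _).trans ?_)
    simp
  have hvar : ∫ a, (∑ l, X l (a l)) ^ 2 ∂(Measure.pi ν) = ∑ l, ∫ t, X l t ^ 2 ∂(ν l) := by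
    have h1 := variance_sum_pi (μ := ν) hXL
    have h2 : ∀ l, Var[X l; ν l] = ∫ t, X l t ^ 2 ∂(ν l) := fun l ↦
      variance_of_integral_eq_zero (hXm l).aemeasurable (hX0 l)
    have h3 : (∑ l, fun a : Fin d → ℝ ↦ X l (a l)) = fun a ↦ ∑ l, X l (a l) := by
      ext a
      simp
    rw [h3, variance_of_integral_eq_zero hSL.aemeasurable] at h1
    · rw [h1]
      exact Finset.sum_congr rfl fun l _ ↦ h2 l
    · rw [integral_finsetSum _ fun l _ ↦ integrable_comp_eval ((hXL l).integrable one_le_two)]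
      exact Finset.sum_eq_zero fun l _ ↦
        (integral_comp_eval (hXm l).aestronglyMeasurable).trans (hX0 l)
  have hZe : ∀ l, Integrable (fun a : Fin d → ℝ ↦ Z l (a l)) (Measure.pi ν) :=
    fun l ↦ integrable_comp_eval (hZi l)
  have hmin : ∀ l, Integrable (fun t ↦ min (w l t ^ 2) |w l t|) (ν l) := fun l ↦
    (hinteg l).mono (((hw l).pow_const 2).min (hw l).abs).aestronglyMeasurable
      (ae_of_all _ fun t ↦ by
        rw [Real.norm_of_nonneg (le_min (sq_nonneg _) (abs_nonneg _))]
        exact min_le_right _ _)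
  have hXsq : ∀ l, Integrable (fun t ↦ X l t ^ 2) (ν l) := fun l ↦ (hXL l).integrable_sq
  have hZ0 : ∀ l t, 0 ≤ Z l t := fun l t ↦ by
    simp only [hZ]
    split_ifs <;> simp
  calc ∫ a, |∑ l ∈ Finset.univ.erase i, w l (a l)| ∂(Measure.pi ν)
      ≤ ∫ a, (1 + (∑ l, X l (a l)) ^ 2 + ∑ l ∈ Finset.univ.erase i, Z l (a l)) ∂(Measure.pi ν) := by
        refine integral_mono_of_nonneg (ae_of_all _ fun a ↦ abs_nonneg _)
          (((integrable_const _).add hSL.integrable_sq).add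
            (integrable_finsetSum _ fun l _ ↦ hZe l)) (ae_of_all _ fun a ↦ ?_)
        simp only [← hsumX]
        exact abs_sum_le_of_truncation _ fun l ↦ w l (a l)
    _ = 1 + ∑ l, ∫ t, X l t ^ 2 ∂(ν l) + ∑ l ∈ Finset.univ.erase i, ∫ t, Z l t ∂(ν l) := by
        have i1 : Integrable (fun a : Fin d → ℝ ↦ 1 + (∑ l, X l (a l)) ^ 2) (Measure.pi ν) :=
          (integrable_const _).add hSL.integrable_sq
        rw [integral_add i1 (integrable_finsetSum _ fun l _ ↦ hZe l),
          integral_add (integrable_const _) hSL.integrable_sq, hvar,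
          integral_finsetSum _ fun l _ ↦ hZe l]
        simp only [integral_const, probReal_univ, smul_eq_mul, mul_one]
        congr 1
        exact Finset.sum_congr rfl fun l _ ↦ integral_comp_eval (hZm l).aestronglyMeasurable
    _ ≤ 1 + ∑ l, ∫ t, X l t ^ 2 ∂(ν l) + ∑ l, ∫ t, Z l t ∂(ν l) := by
        exact add_le_add le_rfl (Finset.sum_le_sum_of_subset_of_nonneg (Finset.subset_univ _)
          fun l _ _ ↦ integral_nonneg (hZ0 l))
    _ = 1 + ∑ l, ∫ t, (X l t ^ 2 + Z l t) ∂(ν l) := by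
        rw [add_assoc, ← Finset.sum_add_distrib]
        congr 1
        exact Finset.sum_congr rfl fun l _ ↦ (integral_add (hXsq l) (hZi l)).symm
    _ ≤ _ := by
        refine add_le_add le_rfl (Finset.sum_le_sum fun l _ ↦ ?_)
        refine integral_mono ((hXsq l).add (hZi l)) (hmin l) fun t ↦ ?_
        have hXY : X l t ^ 2 ≤ Y l t ^ 2 := by
          simp only [hX]
          split_ifs
          · simpa using sq_nonneg _
          · exact le_rfl
        refine (add_le_add_left hXY _).trans ?_
        simp only [hY, hZ]
        split_ifs with h
        · refine le_min (by simp) ?_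
          rw [add_zero, ← sq_abs]
          nlinarith [abs_nonneg (w l t)]
        · refine le_min ?_ (by simp)
          rw [← sq_abs (w l t)]
          nlinarith [abs_nonneg (w l t)]

theorem integral_abs_sum_erase_mul_le (hν : ∀ i, IsSymmetricLaw (ν i)) {w : Fin d → ℝ → ℝ}
    (hw : ∀ l, Measurable (w l)) (hodd : ∀ l t, w l (-t) = -w l t)
    (hinteg : ∀ l, Integrable (w l) (ν l)) (i : Fin d) {c : ℝ → ℝ} (hc : Measurable c)
    (hc0 : ∀ t, 0 ≤ c t) :
    ∫ a, |∑ l ∈ Finset.univ.erase i, w l (a l)| * c (a i) ∂(Measure.pi ν) ≤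
      (1 + ∑ l, ∫ t, min (w l t ^ 2) |w l t| ∂(ν l)) * ∫ t, c t ∂(ν i) := by
  set X : Fin d → ℝ → ℝ := fun l ↦ if l = i then c else w l with hX
  have hXm : ∀ l, Measurable (X l) := by
    intro l
    simp only [hX]
    split_ifs
    · exact hc
    · exact hw l
  have hind := (iIndepFun_pi (μ := ν) fun l ↦ (hXm l).aemeasurable).indepFun_finsetSum_of_notMem
    (fun l ↦ (hXm l).comp (measurable_pi_apply l)) (Finset.notMem_erase i Finset.univ)
  have hind2 := hind.comp (φ := fun t ↦ |t|) (ψ := id) measurable_norm measurable_id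
  have h1 : (fun a : Fin d → ℝ ↦ |∑ l ∈ Finset.univ.erase i, w l (a l)|) =
      (fun t ↦ |t|) ∘ ∑ l ∈ Finset.univ.erase i, fun a : Fin d → ℝ ↦ X l (a l) := by
    ext a
    simp only [Function.comp_apply, Finset.sum_apply, hX]
    congr 1
    exact Finset.sum_congr rfl fun l hl ↦ by rw [if_neg (Finset.ne_of_mem_erase hl)]
  have h2 : (fun a : Fin d → ℝ ↦ c (a i)) = id ∘ fun a : Fin d → ℝ ↦ X i (a i) := by
    ext a
    simp [hX]
  rw [← h1, ← h2] at hind2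
  rw [hind2.integral_fun_mul_eq_mul_integral
    (Measurable.aestronglyMeasurable (Finset.measurable_fun_sum _ fun l _ ↦
      (hw l).comp (measurable_pi_apply l)).abs)
    (hc.comp (measurable_pi_apply i)).aestronglyMeasurable,
    integral_comp_eval hc.aestronglyMeasurable]
  exact mul_le_mul_of_nonneg_right (integral_abs_sum_erase_le hν hw hodd hinteg i)
    (integral_nonneg hc0)

theorem integral_mul_pi_of_ne {c c' : ℝ → ℝ} (hc : Measurable c) (hc' : Measurable c')
    {i l : Fin d} (hil : i ≠ l) :
    ∫ a : Fin d → ℝ, c (a i) * c' (a l) ∂(Measure.pi ν) =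
      (∫ t, c t ∂(ν i)) * ∫ t, c' t ∂(ν l) := by
  have hind := ((iIndepFun_pi (μ := ν) (X := fun _ ↦ id)
    fun l ↦ aemeasurable_id).indepFun hil).comp hc hc'
  refine (hind.integral_fun_mul_eq_mul_integral
    (hc.comp (measurable_pi_apply i)).aestronglyMeasurable
    (hc'.comp (measurable_pi_apply l)).aestronglyMeasurable).trans ?_
  congr 1
  · exact integral_comp_eval hc.aestronglyMeasurable
  · exact integral_comp_eval hc'.aestronglyMeasurable

end Independent

theorem pi_withDensity_prod {d : ℕ} {μ : Measure ℝ} [IsProbabilityMeasure μ]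
    {f : Fin d → ℝ → ENNReal} (hf : ∀ l, Measurable (f l))
    [∀ l, IsProbabilityMeasure (μ.withDensity (f l))] :
    (Measure.pi fun _ : Fin d ↦ μ).withDensity (fun a ↦ ∏ l, f l (a l)) =
      Measure.pi fun l ↦ μ.withDensity (f l) := by
  refine (Measure.pi_eq fun s hs ↦ ?_).symm
  rw [withDensity_apply _ (MeasurableSet.univ_pi hs),
    ← lintegral_indicator (MeasurableSet.univ_pi hs)]
  have h1 : ∀ a : Fin d → ℝ, (Set.univ.pi s).indicator (fun a ↦ ∏ l, f l (a l)) a =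
      ∏ l, (s l).indicator (f l) (a l) := by
    intro a
    by_cases ha : a ∈ Set.univ.pi s
    · rw [Set.indicator_of_mem ha]
      exact Finset.prod_congr rfl fun l _ ↦ by rw [Set.indicator_of_mem (ha l trivial)]
    · rw [Set.indicator_of_notMem ha]
      rw [Set.mem_univ_pi] at ha
      push Not at ha
      obtain ⟨l, hl⟩ := ha
      exact (Finset.prod_eq_zero (Finset.mem_univ l) (by rw [Set.indicator_of_notMem hl])).symm
  have hm : ∀ l, Measurable ((s l).indicator (f l)) := fun l ↦ (hf l).indicator (hs l)
  simp only [h1]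
  rw [lintegral_prod_eq_prod_lintegral_of_indepFun Finset.univ
    (fun l (a : Fin d → ℝ) ↦ (s l).indicator (f l) (a l))
    (iIndepFun_pi fun l ↦ (hm l).aemeasurable) fun l ↦ (hm l).comp (measurable_pi_apply l)]
  refine Finset.prod_congr rfl fun l _ ↦ ?_
  rw [withDensity_apply _ (hs l), ← lintegral_indicator (hs l)]
  exact (measurePreserving_eval (fun _ : Fin d ↦ μ) l).lintegral_comp (hm l)

/-- The law with density proportional to `e`. -/
noncomputable def weightedLaw (μ : Measure ℝ) (e : ℝ → ℝ) : Measure ℝ :=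
  μ.withDensity fun t ↦ ENNReal.ofReal (e t / ∫ s, e s ∂μ)

theorem IsSymmetricLaw.weightedLaw {μ : Measure ℝ} (hμ : IsSymmetricLaw μ) {e : ℝ → ℝ}
    (he : Measurable e)
    (heven : ∀ t, e (-t) = e t) : IsSymmetricLaw (weightedLaw μ e) :=
  (measurePreserving_withDensity (g := fun t : ℝ ↦ -t) ⟨measurable_neg, hμ⟩
    (he.div_const _).ennreal_ofReal fun t ↦ by rw [heven]).map_eq

section Weighted

variable {μ : Measure ℝ} [IsProbabilityMeasure μ] {B : ℝ}

theorem integrable_weight {e : ℝ → ℝ} (he : Measurable e) (he1 : ∀ t, 1 ≤ e t)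
    (heB : ∀ t, e t ≤ B) : Integrable e μ :=
  Integrable.of_bound he.aestronglyMeasurable B (ae_of_all _ fun t ↦ by
    rw [Real.norm_of_nonneg (zero_le_one.trans (he1 t))]
    exact heB t)

theorem one_le_integral_weight {e : ℝ → ℝ} (he : Measurable e) (he1 : ∀ t, 1 ≤ e t)
    (heB : ∀ t, e t ≤ B) : 1 ≤ ∫ t, e t ∂μ := by
  have := integral_mono (μ := μ) (integrable_const 1) (integrable_weight he he1 heB) he1
  simpa using this

theorem isProbabilityMeasure_weightedLaw {e : ℝ → ℝ} (he : Measurable e) (he1 : ∀ t, 1 ≤ e t)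
    (heB : ∀ t, e t ≤ B) : IsProbabilityMeasure (weightedLaw μ e) := by
  have h1 := one_le_integral_weight (μ := μ) he he1 heB
  refine ⟨?_⟩
  rw [weightedLaw, withDensity_apply _ MeasurableSet.univ, Measure.restrict_univ,
    ← ofReal_integral_eq_lintegral_ofReal ((integrable_weight he he1 heB).div_const _)
      (ae_of_all _ fun t ↦ div_nonneg (zero_le_one.trans (he1 t)) (zero_le_one.trans h1)),
    integral_div, div_self (by linarith), ENNReal.ofReal_one]

theorem integral_weightedLaw_le {e : ℝ → ℝ} (he : Measurable e) (he1 : ∀ t, 1 ≤ e t)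
    (heB : ∀ t, e t ≤ B) {g : ℝ → ℝ} (hg : ∀ t, 0 ≤ g t) :
    ∫ t, g t ∂(weightedLaw μ e) ≤ ∫ t, g t * e t ∂μ := by
  have h1 := one_le_integral_weight (μ := μ) he he1 heB
  rw [weightedLaw, integral_withDensity_eq_integral_toReal_smul
    (he.div_const _).ennreal_ofReal (ae_of_all _ fun _ ↦ ENNReal.ofReal_lt_top)]
  have h2 : ∀ t, (ENNReal.ofReal (e t / ∫ s, e s ∂μ)).toReal • g t =
      (g t * e t) / ∫ s, e s ∂μ := by
    intro t
    rw [ENNReal.toReal_ofReal (div_nonneg (zero_le_one.trans (he1 t)) (zero_le_one.trans h1)),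
      smul_eq_mul]
    ring
  simp only [h2]
  rw [integral_div]
  exact div_le_self (integral_nonneg fun t ↦ mul_nonneg (hg t) (zero_le_one.trans (he1 t))) h1

variable {d : ℕ} {e : Fin d → ℝ → ℝ}

theorem integral_mul_prod_weight (he : ∀ l, Measurable (e l)) (he1 : ∀ l t, 1 ≤ e l t)
    (heB : ∀ l t, e l t ≤ B) (Φ : (Fin d → ℝ) → ℝ) :
    ∫ a, Φ a * ∏ l, e l (a l) ∂(Measure.pi fun _ ↦ μ) =
      (∏ l, ∫ t, e l t ∂μ) * ∫ a, Φ a ∂(Measure.pi fun l ↦ weightedLaw μ (e l)) := by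
  have hE : ∀ l, 1 ≤ ∫ t, e l t ∂μ := fun l ↦ one_le_integral_weight (he l) (he1 l) (heB l)
  have hm : ∀ l, Measurable fun t ↦ ENNReal.ofReal (e l t / ∫ s, e l s ∂μ) :=
    fun l ↦ ((he l).div_const _).ennreal_ofReal
  have : ∀ l, IsProbabilityMeasure (μ.withDensity fun t ↦
      ENNReal.ofReal (e l t / ∫ s, e l s ∂μ)) :=
    fun l ↦ isProbabilityMeasure_weightedLaw (he l) (he1 l) (heB l)
  have hpi : (Measure.pi fun l ↦ weightedLaw μ (e l)) =
      (Measure.pi fun _ : Fin d ↦ μ).withDensity fun a ↦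
        ∏ l, ENNReal.ofReal (e l (a l) / ∫ s, e l s ∂μ) := (pi_withDensity_prod hm).symm
  have hmp : Measurable fun a : Fin d → ℝ ↦
      ∏ l, ENNReal.ofReal (e l (a l) / ∫ s, e l s ∂μ) :=
    Finset.measurable_fun_prod _ fun l _ ↦ (hm l).comp (measurable_pi_apply l)
  rw [hpi, integral_withDensity_eq_integral_toReal_smul hmp (ae_of_all _ fun a ↦ ENNReal.prod_lt_top
      fun l _ ↦ ENNReal.ofReal_lt_top),
    ← integral_const_mul]
  refine integral_congr_ae (ae_of_all _ fun a ↦ ?_)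
  have h1 : (∏ l, ∫ t, e l t ∂μ) ≠ 0 :=
    Finset.prod_ne_zero_iff.2 fun l _ ↦ (zero_lt_one.trans_le (hE l)).ne'
  have h2 : (∏ l, ENNReal.ofReal (e l (a l) / ∫ s, e l s ∂μ)).toReal =
      (∏ l, e l (a l)) / ∏ l, ∫ s, e l s ∂μ := by
    rw [ENNReal.toReal_prod, ← Finset.prod_div_distrib]
    exact Finset.prod_congr rfl fun l _ ↦ ENNReal.toReal_ofReal
      (div_nonneg (zero_le_one.trans (he1 l _)) (zero_le_one.trans (hE l)))
  simp only [smul_eq_mul]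
  rw [h2]
  field_simp

/-- Second moment bound, under a product weight, for a sum of truncated interaction terms. -/
theorem integral_sq_sum_min_mul_prod_le (hμ : IsSymmetricLaw μ) (he : ∀ l, Measurable (e l))
    (he1 : ∀ l t, 1 ≤ e l t) (heB : ∀ l t, e l t ≤ B) (heven : ∀ l t, e l (-t) = e l t)
    {w : Fin d → Fin d → ℝ → ℝ} (hw : ∀ i l, Measurable (w i l))
    (hodd : ∀ i l t, w i l (-t) = -w i l t) (hwB : ∀ i l t, |w i l t| ≤ B)
    {c : Fin d → ℝ → ℝ} (hc : ∀ i, Measurable (c i)) (hc0 : ∀ i t, 0 ≤ c i t)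
    (hcB : ∀ i t, c i t ≤ B) {Q Ω : ℝ} (hΩ0 : 0 ≤ Ω) (S : Finset (Fin d))
    (hQ : ∑ i ∈ S, ∫ t, c i t * e i t ∂μ ≤ Q)
    (hΩ : ∀ i, 1 + ∑ l, ∫ t, min (w i l t ^ 2) |w i l t| * e l t ∂μ ≤ Ω) :
    ∫ a : Fin d → ℝ, (∑ i ∈ S, min |∑ l ∈ Finset.univ.erase i, w i l (a l)| (c i (a i))) ^ 2 *
      ∏ l, e l (a l) ∂(Measure.pi fun _ ↦ μ) ≤ (∏ l, ∫ t, e l t ∂μ) * (Q * (Ω + Q)) := by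
  rw [integral_mul_prod_weight he he1 heB]
  have hE : ∀ l, 1 ≤ ∫ t, e l t ∂μ := fun l ↦ one_le_integral_weight (he l) (he1 l) (heB l)
  refine mul_le_mul_of_nonneg_left ?_
    (Finset.prod_nonneg fun l _ ↦ zero_le_one.trans (hE l))
  have hprob : ∀ l, IsProbabilityMeasure (weightedLaw μ (e l)) :=
    fun l ↦ isProbabilityMeasure_weightedLaw (he l) (he1 l) (heB l)
  have hsym : ∀ l, IsSymmetricLaw (weightedLaw μ (e l)) :=
    fun l ↦ hμ.weightedLaw (he l) (heven l)
  set P := Measure.pi fun l ↦ weightedLaw μ (e l) with hP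
  have hB0 : ∀ i : Fin d, 0 ≤ B := fun i ↦ (hc0 i 0).trans (hcB i 0)
  set q : Fin d → ℝ := fun i ↦ ∫ t, c i t * e i t ∂μ with hq
  have hq0 : ∀ i, 0 ≤ q i := fun i ↦ integral_nonneg fun t ↦
    mul_nonneg (hc0 i t) (zero_le_one.trans (he1 i t))
  have hcq : ∀ i, ∫ t, c i t ∂(weightedLaw μ (e i)) ≤ q i := fun i ↦
    integral_weightedLaw_le (he i) (he1 i) (heB i) (hc0 i)
  have hW : ∀ i, Measurable fun a : Fin d → ℝ ↦ |∑ l ∈ Finset.univ.erase i, w i l (a l)| :=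
    fun i ↦ (Finset.measurable_fun_sum _ fun l _ ↦
      (hw i l).comp (measurable_pi_apply l)).abs
  have hci : ∀ i, Measurable fun a : Fin d → ℝ ↦ c i (a i) := fun i ↦
    (hc i).comp (measurable_pi_apply i)
  have hWB : ∀ i (a : Fin d → ℝ), |∑ l ∈ Finset.univ.erase i, w i l (a l)| ≤ d * B := by
    intro i a
    refine (Finset.abs_sum_le_sum_abs _ _).trans
      ((Finset.sum_le_sum_of_subset_of_nonneg (Finset.subset_univ _)
        fun l _ _ ↦ abs_nonneg _).trans ((Finset.sum_le_sum fun l _ ↦ hwB i l _).trans ?_))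
    simp
  have hi1 : ∀ i, Integrable (fun a : Fin d → ℝ ↦
      |∑ l ∈ Finset.univ.erase i, w i l (a l)| * c i (a i)) P := by
    intro i
    refine Integrable.of_bound ((hW i).mul (hci i)).aestronglyMeasurable (d * B * B)
      (ae_of_all _ fun a ↦ ?_)
    rw [Real.norm_of_nonneg (mul_nonneg (abs_nonneg _) (hc0 i _))]
    exact mul_le_mul (hWB i a) (hcB i _) (hc0 i _) (by have := hB0 i; positivity)
  have hi2 : ∀ i l, Integrable (fun a : Fin d → ℝ ↦ c i (a i) * c l (a l)) P := by
    intro i l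
    refine Integrable.of_bound ((hci i).mul (hci l)).aestronglyMeasurable (B * B)
      (ae_of_all _ fun a ↦ ?_)
    rw [Real.norm_of_nonneg (mul_nonneg (hc0 i _) (hc0 l _))]
    exact mul_le_mul (hcB i _) (hcB l _) (hc0 l _) (hB0 i)
  have hI1 : Integrable (fun a : Fin d → ℝ ↦
      ∑ i ∈ S, |∑ l ∈ Finset.univ.erase i, w i l (a l)| * c i (a i)) P :=
    integrable_finsetSum _ fun i _ ↦ hi1 i
  have hI3 : ∀ i, Integrable (fun a : Fin d → ℝ ↦ ∑ l ∈ S.erase i, c i (a i) * c l (a l)) P :=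
    fun i ↦ integrable_finsetSum _ fun l _ ↦ hi2 i l
  have hI2 : Integrable (fun a : Fin d → ℝ ↦
      ∑ i ∈ S, ∑ l ∈ S.erase i, c i (a i) * c l (a l)) P :=
    integrable_finsetSum _ fun i _ ↦ hI3 i
  have hb1 : ∀ i, ∫ a : Fin d → ℝ,
      |∑ l ∈ Finset.univ.erase i, w i l (a l)| * c i (a i) ∂P ≤ Ω * q i := by
    intro i
    refine (integral_abs_sum_erase_mul_le hsym (hw i) (hodd i) (fun l ↦ Integrable.of_bound
      (hw i l).aestronglyMeasurable B (ae_of_all _ (hwB i l))) i (hc i) (hc0 i)).trans ?_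
    refine mul_le_mul (le_trans ?_ (hΩ i)) (hcq i) (integral_nonneg (hc0 i)) hΩ0
    refine add_le_add le_rfl (Finset.sum_le_sum fun l _ ↦ ?_)
    exact integral_weightedLaw_le (he l) (he1 l) (heB l) fun t ↦
      le_min (sq_nonneg _) (abs_nonneg _)
  have hb2 : ∀ i l, i ≠ l → ∫ a : Fin d → ℝ, c i (a i) * c l (a l) ∂P ≤ q i * q l := by
    intro i l hil
    rw [hP, integral_mul_pi_of_ne (hc i) (hc l) hil]
    exact mul_le_mul (hcq i) (hcq l) (integral_nonneg (hc0 l)) (hq0 i)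
  have hQ0 : 0 ≤ ∑ i ∈ S, q i := Finset.sum_nonneg fun i _ ↦ hq0 i
  calc _ ≤ ∫ a : Fin d → ℝ, (∑ i ∈ S, |∑ l ∈ Finset.univ.erase i, w i l (a l)| * c i (a i) +
        ∑ i ∈ S, ∑ l ∈ S.erase i, c i (a i) * c l (a l)) ∂P :=
        integral_mono_of_nonneg (ae_of_all _ fun a ↦ sq_nonneg _) (hI1.add hI2)
          (ae_of_all _ fun a ↦ sq_sum_min_le S fun i _ ↦ hc0 i _)
    _ = ∑ i ∈ S, ∫ a : Fin d → ℝ, |∑ l ∈ Finset.univ.erase i, w i l (a l)| * c i (a i) ∂P +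
        ∑ i ∈ S, ∑ l ∈ S.erase i, ∫ a : Fin d → ℝ, c i (a i) * c l (a l) ∂P := by
        rw [integral_add hI1 hI2, integral_finsetSum _ fun i _ ↦ hi1 i,
          integral_finsetSum _ fun i _ ↦ hI3 i]
        congr 1
        exact Finset.sum_congr rfl fun i _ ↦ integral_finsetSum _ fun l _ ↦ hi2 i l
    _ ≤ ∑ i ∈ S, Ω * q i + ∑ i ∈ S, ∑ l ∈ S.erase i, q i * q l := by
        refine add_le_add (Finset.sum_le_sum fun i _ ↦ hb1 i) (Finset.sum_le_sum fun i _ ↦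
          Finset.sum_le_sum fun l hl ↦ hb2 i l (Finset.ne_of_mem_erase hl).symm)
    _ ≤ ∑ i ∈ S, Ω * q i + ∑ i ∈ S, ∑ l ∈ S, q i * q l := by
        refine add_le_add le_rfl (Finset.sum_le_sum fun i _ ↦
          Finset.sum_le_sum_of_subset_of_nonneg (Finset.erase_subset _ _)
            fun l _ _ ↦ mul_nonneg (hq0 i) (hq0 l))
    _ = (∑ i ∈ S, q i) * (Ω + ∑ i ∈ S, q i) := by
        rw [← Finset.mul_sum, ← Finset.sum_mul_sum]
        ring
    _ ≤ _ := by
        gcongr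
        exact hQ0.trans hQ

end Weighted

/-- Truncation of a real number to the interval `[-R, R]`. -/
def clip (R t : ℝ) : ℝ := max (-R) (min R t)

theorem measurable_clip (R : ℝ) : Measurable (clip R) := by
  unfold clip
  fun_prop

theorem clip_neg {R : ℝ} (hR : 0 ≤ R) (t : ℝ) : clip R (-t) = -clip R t := by
  unfold clip
  grind

theorem abs_clip {R : ℝ} (hR : 0 ≤ R) (t : ℝ) : |clip R t| = min R |t| := by
  unfold clip
  grind

theorem abs_clip_le {R : ℝ} (hR : 0 ≤ R) (t : ℝ) : |clip R t| ≤ R := by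
  rw [abs_clip hR]
  exact min_le_left _ _

theorem sq_clip {R : ℝ} (hR : 0 ≤ R) (t : ℝ) : clip R t ^ 2 = min (R ^ 2) (t ^ 2) := by
  rw [← sq_abs, abs_clip hR, ← sq_abs t]
  rcases le_total R |t| with h | h
  · rw [min_eq_left h, min_eq_left (by gcongr)]
  · rw [min_eq_right h, min_eq_right (by gcongr)]

theorem abs_clip_sub_clip_le {h R : ℝ} (hh : 0 ≤ h) (hR : h ≤ R) (t : ℝ) :
    |clip R t - clip h t| ≤ |clip R t| := by
  unfold clip
  grind

theorem abs_clip_sub_clip_le_excess {h R : ℝ} (hh : 0 ≤ h) (hR : h ≤ R) (t : ℝ) :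
    |clip R t - clip h t| ≤ max (|t| - h) 0 := by
  unfold clip
  grind

theorem abs_sub_clip {R : ℝ} (hR : 0 ≤ R) (t : ℝ) : |t - clip R t| = max (|t| - R) 0 := by
  unfold clip
  grind

theorem clip_mul_clip_sub_nonneg {h R : ℝ} (hh : 0 ≤ h) (hR : h ≤ R) (t : ℝ) :
    0 ≤ clip R t * (clip R t - clip h t) := by
  rcases le_total 0 t with ht | ht
  · refine mul_nonneg ?_ ?_ <;> unfold clip <;> grind
  · refine mul_nonneg_of_nonpos_of_nonpos ?_ ?_ <;> unfold clip <;> grind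

theorem clip_mul_sub_nonneg {R : ℝ} (hR : 0 ≤ R) (t : ℝ) : 0 ≤ clip R t * (t - clip R t) := by
  rcases le_total 0 t with ht | ht
  · refine mul_nonneg ?_ ?_ <;> unfold clip <;> grind
  · refine mul_nonneg_of_nonpos_of_nonpos ?_ ?_ <;> unfold clip <;> grind

theorem min_sq_abs_le {s t : ℝ} (h : |s| ≤ |t|) : min (s ^ 2) |s| ≤ min (t ^ 2) |t| :=
  min_le_min (by rw [← sq_abs, ← sq_abs t]; gcongr) h

theorem min_sq_abs_le_add (t : ℝ) : min (t ^ 2) |t| ≤ min 1 (t ^ 2) + max (|t| - 1) 0 := by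
  rcases le_total |t| 1 with h | h
  · have h1 : t ^ 2 ≤ 1 := (sq_le_one_iff_abs_le_one t).2 h
    rw [min_eq_right h1, max_eq_right (by linarith)]
    linarith [min_le_left (t ^ 2) |t|]
  · have h1 : 1 ≤ t ^ 2 := (one_le_sq_iff_one_le_abs t).2 h
    rw [min_eq_left h1, max_eq_left (by linarith)]
    linarith [min_le_right (t ^ 2) |t|]

theorem integral_exp_sum_le_of_odd {d : ℕ} {μ : Measure ℝ} [IsProbabilityMeasure μ]
    (hμ : IsSymmetricLaw μ) {y : ℝ → ℝ} (hy : Measurable y) (hodd : ∀ t, y (-t) = -y t) {h : ℝ}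
    (hyh : ∀ t, |y t| ≤ h) {v : Fin d → ℝ} (hv : ∀ i, |v i| * h ≤ 1) :
    ∫ a : Fin d → ℝ, Real.exp (∑ i, y (a i) * v i) ∂(Measure.pi fun _ ↦ μ) ≤
      Real.exp ((∑ i, v i ^ 2) * ∫ t, y t ^ 2 ∂μ) := by
  simp only [Real.exp_sum]
  rw [integral_fintype_prod_eq_prod (fun i t ↦ Real.exp (y t * v i)), Finset.sum_mul, Real.exp_sum]
  refine Finset.prod_le_prod (fun i _ ↦ integral_nonneg fun t ↦ (Real.exp_pos _).le) fun i _ ↦ ?_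
  have hi1 : Integrable y μ := Integrable.of_bound hy.aestronglyMeasurable h (ae_of_all _ hyh)
  have hi2 : Integrable (fun t ↦ y t ^ 2) μ :=
    Integrable.of_bound (hy.pow_const 2).aestronglyMeasurable (h ^ 2) (ae_of_all _ fun t ↦ by
      rw [Real.norm_of_nonneg (sq_nonneg _), ← sq_abs]
      have := hyh t
      gcongr)
  have i1 : Integrable (fun t ↦ 1 + v i * y t) μ := (integrable_const _).add (hi1.const_mul _)
  have i2 : Integrable (fun t ↦ v i ^ 2 * y t ^ 2) μ := hi2.const_mul _
  calc ∫ t, Real.exp (y t * v i) ∂μ ≤ ∫ t, (1 + v i * y t + v i ^ 2 * y t ^ 2) ∂μ := by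
        refine integral_mono_of_nonneg (ae_of_all _ fun t ↦ (Real.exp_pos _).le) (i1.add i2)
          (ae_of_all _ fun t ↦ ?_)
        have h1 : |y t * v i| ≤ 1 := by
          rw [abs_mul, mul_comm]
          exact (mul_le_mul_of_nonneg_left (hyh t) (abs_nonneg _)).trans (hv i)
        have h2 := (abs_le.1 (Real.abs_exp_sub_one_sub_id_le h1)).2
        change Real.exp (y t * v i) ≤ 1 + v i * y t + v i ^ 2 * y t ^ 2
        nlinarith
    _ = 1 + v i ^ 2 * ∫ t, y t ^ 2 ∂μ := by
        rw [integral_add i1 i2, integral_add (integrable_const _) (hi1.const_mul _),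
          integral_const_mul, integral_const_mul, hμ.integral_odd_eq_zero hy hodd]
        simp
    _ ≤ _ := by
        rw [add_comm]
        exact Real.add_one_le_exp _

theorem integral_sq_mul_exp_le_of_odd {d : ℕ} {μ : Measure ℝ} [IsProbabilityMeasure μ]
    (hμ : IsSymmetricLaw μ) {y : ℝ → ℝ} (hy : Measurable y) (hodd : ∀ t, y (-t) = -y t) {h : ℝ}
    (hyh : ∀ t, |y t| ≤ h) {v : Fin d → ℝ} {lam V : ℝ} (hlam : 0 < lam)
    (hv : ∀ i, 2 * lam * |v i| * h ≤ 1) (hV : 4 * (∑ i, v i ^ 2) * ∫ t, y t ^ 2 ∂μ ≤ V)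
    (hV1 : lam ^ 2 * V ≤ 1) :
    ∫ a : Fin d → ℝ, (∑ i, y (a i) * v i) ^ 2 * Real.exp (lam * |∑ i, y (a i) * v i|)
      ∂(Measure.pi fun _ ↦ μ) ≤ 4 * V := by
  set P := Measure.pi fun _ : Fin d ↦ μ with hP
  set f : (Fin d → ℝ) → ℝ := fun a ↦ ∑ i, y (a i) * v i with hf
  have hfm : Measurable f := Finset.measurable_fun_sum _ fun i _ ↦
    (hy.comp (measurable_pi_apply i)).mul_const _
  have hV0 : 0 ≤ V := by
    refine le_trans ?_ hV
    have : 0 ≤ ∫ t, y t ^ 2 ∂μ := integral_nonneg fun t ↦ sq_nonneg _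
    have := Finset.sum_nonneg fun i (_ : i ∈ Finset.univ) ↦ sq_nonneg (v i)
    positivity
  have hfb : ∀ a, |f a| ≤ ∑ i, h * |v i| := fun a ↦
    (Finset.abs_sum_le_sum_abs _ _).trans (Finset.sum_le_sum fun i _ ↦ by
      rw [abs_mul]
      exact mul_le_mul_of_nonneg_right (hyh _) (abs_nonneg _))
  have hie : ∀ c : ℝ, Integrable (fun a ↦ Real.exp (c * f a)) P := by
    intro c
    refine Integrable.of_bound (Measurable.aestronglyMeasurable (by fun_prop))
      (Real.exp (|c| * ∑ i, h * |v i|)) (ae_of_all _ fun a ↦ ?_)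
    rw [Real.norm_of_nonneg (Real.exp_pos _).le]
    refine Real.exp_le_exp.2 ((le_abs_self _).trans ?_)
    rw [abs_mul]
    exact mul_le_mul_of_nonneg_left (hfb a) (abs_nonneg _)
  have hexp : ∀ c : ℝ, |c| = 2 * lam → ∫ a, Real.exp (c * f a) ∂P ≤ 1 + 2 * (lam ^ 2 * V) := by
    intro c hc
    have h1 : ∀ a, c * f a = ∑ i, y (a i) * (c * v i) := by
      intro a
      rw [hf, Finset.mul_sum]
      exact Finset.sum_congr rfl fun i _ ↦ by ring
    simp only [h1]
    refine (integral_exp_sum_le_of_odd hμ hy hodd hyh fun i ↦ ?_).trans ?_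
    · rw [abs_mul, hc]
      exact hv i
    · have h2 : (∑ i, (c * v i) ^ 2) * ∫ t, y t ^ 2 ∂μ ≤ lam ^ 2 * V := by
        have h3 : ∑ i, (c * v i) ^ 2 = 4 * lam ^ 2 * ∑ i, v i ^ 2 := by
          rw [Finset.mul_sum]
          refine Finset.sum_congr rfl fun i _ ↦ ?_
          rw [mul_pow, ← sq_abs c, hc]
          ring
        rw [h3]
        nlinarith [sq_nonneg lam]
      refine (Real.exp_le_exp.2 h2).trans ?_
      have h4 : 0 ≤ lam ^ 2 * V := by positivity
      have h5 := Real.abs_exp_sub_one_le (x := lam ^ 2 * V) (by rwa [abs_of_nonneg h4])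
      rw [abs_of_nonneg h4] at h5
      linarith [(abs_le.1 h5).2]
  calc _ ≤ ∫ a, (lam ^ 2)⁻¹ * (Real.exp (2 * lam * f a) + Real.exp (-(2 * lam) * f a) - 2) ∂P := by
        refine integral_mono_of_nonneg (ae_of_all _ fun a ↦ by positivity)
          ((((hie _).add (hie _)).sub (integrable_const _)).const_mul _) (ae_of_all _ fun a ↦ ?_)
        simp only [neg_mul]
        exact sq_mul_exp_mul_abs_le hlam (f a)
    _ = (lam ^ 2)⁻¹ * (∫ a, Real.exp (2 * lam * f a) ∂P +
        ∫ a, Real.exp (-(2 * lam) * f a) ∂P - 2) := by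
        have i1 : Integrable (fun a ↦ Real.exp (2 * lam * f a) + Real.exp (-(2 * lam) * f a)) P :=
          (hie _).add (hie _)
        rw [integral_const_mul, integral_sub i1 (integrable_const _), integral_add (hie _) (hie _)]
        simp
    _ ≤ (lam ^ 2)⁻¹ * ((1 + 2 * (lam ^ 2 * V)) + (1 + 2 * (lam ^ 2 * V)) - 2) := by
        gcongr
        · exact hexp _ (abs_of_pos (by positivity))
        · exact hexp _ (by rw [abs_neg, abs_of_pos (by positivity)])
    _ = 4 * V := by
        field_simp
        ring

namespace IsStableLaw

variable {p : ℝ} {μ : Measure ℝ} [IsProbabilityMeasure μ]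

theorem integral_sq_clip_le (hμ : IsStableLaw p μ) (hp : 0 < p) {R : ℝ} (hR : 0 < R) :
    ∫ t, clip R t ^ 2 ∂μ ≤ 16 * R ^ (2 - p) := by
  simp only [sq_clip hR.le]
  exact hμ.integral_min_sq_le hp hR

theorem integral_abs_clip_sub_clip_le (hμ : IsStableLaw p μ) (hp : 1 < p) {h R : ℝ} (hh : 0 < h)
    (hR : h ≤ R) : ∫ t, |clip R t - clip h t| ∂μ ≤ 16 * (h ^ (1 - p) / (p - 1)) :=
  (integral_mono_of_nonneg (ae_of_all _ fun _ ↦ abs_nonneg _) (hμ.integrable_excess hp hh)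
    (ae_of_all _ fun t ↦ abs_clip_sub_clip_le_excess hh.le hR t)).trans
    (hμ.integral_excess_le hp hh)

theorem integrable_min_sq_abs_mul (hμ : IsStableLaw p μ) (hp : 1 < p) (x : ℝ) :
    Integrable (fun t ↦ min ((t * x) ^ 2) |t * x|) μ := by
  refine ((hμ.integrable_id hp).mul_const x).mono
    (Measurable.aestronglyMeasurable (by fun_prop)) (ae_of_all _ fun t ↦ ?_)
  rw [Real.norm_of_nonneg (le_min (sq_nonneg _) (abs_nonneg _))]
  exact min_le_right _ _

theorem integral_min_sq_abs_mul_le (hμ : IsStableLaw p μ) (hp : 1 < p) (x : ℝ) :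
    ∫ t, min ((t * x) ^ 2) |t * x| ∂μ ≤ 16 * (1 + 1 / (p - 1)) * |x| ^ p := by
  rcases eq_or_ne x 0 with rfl | hx
  · simp [Real.zero_rpow (by linarith : p ≠ 0)]
  have hx0 : 0 < |x| := abs_pos.2 hx
  have hR : 0 < |x|⁻¹ := inv_pos.2 hx0
  have h1 := hμ.integral_min_one_sq_le (by linarith) hR
  have h2 := hμ.integral_excess_le hp hR
  have e1 : ∀ t, min 1 ((t / |x|⁻¹) ^ 2) = min 1 ((t * x) ^ 2) := by
    intro t
    rw [div_inv_eq_mul, mul_pow, sq_abs, mul_pow]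
  simp only [e1] at h1
  have e2 : ∀ t, max (|t * x| - 1) 0 = |x| * max (|t| - |x|⁻¹) 0 := by
    intro t
    rw [mul_max_of_nonneg _ _ hx0.le, mul_zero, mul_sub, mul_inv_cancel₀ hx0.ne', abs_mul, mul_comm]
  have i1 : Integrable (fun t ↦ min 1 ((t * x) ^ 2)) μ := by
    refine Integrable.of_bound (Measurable.aestronglyMeasurable (by fun_prop)) 1
      (ae_of_all _ fun t ↦ ?_)
    rw [Real.norm_of_nonneg (le_min zero_le_one (sq_nonneg _))]
    exact min_le_left _ _
  have i2 : Integrable (fun t ↦ |x| * max (|t| - |x|⁻¹) 0) μ :=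
    (hμ.integrable_excess hp hR).const_mul _
  have e3 : |x|⁻¹ ^ (-p) = |x| ^ p := by
    rw [Real.inv_rpow hx0.le, ← Real.rpow_neg hx0.le, neg_neg]
  have e4 : |x| * |x|⁻¹ ^ (1 - p) = |x| ^ p := by
    rw [Real.inv_rpow hx0.le, ← Real.rpow_neg hx0.le, ← Real.rpow_one_add' hx0.le (by linarith)]
    ring_nf
  calc ∫ t, min ((t * x) ^ 2) |t * x| ∂μ
      ≤ ∫ t, (min 1 ((t * x) ^ 2) + |x| * max (|t| - |x|⁻¹) 0) ∂μ := by
        refine integral_mono (hμ.integrable_min_sq_abs_mul hp x) (i1.add i2) fun t ↦ ?_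
        change min ((t * x) ^ 2) |t * x| ≤ min 1 ((t * x) ^ 2) + |x| * max (|t| - |x|⁻¹) 0
        rw [← e2]
        exact min_sq_abs_le_add _
    _ = ∫ t, min 1 ((t * x) ^ 2) ∂μ + |x| * ∫ t, max (|t| - |x|⁻¹) 0 ∂μ := by
        rw [integral_add i1 i2, integral_const_mul]
    _ ≤ 16 * |x|⁻¹ ^ (-p) + |x| * (16 * (|x|⁻¹ ^ (1 - p) / (p - 1))) := by gcongr
    _ = 16 * |x|⁻¹ ^ (-p) + 16 * (|x| * |x|⁻¹ ^ (1 - p)) / (p - 1) := by ring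
    _ = _ := by
        rw [e3, e4]
        ring

end IsStableLaw

theorem exp_mul_le_one_add {lam M K c : ℝ} (hM : 0 < M) (hc : 0 ≤ c) (hcM : c ≤ M)
    (hK : Real.exp (lam * M) ≤ 1 + K) : Real.exp (lam * c) ≤ 1 + K * (c / M) := by
  have h1 : c / M ≤ 1 := (div_le_one hM).2 hcM
  have h0 : 0 ≤ c / M := by positivity
  have h := convexOn_exp.2 (Set.mem_univ 0) (Set.mem_univ (lam * M)) (sub_nonneg.2 h1) h0
    (by ring)
  have e : (1 - c / M) • (0 : ℝ) + (c / M) • (lam * M) = lam * c := by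
    simp only [smul_eq_mul]
    field_simp
    ring
  rw [e, Real.exp_zero] at h
  simp only [smul_eq_mul] at h
  nlinarith

theorem exp_le_one_add_mul_exp (t : ℝ) : Real.exp t ≤ 1 + t * Real.exp t := by
  have h := Real.add_one_le_exp (-t)
  have h1 : Real.exp t * Real.exp (-t) = 1 := by rw [← Real.exp_add]; simp
  nlinarith [Real.exp_pos t]

theorem abs_eq_add_abs_sub {s t : ℝ} (h : 0 ≤ s * (t - s)) : |t| = |s| + |t - s| := by
  have := (abs_add_eq_add_abs_iff s (t - s)).2 (by
    rcases lt_trichotomy s 0 with hs | hs | hs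
    · exact Or.inr ⟨hs.le, by nlinarith⟩
    · rcases le_total 0 (t - s) with h' | h'
      · exact Or.inl ⟨hs.ge, h'⟩
      · exact Or.inr ⟨hs.le, h'⟩
    · exact Or.inl ⟨hs.le, by nlinarith⟩)
  rwa [add_sub_cancel] at this

namespace IsDyadicStep

variable {p : ℝ} {d b : ℕ} {x x' : Fin d → ℝ} {S : Finset (Fin d)}

theorem mul_sub_nonneg (hS : IsDyadicStep p b x x' S) (i : Fin d) : 0 ≤ x i * (x' i - x i) := by
  by_cases hi : i ∈ S
  · exact hS.mul_nonneg i hi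
  · rw [hS.eq_of_notMem i hi]
    simp

theorem abs_sub_eq_ite (hS : IsDyadicStep p b x x' S) (i : Fin d) :
    |x' i - x i| = if i ∈ S then ((2 : ℝ) ^ b)⁻¹ else 0 := by
  split_ifs with hi
  · exact hS.abs_sub i hi
  · rw [hS.eq_of_notMem i hi]
    simp

theorem abs_sub_le (hS : IsDyadicStep p b x x' S) (i : Fin d) :
    |x' i - x i| ≤ ((2 : ℝ) ^ b)⁻¹ := by
  rw [hS.abs_sub_eq_ite]
  split_ifs
  · exact le_rfl
  · positivity

theorem abs_le_of_mem (hS : IsDyadicStep p b x x' S) (hp : 1 ≤ p) {i : Fin d} (hi : i ∈ S) :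
    |x' i| ≤ |x' i| ^ p * ((2 : ℝ) ^ b)⁻¹ ^ (1 - p) := by
  have hδ : 0 < ((2 : ℝ) ^ b)⁻¹ := by positivity
  have h1 : ((2 : ℝ) ^ b)⁻¹ ≤ |x' i| := by
    rw [abs_eq_add_abs_sub (hS.mul_sub_nonneg i), hS.abs_sub i hi]
    linarith [abs_nonneg (x i)]
  have hx : 0 < |x' i| := hδ.trans_le h1
  calc |x' i| = |x' i| ^ p * |x' i| ^ (1 - p) := by
        rw [← Real.rpow_add hx]
        simp
    _ ≤ _ := by
        gcongr ?_ * ?_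
        exact Real.rpow_le_rpow_of_nonpos hδ h1 (by linarith)

end IsDyadicStep

/-- The part of the truncation at level `R` lying above level `h`. -/
def clipExcess (R h t : ℝ) : ℝ := clip R t - clip h t

theorem measurable_clipExcess (R h : ℝ) : Measurable (clipExcess R h) :=
  (measurable_clip R).sub (measurable_clip h)

theorem clipExcess_neg {R h : ℝ} (hh : 0 ≤ h) (hR : h ≤ R) (t : ℝ) :
    clipExcess R h (-t) = -clipExcess R h t := by
  rw [clipExcess, clipExcess, clip_neg hh, clip_neg (hh.trans hR)]
  ring

theorem abs_clipExcess_le {R h : ℝ} (hh : 0 ≤ h) (hR : h ≤ R) (t : ℝ) :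
    |clipExcess R h t| ≤ |clip R t| := abs_clip_sub_clip_le hh hR t

theorem abs_clipExcess_le' {R h : ℝ} (hh : 0 ≤ h) (hR : h ≤ R) (t : ℝ) :
    |clipExcess R h t| ≤ R := (abs_clipExcess_le hh hR t).trans (abs_clip_le (hh.trans hR) t)

theorem abs_clip_mul_add_le {R h : ℝ} (hh : 0 ≤ h) (hR : h ≤ R) {s s' : ℝ}
    (hs : 0 ≤ s * (s' - s)) (t : ℝ) :
    |clip R t * s + clipExcess R h t * (s' - s)| ≤ |clip R t| * |s'| := by
  refine (abs_add_le _ _).trans ?_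
  rw [abs_mul, abs_mul, abs_eq_add_abs_sub hs]
  nlinarith [abs_nonneg (s' - s), abs_clipExcess_le hh hR t]

/-- The absolute value of the truncated form with its diagonal part removed. -/
noncomputable def truncatedForm {d : ℕ} (R h : ℝ) (a x : Fin d → ℝ) : ℝ :=
  |∑ i, clip R (a i) * x i| - ∑ i, |clipExcess R h (a i)| * |x i|

/-- The interaction sum controlling one link of the chain. -/
noncomputable def interactionSum {d : ℕ} (R h : ℝ) (x x' a : Fin d → ℝ) : ℝ :=
  ∑ i, min |∑ l ∈ Finset.univ.erase i, if l < i then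
      clip R (a l) * x l + clipExcess R h (a l) * (x' l - x l) else clip R (a l) * x l|
    |clipExcess R h (a i) * (x' i - x i)|

theorem abs_truncatedForm_sub_sub_le {d : ℕ} {R h : ℝ} (hh : 0 ≤ h) (hR : h ≤ R)
    {x x' : Fin d → ℝ} (hx : ∀ i, 0 ≤ x i * (x' i - x i)) (a : Fin d → ℝ) :
    ∃ u₁ u₂ : ℝ, truncatedForm R h a x' - truncatedForm R h a x = u₁ + u₂ ∧
      |u₁| ≤ |∑ i, clip h (a i) * (x' i - x i)| ∧ |u₂| ≤ 2 * interactionSum R h x x' a := by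
  refine ⟨|∑ i, clip R (a i) * x' i| -
      |∑ i, (clip R (a i) * x i + clipExcess R h (a i) * (x' i - x i))|,
    |∑ i, (clip R (a i) * x i + clipExcess R h (a i) * (x' i - x i))| -
      |∑ i, clip R (a i) * x i| - ∑ i, |clipExcess R h (a i) * (x' i - x i)|, ?_, ?_, ?_⟩
  · have h1 : ∑ i, |clipExcess R h (a i) * (x' i - x i)| =
        ∑ i, |clipExcess R h (a i)| * |x' i| - ∑ i, |clipExcess R h (a i)| * |x i| := by
      rw [← Finset.sum_sub_distrib]
      refine Finset.sum_congr rfl fun i _ ↦ ?_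
      rw [abs_mul, abs_eq_add_abs_sub (hx i)]
      ring
    rw [h1, truncatedForm, truncatedForm]
    ring
  · refine (abs_abs_sub_abs_le_abs_sub _ _).trans (le_of_eq ?_)
    rw [← Finset.sum_sub_distrib]
    congr 1
    refine Finset.sum_congr rfl fun i _ ↦ ?_
    rw [clipExcess]
    ring
  · refine abs_abs_sum_add_sub_le _ _ fun i ↦ ?_
    have := mul_nonneg (clip_mul_clip_sub_nonneg hh hR (a i)) (hx i)
    rw [clipExcess]
    nlinarith

theorem interactionSum_nonneg {d : ℕ} (R h : ℝ) (x x' a : Fin d → ℝ) :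
    0 ≤ interactionSum R h x x' a :=
  Finset.sum_nonneg fun _ _ ↦ le_min (abs_nonneg _) (abs_nonneg _)

theorem interactionSum_le {d : ℕ} (R h : ℝ) (x x' a : Fin d → ℝ) :
    interactionSum R h x x' a ≤ ∑ i, |clipExcess R h (a i) * (x' i - x i)| :=
  Finset.sum_le_sum fun _ _ ↦ min_le_right _ _

theorem measurable_interactionSum {d : ℕ} (R h : ℝ) (x x' : Fin d → ℝ) :
    Measurable (interactionSum R h x x') := by
  have h1 := measurable_clip R
  have h2 := measurable_clipExcess R h
  refine Finset.measurable_fun_sum _ fun i _ ↦ (Finset.measurable_fun_sum _ fun l _ ↦ ?_).abs.min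
    (((h2.comp (measurable_pi_apply i)).mul_const _).abs)
  split_ifs
  · exact ((h1.comp (measurable_pi_apply l)).mul_const _).add
      ((h2.comp (measurable_pi_apply l)).mul_const _)
  · exact (h1.comp (measurable_pi_apply l)).mul_const _

namespace IsStableLaw

variable {p : ℝ} {μ : Measure ℝ} [IsProbabilityMeasure μ] {R h : ℝ}

theorem integral_sq_clipExcess_le (hμ : IsStableLaw p μ) (hp : 0 < p) (hh : 0 < h) (hR : h ≤ R) :
    ∫ t, clipExcess R h t ^ 2 ∂μ ≤ 16 * R ^ (2 - p) := by
  have hR0 := hh.trans_le hR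
  refine (integral_mono_of_nonneg (ae_of_all _ fun t ↦ sq_nonneg _) ?_
    (ae_of_all _ fun t ↦ ?_)).trans (hμ.integral_sq_clip_le hp hR0)
  · refine Integrable.of_bound ((measurable_clip R).pow_const 2).aestronglyMeasurable (R ^ 2)
      (ae_of_all _ fun t ↦ ?_)
    rw [Real.norm_of_nonneg (sq_nonneg _), ← sq_abs]
    have := abs_clip_le hR0.le t
    gcongr
  · exact sq_le_sq.2 (abs_clipExcess_le hh.le hR t)

theorem integral_abs_clipExcess_mul_exp_le (hμ : IsStableLaw p μ) (hp : 1 < p) (hh : 0 < h)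
    (hR : h ≤ R) {δ lam K : ℝ} (hδ : 0 < δ) (hK0 : 0 ≤ K)
    (hK : Real.exp (lam * (R * δ)) ≤ 1 + K) :
    ∫ t, |clipExcess R h t| * δ * Real.exp (lam * (|clipExcess R h t| * δ)) ∂μ ≤
      16 * δ * (h ^ (1 - p) / (p - 1) + K * R ^ (1 - p)) := by
  have hR0 := hh.trans_le hR
  have hm := measurable_clipExcess R h
  have i1 : Integrable (fun t ↦ δ * |clipExcess R h t|) μ :=
    (Integrable.of_bound hm.abs.aestronglyMeasurable R (ae_of_all _ fun t ↦ by
      rw [Real.norm_of_nonneg (abs_nonneg _)]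
      exact abs_clipExcess_le' hh.le hR t)).const_mul _
  have i2 : Integrable (fun t ↦ δ * K / R * clipExcess R h t ^ 2) μ :=
    (Integrable.of_bound (hm.pow_const 2).aestronglyMeasurable (R ^ 2) (ae_of_all _ fun t ↦ by
      rw [Real.norm_of_nonneg (sq_nonneg _), ← sq_abs]
      have := abs_clipExcess_le' hh.le hR t
      gcongr)).const_mul _
  calc _ ≤ ∫ t, (δ * |clipExcess R h t| + δ * K / R * clipExcess R h t ^ 2) ∂μ := by
        refine integral_mono_of_nonneg (ae_of_all _ fun t ↦ by positivity) (i1.add i2)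
          (ae_of_all _ fun t ↦ ?_)
        have h1 := exp_mul_le_one_add (c := |clipExcess R h t| * δ) (by positivity) (by positivity)
          (mul_le_mul_of_nonneg_right (abs_clipExcess_le' hh.le hR t) hδ.le) hK
        calc |clipExcess R h t| * δ * Real.exp (lam * (|clipExcess R h t| * δ))
            ≤ |clipExcess R h t| * δ * (1 + K * (|clipExcess R h t| * δ / (R * δ))) := by gcongr
          _ = δ * |clipExcess R h t| + δ * K / R * clipExcess R h t ^ 2 := by
            rw [← sq_abs (clipExcess R h t)]
            field_simp
    _ = δ * ∫ t, |clipExcess R h t| ∂μ + δ * K / R * ∫ t, clipExcess R h t ^ 2 ∂μ := by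
        rw [integral_add i1 i2, integral_const_mul, integral_const_mul]
    _ ≤ δ * (16 * (h ^ (1 - p) / (p - 1))) + δ * K / R * (16 * R ^ (2 - p)) := by
        gcongr
        · exact hμ.integral_abs_clip_sub_clip_le hp hh hR
        · exact hμ.integral_sq_clipExcess_le (by linarith) hh hR
    _ = _ := by
        have : R ^ (2 - p) = R * R ^ (1 - p) := by
          rw [show 2 - p = 1 + (1 - p) by ring, Real.rpow_add hR0, Real.rpow_one]
        rw [this]
        field_simp

theorem integral_min_sq_abs_mul_exp_le (hμ : IsStableLaw p μ) (hp : 1 < p) (hh : 0 < h)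
    (hR : h ≤ R) {δ lam K : ℝ} (hδ : 0 < δ) (hK0 : 0 ≤ K)
    (hK : Real.exp (lam * (R * δ)) ≤ 1 + K) (y : ℝ) {w : ℝ → ℝ}
    (hwy : ∀ t, |w t| ≤ |clip R t| * |y|) :
    ∫ t, min (w t ^ 2) |w t| * Real.exp (lam * (|clipExcess R h t| * δ)) ∂μ ≤
      16 * (1 + 1 / (p - 1)) * |y| ^ p + 16 * K * R ^ (1 - p) * |y| := by
  have hR0 := hh.trans_le hR
  have i1 := hμ.integrable_min_sq_abs_mul hp y
  have i2 : Integrable (fun t ↦ K * |y| / R * clip R t ^ 2) μ :=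
    (Integrable.of_bound ((measurable_clip R).pow_const 2).aestronglyMeasurable (R ^ 2)
      (ae_of_all _ fun t ↦ by
        rw [Real.norm_of_nonneg (sq_nonneg _), ← sq_abs]
        have := abs_clip_le hR0.le t
        gcongr)).const_mul _
  calc _ ≤ ∫ t, (min ((t * y) ^ 2) |t * y| + K * |y| / R * clip R t ^ 2) ∂μ := by
        refine integral_mono_of_nonneg (ae_of_all _ fun t ↦ ?_) (i1.add i2)
          (ae_of_all _ fun t ↦ ?_)
        · exact mul_nonneg (le_min (sq_nonneg _) (abs_nonneg _)) (Real.exp_pos _).le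
        have h1 := exp_mul_le_one_add (c := |clipExcess R h t| * δ) (by positivity) (by positivity)
          (mul_le_mul_of_nonneg_right (abs_clipExcess_le' hh.le hR t) hδ.le) hK
        have h2 : min (w t ^ 2) |w t| ≤ min ((t * y) ^ 2) |t * y| := by
          refine min_sq_abs_le ((hwy t).trans ?_)
          rw [abs_mul, abs_clip hR0.le]
          exact mul_le_mul_of_nonneg_right (min_le_right _ _) (abs_nonneg _)
        have h3 : min (w t ^ 2) |w t| ≤ |clip R t| * |y| := (min_le_right _ _).trans (hwy t)
        have h4 : 0 ≤ min (w t ^ 2) |w t| := le_min (sq_nonneg _) (abs_nonneg _)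
        have h5 := abs_clipExcess_le hh.le hR t
        calc min (w t ^ 2) |w t| * Real.exp (lam * (|clipExcess R h t| * δ))
            ≤ min (w t ^ 2) |w t| * (1 + K * (|clipExcess R h t| * δ / (R * δ))) := by gcongr
          _ = min (w t ^ 2) |w t| + min (w t ^ 2) |w t| * (K * (|clipExcess R h t| / R)) := by
            field_simp
          _ ≤ min ((t * y) ^ 2) |t * y| + (|clip R t| * |y|) * (K * (|clip R t| / R)) := by
            gcongr
          _ = min ((t * y) ^ 2) |t * y| + K * |y| / R * clip R t ^ 2 := by
            rw [← sq_abs (clip R t)]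
            field_simp
    _ = ∫ t, min ((t * y) ^ 2) |t * y| ∂μ + K * |y| / R * ∫ t, clip R t ^ 2 ∂μ := by
        rw [integral_add i1 i2, integral_const_mul]
    _ ≤ 16 * (1 + 1 / (p - 1)) * |y| ^ p + K * |y| / R * (16 * R ^ (2 - p)) := by
        gcongr
        · exact hμ.integral_min_sq_abs_mul_le hp y
        · exact hμ.integral_sq_clip_le (by linarith) hR0
    _ = _ := by
        have : R ^ (2 - p) = R * R ^ (1 - p) := by
          rw [show 2 - p = 1 + (1 - p) by ring, Real.rpow_add hR0, Real.rpow_one]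
        rw [this]
        field_simp

theorem integral_sq_interactionSum_mul_prod_le (hμ : IsStableLaw p μ) (hp : 1 < p) (hh : 0 < h)
    (hR : h ≤ R) {d b : ℕ} {x x' : Fin d → ℝ} {S : Finset (Fin d)} (hS : IsDyadicStep p b x x' S)
    {lam K Q W : ℝ} (hlam : 0 ≤ lam) (hK0 : 0 ≤ K)
    (hK : Real.exp (lam * (R * ((2 : ℝ) ^ b)⁻¹)) ≤ 1 + K)
    (hQ : 16 * S.card * ((2 : ℝ) ^ b)⁻¹ * (h ^ (1 - p) / (p - 1) + K * R ^ (1 - p)) ≤ Q)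
    (hQ1 : lam * Q ≤ 1)
    (hW : 1 + 16 * (1 + 1 / (p - 1)) + 16 * K * (R * ((2 : ℝ) ^ b)⁻¹) ^ (1 - p) ≤ W) :
    ∫ a, interactionSum R h x x' a ^ 2 *
      ∏ l, Real.exp (lam * (|clipExcess R h (a l)| * |x' l - x l|)) ∂(Measure.pi fun _ ↦ μ) ≤
      3 * (Q * (W + Q)) := by
  have hR0 := hh.trans_le hR
  set δ : ℝ := ((2 : ℝ) ^ b)⁻¹ with hδ
  have hδ0 : 0 < δ := by positivity
  have hp1 : 0 < p - 1 := by linarith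
  have hsym := hμ.isSymmetricLaw
  have hzm := measurable_clipExcess R h
  set c : Fin d → ℝ → ℝ := fun i t ↦ |clipExcess R h t| * |x' i - x i| with hc
  set e : Fin d → ℝ → ℝ := fun i t ↦ Real.exp (lam * c i t) with he
  have hcm : ∀ i, Measurable (c i) := fun i ↦ hzm.abs.mul_const _
  have hem : ∀ i, Measurable (e i) := fun i ↦ Real.measurable_exp.comp ((hcm i).const_mul _)
  have hc0 : ∀ i t, 0 ≤ c i t := fun i t ↦ by positivity
  have hcR : ∀ i t, c i t ≤ R * δ := fun i t ↦
    mul_le_mul (abs_clipExcess_le' hh.le hR t) (hS.abs_sub_le i) (abs_nonneg _) hR0.le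
  have he1 : ∀ i t, 1 ≤ e i t := fun i t ↦ Real.one_le_exp (mul_nonneg hlam (hc0 i t))
  set w : Fin d → Fin d → ℝ → ℝ := fun i l t ↦ if l < i then
      clip R t * x l + clipExcess R h t * (x' l - x l) else clip R t * x l with hw
  have hwy : ∀ i l t, |w i l t| ≤ |clip R t| * |x' l| := by
    intro i l t
    simp only [hw]
    split_ifs
    · exact abs_clip_mul_add_le hh.le hR (hS.mul_sub_nonneg l) t
    · rw [abs_mul]
      have := abs_eq_add_abs_sub (hS.mul_sub_nonneg l)
      exact mul_le_mul_of_nonneg_left (by linarith [abs_nonneg (x' l - x l)]) (abs_nonneg _)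
  set B : ℝ := Real.exp (lam * (R * δ)) + R * ∑ l, |x' l| + R * δ with hB
  have hX0 : 0 ≤ R * ∑ l, |x' l| := mul_nonneg hR0.le (Finset.sum_nonneg fun _ _ ↦ abs_nonneg _)
  have hRδ : 0 < R * δ := by positivity
  have hq : ∀ i, ∫ t, c i t * e i t ∂μ ≤ if i ∈ S then
      16 * δ * (h ^ (1 - p) / (p - 1) + K * R ^ (1 - p)) else 0 := by
    intro i
    simp only [he, hc, hS.abs_sub_eq_ite]
    split_ifs with hi
    · exact hμ.integral_abs_clipExcess_mul_exp_le hp hh hR hδ0 hK0 hK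
    · simp
  have hqQ : ∑ i, ∫ t, c i t * e i t ∂μ ≤ Q := by
    refine (Finset.sum_le_sum fun i _ ↦ hq i).trans (le_trans (le_of_eq ?_) hQ)
    rw [Finset.sum_ite_mem, Finset.univ_inter, Finset.sum_const, nsmul_eq_mul]
    ring
  have hprod : ∏ l, ∫ t, e l t ∂μ ≤ 3 := by
    have hce : ∀ l, Integrable (fun t ↦ c l t * e l t) μ := fun l ↦
      Integrable.of_bound ((hcm l).mul (hem l)).aestronglyMeasurable
        (R * δ * Real.exp (lam * (R * δ))) (ae_of_all _ fun t ↦ by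
          rw [Real.norm_of_nonneg (mul_nonneg (hc0 l t) (Real.exp_pos _).le)]
          have := hcR l t
          have := hc0 l t
          change c l t * Real.exp (lam * c l t) ≤ _
          gcongr)
    calc ∏ l, ∫ t, e l t ∂μ ≤ ∏ l, Real.exp (lam * ∫ t, c l t * e l t ∂μ) := by
          refine Finset.prod_le_prod (fun l _ ↦ integral_nonneg fun t ↦ (Real.exp_pos _).le)
            fun l _ ↦ ?_
          have i1 : Integrable (fun t ↦ 1 + lam * (c l t * e l t)) μ :=
            (integrable_const _).add ((hce l).const_mul _)
          calc ∫ t, e l t ∂μ ≤ ∫ t, (1 + lam * (c l t * e l t)) ∂μ := by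
                refine integral_mono_of_nonneg (ae_of_all _ fun t ↦ (Real.exp_pos _).le) i1
                  (ae_of_all _ fun t ↦ ?_)
                have := exp_le_one_add_mul_exp (lam * c l t)
                change Real.exp (lam * c l t) ≤ 1 + lam * (c l t * Real.exp (lam * c l t))
                linarith
            _ = 1 + lam * ∫ t, c l t * e l t ∂μ := by
                rw [integral_add (integrable_const _) ((hce l).const_mul _), integral_const_mul]
                simp
            _ ≤ _ := by
                rw [add_comm]
                exact Real.add_one_le_exp _
      _ = Real.exp (lam * ∑ l, ∫ t, c l t * e l t ∂μ) := by
          rw [Finset.mul_sum, Real.exp_sum]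
      _ ≤ Real.exp 1 := Real.exp_le_exp.2 ((mul_le_mul_of_nonneg_left hqQ hlam).trans hQ1)
      _ ≤ 3 := Real.exp_one_lt_three.le
  have hQ0 : 0 ≤ Q := le_trans (Finset.sum_nonneg fun i _ ↦ integral_nonneg fun t ↦
    mul_nonneg (hc0 i t) (Real.exp_pos _).le) hqQ
  have hW0 : 0 ≤ W := le_trans (by positivity) hW
  have key := integral_sq_sum_min_mul_prod_le hsym (B := B) hem he1
    (fun l t ↦ by
      have := Real.exp_le_exp.2 (mul_le_mul_of_nonneg_left (hcR l t) hlam)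
      simp only [he]
      linarith)
    (fun l t ↦ by simp only [he, hc, clipExcess_neg hh.le hR, abs_neg])
    (w := w) (fun i l ↦ by
      simp only [hw]
      split_ifs
      · exact ((measurable_clip R).mul_const _).add (hzm.mul_const _)
      · exact (measurable_clip R).mul_const _)
    (fun i l t ↦ by
      simp only [hw, clipExcess_neg hh.le hR, clip_neg hR0.le]
      split_ifs <;> ring)
    (fun i l t ↦ by
      have h1 : |x' l| ≤ ∑ l, |x' l| :=
        Finset.single_le_sum (f := fun l ↦ |x' l|) (fun _ _ ↦ abs_nonneg _) (Finset.mem_univ l)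
      have h2 := (hwy i l t).trans
        (mul_le_mul (abs_clip_le hR0.le t) h1 (abs_nonneg _) hR0.le)
      have := Real.exp_pos (lam * (R * δ))
      linarith)
    (c := c) hcm hc0
    (fun i t ↦ by
      have := hcR i t
      have := Real.exp_pos (lam * (R * δ))
      linarith) hW0 Finset.univ hqQ
    (fun i ↦ by
      refine le_trans ?_ hW
      have h1 : ∀ l, ∫ t, min (w i l t ^ 2) |w i l t| * e l t ∂μ ≤
          16 * (1 + 1 / (p - 1)) * |x' l| ^ p + 16 * K * (R * δ) ^ (1 - p) * |x' l| ^ p := by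
        intro l
        by_cases hl : l ∈ S
        · simp only [he, hc, hS.abs_sub_eq_ite, if_pos hl]
          refine (hμ.integral_min_sq_abs_mul_exp_le hp hh hR hδ0 hK0 hK (x' l) (hwy i l)).trans ?_
          have h2 := hS.abs_le_of_mem hp.le hl
          rw [Real.mul_rpow hR0.le hδ0.le]
          have h3 : 0 ≤ 16 * K * R ^ (1 - p) := by positivity
          have h4 := mul_le_mul_of_nonneg_left h2 h3
          refine add_le_add le_rfl (h4.trans (le_of_eq ?_))
          ring
        · have h2 := hμ.integral_min_sq_abs_mul_exp_le hp hh hR (δ := 1) (lam := 0) one_pos le_rfl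
            (by simp) (x' l) (hwy i l)
          simp only [he, hc, hS.abs_sub_eq_ite, if_neg hl, mul_zero, Real.exp_zero]
          simp only [zero_mul, Real.exp_zero, mul_zero, add_zero] at h2
          have : 0 ≤ 16 * K * (R * δ) ^ (1 - p) * |x' l| ^ p := by positivity
          linarith
      have h5 := Finset.sum_le_sum fun l (_ : l ∈ Finset.univ) ↦ h1 l
      rw [Finset.sum_add_distrib, ← Finset.mul_sum, ← Finset.mul_sum] at h5
      have h6 := hS.sum_le
      have h7 : 0 ≤ 16 * (1 + 1 / (p - 1)) := by positivity
      have h8 : 0 ≤ 16 * K * (R * δ) ^ (1 - p) := by positivity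
      nlinarith)
  have hG : ∀ a, interactionSum R h x x' a =
      ∑ i, min |∑ l ∈ Finset.univ.erase i, w i l (a l)| (c i (a i)) := by
    intro a
    simp only [interactionSum, hw, hc, abs_mul]
  simp only [hG]
  refine key.trans (mul_le_mul_of_nonneg_right hprod (by positivity))

theorem integral_truncatedForm_step_le (hμ : IsStableLaw p μ) (hp : 1 < p) (hh : 0 < h)
    (hR : h ≤ R) {d b : ℕ} {x x' : Fin d → ℝ} {S : Finset (Fin d)} (hS : IsDyadicStep p b x x' S)
    {lam K v Q W : ℝ} (hlam : 0 < lam) (hK0 : 0 ≤ K)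
    (hK : Real.exp (4 * lam * (R * ((2 : ℝ) ^ b)⁻¹)) ≤ 1 + K)
    (hh1 : 4 * lam * ((2 : ℝ) ^ b)⁻¹ * h ≤ 1)
    (hv : 256 * ((2 : ℝ) ^ b)⁻¹ ^ 2 * S.card * h ^ (2 - p) ≤ v) (hv1 : lam ^ 2 * v ≤ 1)
    (hQ : 16 * S.card * ((2 : ℝ) ^ b)⁻¹ * (h ^ (1 - p) / (p - 1) + K * R ^ (1 - p)) ≤ Q)
    (hQ1 : 4 * lam * Q ≤ 1)
    (hW : 1 + 16 * (1 + 1 / (p - 1)) + 16 * K * (R * ((2 : ℝ) ^ b)⁻¹) ^ (1 - p) ≤ W) :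
    ∫ a, (truncatedForm R h a x' - truncatedForm R h a x) ^ 2 *
      Real.exp (lam * |truncatedForm R h a x' - truncatedForm R h a x|)
      ∂(Measure.pi fun _ ↦ μ) ≤ 4 * v + 48 * (Q * (W + Q)) := by
  have hR0 := hh.trans_le hR
  set δ : ℝ := ((2 : ℝ) ^ b)⁻¹ with hδ
  have hδ0 : 0 < δ := by positivity
  set P := Measure.pi fun _ : Fin d ↦ μ with hP
  set Y : (Fin d → ℝ) → ℝ := fun a ↦ ∑ i, clip h (a i) * (x' i - x i) with hY
  set G := interactionSum R h x x' with hG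
  set E : (Fin d → ℝ) → ℝ :=
    fun a ↦ ∏ l, Real.exp (4 * lam * (|clipExcess R h (a l)| * |x' l - x l|)) with hE
  have hYb : ∀ a, |Y a| ≤ ∑ i, h * |x' i - x i| := fun a ↦
    (Finset.abs_sum_le_sum_abs _ _).trans (Finset.sum_le_sum fun i _ ↦ by
      rw [abs_mul]
      exact mul_le_mul_of_nonneg_right (abs_clip_le hh.le _) (abs_nonneg _))
  have hYm : Measurable Y := Finset.measurable_fun_sum _ fun i _ ↦
    ((measurable_clip h).comp (measurable_pi_apply i)).mul_const _
  have hsum : ∀ a : Fin d → ℝ, ∑ i, |clipExcess R h (a i) * (x' i - x i)| ≤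
      ∑ i, R * |x' i - x i| := fun a ↦ Finset.sum_le_sum fun i _ ↦ by
    rw [abs_mul]
    exact mul_le_mul_of_nonneg_right (abs_clipExcess_le' hh.le hR _) (abs_nonneg _)
  have hEexp : ∀ a, E a =
      Real.exp (4 * lam * ∑ i, |clipExcess R h (a i) * (x' i - x i)|) := by
    intro a
    simp only [hE, abs_mul]
    rw [Finset.mul_sum, Real.exp_sum]
  have hEm : Measurable E := Finset.measurable_fun_prod _ fun l _ ↦ Real.measurable_exp.comp
    ((((measurable_clipExcess R h).comp (measurable_pi_apply l)).abs.mul_const _).const_mul _)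
  have hGm : Measurable G := measurable_interactionSum R h x x'
  have i1 : Integrable (fun a ↦ 4 * (Y a ^ 2 * Real.exp (2 * lam * |Y a|))) P := by
    refine (Integrable.of_bound (Measurable.aestronglyMeasurable (by fun_prop))
      ((∑ i, h * |x' i - x i|) ^ 2 * Real.exp (2 * lam * ∑ i, h * |x' i - x i|))
      (ae_of_all _ fun a ↦ ?_)).const_mul _
    rw [Real.norm_of_nonneg (by positivity), ← sq_abs (Y a)]
    have := hYb a
    gcongr
  have i2 : Integrable (fun a ↦ 16 * (G a ^ 2 * E a)) P := by
    refine (Integrable.of_bound (Measurable.aestronglyMeasurable (by fun_prop))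
      ((∑ i, R * |x' i - x i|) ^ 2 * Real.exp (4 * lam * ∑ i, R * |x' i - x i|))
      (ae_of_all _ fun a ↦ ?_)).const_mul _
    rw [hEexp, Real.norm_of_nonneg (by positivity)]
    have h1 := hsum a
    have h2 := (interactionSum_le R h x x' a).trans h1
    have h3 := interactionSum_nonneg R h x x' a
    gcongr
  calc _ ≤ ∫ a, (4 * (Y a ^ 2 * Real.exp (2 * lam * |Y a|)) + 16 * (G a ^ 2 * E a)) ∂P := by
        refine integral_mono_of_nonneg (ae_of_all _ fun a ↦ by positivity) (i1.add i2)
          (ae_of_all _ fun a ↦ ?_)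
        obtain ⟨u₁, u₂, hu, hu1, hu2⟩ :=
          abs_truncatedForm_sub_sub_le hh.le hR hS.mul_sub_nonneg a
        simp only [hu]
        refine (sq_mul_exp_add_le hlam.le).trans (add_le_add ?_ ?_)
        · rw [← sq_abs u₁, ← sq_abs (Y a)]
          gcongr
        · rw [← sq_abs u₂, hEexp]
          have h3 : 2 * lam * |u₂| ≤ 4 * lam * ∑ i, |clipExcess R h (a i) * (x' i - x i)| := by
            have := mul_le_mul_of_nonneg_left
              (hu2.trans (mul_le_mul_of_nonneg_left (interactionSum_le R h x x' a) zero_le_two))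
              (show 0 ≤ 2 * lam by positivity)
            linarith
          calc 4 * (|u₂| ^ 2 * Real.exp (2 * lam * |u₂|)) ≤ 4 * ((2 * G a) ^ 2 *
              Real.exp (4 * lam * ∑ i, |clipExcess R h (a i) * (x' i - x i)|)) := by gcongr
            _ = _ := by ring
    _ = 4 * ∫ a, Y a ^ 2 * Real.exp (2 * lam * |Y a|) ∂P + 16 * ∫ a, G a ^ 2 * E a ∂P := by
        rw [integral_add i1 i2, integral_const_mul, integral_const_mul]
    _ ≤ 4 * (4 * (v / 4)) + 16 * (3 * (Q * (W + Q))) := by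
        refine add_le_add (mul_le_mul_of_nonneg_left ?_ (by norm_num))
          (mul_le_mul_of_nonneg_left ?_ (by norm_num))
        · refine integral_sq_mul_exp_le_of_odd hμ.isSymmetricLaw (measurable_clip h)
            (clip_neg hh.le) (abs_clip_le hh.le) (by positivity) (fun i ↦ ?_) ?_ ?_
          · refine le_trans ?_ hh1
            have := hS.abs_sub_le i
            rw [show 2 * (2 * lam) = 4 * lam by ring]
            gcongr
          · have h1 : ∑ i, (x' i - x i) ^ 2 = S.card * δ ^ 2 := by
              have : ∀ i, (x' i - x i) ^ 2 = if i ∈ S then δ ^ 2 else 0 := by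
                intro i
                rw [← sq_abs, hS.abs_sub_eq_ite]
                split_ifs <;> simp [hδ]
              simp only [this]
              rw [Finset.sum_ite_mem, Finset.univ_inter, Finset.sum_const, nsmul_eq_mul]
            rw [h1]
            have h2 := hμ.integral_sq_clip_le (by linarith) hh
            have h3 : 4 * (S.card * δ ^ 2) * ∫ t, clip h t ^ 2 ∂μ ≤
                4 * (S.card * δ ^ 2) * (16 * h ^ (2 - p)) := by gcongr
            linarith
          · linarith
        · exact hμ.integral_sq_interactionSum_mul_prod_le hp hh hR hS (by positivity) hK0 hK hQ hQ1
            hW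
    _ = _ := by ring

end IsStableLaw

/-- The Gaussian part of the variance of a chain link at relative scale `β`. -/
noncomputable def linkVariance (p β : ℝ) : ℝ :=
  700 * Real.exp (-(1 / (p - 1))) * min 1 (β ^ p) / β ^ 2

/-- The tail mass of the coordinates moved by a chain link at relative scale `β`. -/
noncomputable def linkTail (p β : ℝ) : ℝ :=
  16 * (min 1 (β ^ p) / β) * (3 * (1 / (p - 1)) + (min β β⁻¹) ^ (-(1 / 4) : ℝ))

/-- The size of the linear form met by the coordinates moved by a chain link. -/
noncomputable def linkMass (p β : ℝ) : ℝ :=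
  25 * (1 / (p - 1)) * (min β β⁻¹) ^ (-(1 / 2) : ℝ)

/-- The scale below which the increment of a chain link is subgaussian. -/
noncomputable def linkScale (p ε β : ℝ) : ℝ :=
  4 * (Real.exp (-(1 / (p - 1))) / β) + √(linkVariance p β) + 4 * linkTail p β +
    4 * (ε⁻¹ / β / Real.log (1 + (min β β⁻¹) ^ (-(1 / 4) : ℝ)))

section Scalar

variable {p β : ℝ}

theorem min_self_inv_pos (hβ : 0 < β) : 0 < min β β⁻¹ := lt_min hβ (by positivity)

theorem min_self_inv_le_one (β : ℝ) : min β β⁻¹ ≤ 1 := by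
  rcases le_total β 1 with h | h
  · exact (min_le_left _ _).trans h
  · exact (min_le_right _ _).trans (inv_le_one_of_one_le₀ h)

theorem log_min_self_inv (hβ : 0 < β) : Real.log (min β β⁻¹) = -|Real.log β| := by
  rcases le_total β 1 with h | h
  · rw [min_eq_left (h.trans ((one_le_inv₀ hβ).2 h)), abs_of_nonpos (Real.log_nonpos hβ.le h),
      neg_neg]
  · rw [min_eq_right ((inv_le_one_of_one_le₀ h).trans h), Real.log_inv,
      abs_of_nonneg (Real.log_nonneg h)]

theorem min_one_rpow_pos (hβ : 0 < β) : 0 < min 1 (β ^ p) := lt_min one_pos (by positivity)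

theorem min_one_rpow_div_le (hp2 : p ≤ 2) (hβ : 0 < β) :
    min 1 (β ^ p) / β ≤ (min β β⁻¹) ^ (p - 1) := by
  rcases le_total β 1 with h | h
  · rw [min_eq_left (h.trans ((one_le_inv₀ hβ).2 h)), Real.rpow_sub_one hβ.ne']
    gcongr
    exact min_le_right _ _
  · have h1 : β⁻¹ ≤ 1 := inv_le_one_of_one_le₀ h
    rw [min_eq_right (h1.trans h)]
    have h2 : β⁻¹ ^ (1 : ℝ) ≤ β⁻¹ ^ (p - 1) :=
      Real.rpow_le_rpow_of_exponent_ge (by positivity) h1 (by linarith)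
    rw [Real.rpow_one] at h2
    refine le_trans ?_ h2
    rw [inv_eq_one_div]
    gcongr
    exact min_le_left _ _

theorem min_one_rpow_div_le_one (hp : 1 < p) (hp2 : p ≤ 2) (hβ : 0 < β) :
    min 1 (β ^ p) / β ≤ 1 :=
  (min_one_rpow_div_le hp2 hβ).trans
    (Real.rpow_le_one (min_self_inv_pos hβ).le (min_self_inv_le_one β) (by linarith))

theorem min_one_rpow_mul_div_le (hp : 1 < p) (hp2 : p ≤ 2) (hβ : 0 < β) :
    min 1 (β ^ p) * (min 1 (β ^ p) / β) ≤ min β β⁻¹ := by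
  have hw := min_one_rpow_pos (p := p) hβ
  rcases le_total β 1 with h | h
  · rw [min_eq_left (h.trans ((one_le_inv₀ hβ).2 h))]
    have h1 : β ^ p ≤ β ^ (1 : ℝ) := Real.rpow_le_rpow_of_exponent_ge hβ h hp.le
    rw [Real.rpow_one] at h1
    calc _ ≤ β * 1 := mul_le_mul ((min_le_right _ _).trans h1)
          (min_one_rpow_div_le_one hp hp2 hβ) (by positivity) hβ.le
      _ = β := mul_one β
  · have h1 : β⁻¹ ≤ 1 := inv_le_one_of_one_le₀ h
    rw [min_eq_right (h1.trans h)]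
    calc _ ≤ 1 * (1 / β) := by gcongr <;> exact min_le_left _ _
      _ = β⁻¹ := by ring

theorem rpow_le_min_self_inv_rpow (hp : 1 < p) (hp' : p ≤ 5 / 4) (hβ : 0 < β) :
    β ^ (p - 1) ≤ (min β β⁻¹) ^ (-(1 / 4) : ℝ) := by
  rcases le_total β 1 with h | h
  · exact (Real.rpow_le_one hβ.le h (by linarith)).trans
      (Real.one_le_rpow_of_pos_of_le_one_of_nonpos (min_self_inv_pos hβ) (min_self_inv_le_one β)
        (by norm_num))
  · rw [min_eq_right ((inv_le_one_of_one_le₀ h).trans h), Real.inv_rpow hβ.le,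
      ← Real.rpow_neg hβ.le, neg_neg]
    exact Real.rpow_le_rpow_of_exponent_le h (by linarith)

theorem mul_exp_neg_le_one (r : ℝ) : r * Real.exp (-r) ≤ 1 := by
  have h := Real.add_one_le_exp r
  have h1 : Real.exp r * Real.exp (-r) = 1 := by rw [← Real.exp_add]; simp
  nlinarith [Real.exp_pos (-r)]

theorem four_add_two_mul_abs_log_le (hp : 1 < p) (hp' : p ≤ 5 / 4) (hβ : 0 < β) :
    4 + 2 * |Real.log β| ≤ 5 * (1 / (p - 1)) * (min β β⁻¹) ^ (-((p - 1) / 2)) := by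
  set m := min β β⁻¹ with hm
  have hm0 : 0 < m := min_self_inv_pos hβ
  have hm1 : m ≤ 1 := min_self_inv_le_one β
  have hs : 0 < p - 1 := by linarith
  have hr : 4 ≤ 1 / (p - 1) := by
    rw [le_div_iff₀ hs]
    linarith
  have h1 : |Real.log β| = Real.log m⁻¹ := by
    rw [Real.log_inv, log_min_self_inv hβ, neg_neg]
  have h2 := Real.log_le_rpow_div (x := m⁻¹) (by positivity) (half_pos hs)
  have h3 : m⁻¹ ^ ((p - 1) / 2) = m ^ (-((p - 1) / 2)) := by
    rw [Real.inv_rpow hm0.le, ← Real.rpow_neg hm0.le]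
  rw [h3] at h2
  have h4 : 1 ≤ m ^ (-((p - 1) / 2)) :=
    Real.one_le_rpow_of_pos_of_le_one_of_nonpos hm0 hm1 (by linarith)
  rw [h1]
  have h5 : m ^ (-((p - 1) / 2)) / ((p - 1) / 2) = 2 * (1 / (p - 1)) * m ^ (-((p - 1) / 2)) := by
    field_simp
  rw [h5] at h2
  have h6 : 4 ≤ 1 / (p - 1) * m ^ (-((p - 1) / 2)) := by nlinarith
  linarith

theorem four_add_two_mul_abs_log_le_log (hβ : 0 < β) :
    4 + 2 * |Real.log β| ≤ 14 * Real.log (1 + (min β β⁻¹) ^ (-(1 / 4) : ℝ)) := by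
  set m := min β β⁻¹ with hm
  have hm0 : 0 < m := min_self_inv_pos hβ
  have hm1 : m ≤ 1 := min_self_inv_le_one β
  have h4 : 1 ≤ m ^ (-(1 / 4) : ℝ) :=
    Real.one_le_rpow_of_pos_of_le_one_of_nonpos hm0 hm1 (by norm_num)
  have h1 : Real.log 2 ≤ Real.log (1 + m ^ (-(1 / 4) : ℝ)) :=
    Real.log_le_log (by norm_num) (by linarith)
  have h2 : Real.log (m ^ (-(1 / 4) : ℝ)) ≤ Real.log (1 + m ^ (-(1 / 4) : ℝ)) :=
    Real.log_le_log (by linarith) (by linarith)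
  rw [Real.log_rpow hm0, log_min_self_inv hβ] at h2
  linarith [Real.log_two_gt_d9]

theorem linkVariance_pos (hβ : 0 < β) : 0 < linkVariance p β := by
  have := min_one_rpow_pos (p := p) hβ
  unfold linkVariance
  positivity

theorem linkTail_pos (hp : 1 < p) (hβ : 0 < β) : 0 < linkTail p β := by
  have := min_one_rpow_pos (p := p) hβ
  have := min_self_inv_pos hβ
  have : 0 < p - 1 := by linarith
  unfold linkTail
  positivity

theorem linkMass_pos (hp : 1 < p) (hβ : 0 < β) : 0 < linkMass p β := by
  have := min_self_inv_pos hβ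
  have : 0 < p - 1 := by linarith
  unfold linkMass
  positivity

theorem log_one_add_rpow_pos (hβ : 0 < β) :
    0 < Real.log (1 + (min β β⁻¹) ^ (-(1 / 4) : ℝ)) := by
  have := min_self_inv_pos hβ
  exact Real.log_pos (by
    have : 0 < (min β β⁻¹) ^ (-(1 / 4) : ℝ) := by positivity
    linarith)

theorem linkScale_pos (hp : 1 < p) {ε : ℝ} (hε : 0 < ε) (hβ : 0 < β) : 0 < linkScale p ε β := by
  have := linkTail_pos hp hβ
  have := linkVariance_pos (p := p) hβ
  have := log_one_add_rpow_pos hβ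
  unfold linkScale
  positivity

theorem linkTail_le (hp : 1 < p) (hp' : p ≤ 5 / 4) (hβ : 0 < β) :
    linkTail p β ≤
      64 * (1 / (p - 1)) * (min 1 (β ^ p) / β) * (min β β⁻¹) ^ (-(1 / 4) : ℝ) := by
  have hw := min_one_rpow_pos (p := p) hβ
  have hs : 0 < p - 1 := by linarith
  have hr : 4 ≤ 1 / (p - 1) := by
    rw [le_div_iff₀ hs]
    linarith
  have h4 : 1 ≤ (min β β⁻¹) ^ (-(1 / 4) : ℝ) :=
    Real.one_le_rpow_of_pos_of_le_one_of_nonpos (min_self_inv_pos hβ) (min_self_inv_le_one β)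
      (by norm_num)
  have h5 : 3 * (1 / (p - 1)) + (min β β⁻¹) ^ (-(1 / 4) : ℝ) ≤
      4 * (1 / (p - 1)) * (min β β⁻¹) ^ (-(1 / 4) : ℝ) := by nlinarith
  have h6 := mul_le_mul_of_nonneg_left h5 (show 0 ≤ 16 * (min 1 (β ^ p) / β) by positivity)
  unfold linkTail
  linarith

/-- The entropy of a chain link per coordinate. -/
noncomputable def linkEntropy (p β : ℝ) : ℝ := min 1 (β ^ p) * (4 + 2 * |Real.log β|)

theorem linkEntropy_pos (hβ : 0 < β) : 0 < linkEntropy p β := by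
  have := min_one_rpow_pos (p := p) hβ
  unfold linkEntropy
  positivity

theorem linkEntropy_le (hβ : 0 < β) :
    linkEntropy p β ≤ 16 * min 1 (β ^ p) * (min β β⁻¹) ^ (-(1 / 8) : ℝ) := by
  have h := entropyBound_le (p := p) (d := 1) hβ
  simpa [entropyBound, linkEntropy] using h

theorem one_le_rpow_min_self_inv (hβ : 0 < β) {c : ℝ} (hc : c ≤ 0) : 1 ≤ (min β β⁻¹) ^ c :=
  Real.one_le_rpow_of_pos_of_le_one_of_nonpos (min_self_inv_pos hβ) (min_self_inv_le_one β) hc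

theorem rpow_min_self_inv_le (hβ : 0 < β) {c c' : ℝ} (hc : c' ≤ c) :
    (min β β⁻¹) ^ c ≤ (min β β⁻¹) ^ c' :=
  Real.rpow_le_rpow_of_exponent_ge (min_self_inv_pos hβ) (min_self_inv_le_one β) hc

theorem linkEntropy_mul_exp_div_le (hp : 1 < p) (hp' : p ≤ 5 / 4) (hβ : 0 < β) :
    linkEntropy p β * (Real.exp (-(1 / (p - 1))) / β) ≤ 5 * (min β β⁻¹) ^ ((p - 1) / 2) := by
  have hw := min_one_rpow_pos (p := p) hβ
  have hm0 := min_self_inv_pos hβ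
  have hs : 0 < p - 1 := by linarith
  set m := min β β⁻¹ with hm
  calc linkEntropy p β * (Real.exp (-(1 / (p - 1))) / β)
      = (min 1 (β ^ p) / β) * (4 + 2 * |Real.log β|) * Real.exp (-(1 / (p - 1))) := by
        unfold linkEntropy
        ring
    _ ≤ m ^ (p - 1) * (5 * (1 / (p - 1)) * m ^ (-((p - 1) / 2))) * Real.exp (-(1 / (p - 1))) := by
        gcongr
        · exact min_one_rpow_div_le (by linarith) hβ
        · exact four_add_two_mul_abs_log_le hp hp' hβ
    _ = 5 * (m ^ (p - 1) * m ^ (-((p - 1) / 2))) *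
          (1 / (p - 1) * Real.exp (-(1 / (p - 1)))) := by ring
    _ ≤ 5 * (m ^ (p - 1) * m ^ (-((p - 1) / 2))) * 1 := by
        gcongr
        exact mul_exp_neg_le_one _
    _ = _ := by
        rw [← Real.rpow_add hm0, mul_one]
        ring_nf

theorem linkVariance_mul_linkEntropy_le (hp : 1 < p) (hp' : p ≤ 5 / 4) (hβ : 0 < β) :
    linkVariance p β * linkEntropy p β ≤ 3500 * ((min β β⁻¹) ^ ((p - 1) / 2)) ^ 2 := by
  have hw := min_one_rpow_pos (p := p) hβ
  have hm0 := min_self_inv_pos hβ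
  have hl := linkEntropy_pos (p := p) hβ
  have h1 := linkEntropy_mul_exp_div_le hp hp' hβ
  have h2 := min_one_rpow_div_le (p := p) (by linarith) hβ
  set m := min β β⁻¹ with hm
  calc linkVariance p β * linkEntropy p β
      = 700 * (min 1 (β ^ p) / β) * (linkEntropy p β * (Real.exp (-(1 / (p - 1))) / β)) := by
        unfold linkVariance
        field_simp
    _ ≤ 700 * m ^ (p - 1) * (5 * m ^ ((p - 1) / 2)) := by gcongr
    _ ≤ 700 * m ^ ((p - 1) / 2) * (5 * m ^ ((p - 1) / 2)) := by
        gcongr ?_ * ?_ * ?_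
        exact rpow_min_self_inv_le hβ (by linarith)
    _ = _ := by ring

theorem linkEntropy_mul_sqrt_linkVariance_le (hp : 1 < p) (hp' : p ≤ 5 / 4) (hβ : 0 < β) :
    linkEntropy p β * √(linkVariance p β) ≤ 424 * (min β β⁻¹) ^ (1 / 16 : ℝ) := by
  have hw := min_one_rpow_pos (p := p) hβ
  have hm0 := min_self_inv_pos hβ
  have hl := linkEntropy_pos (p := p) hβ
  have h1 := linkEntropy_le (p := p) hβ
  have h2 := min_one_rpow_mul_div_le hp (by linarith) hβ
  have h3 := min_one_rpow_div_le_one hp (by linarith) hβ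
  have hE : Real.exp (-(1 / (p - 1))) ≤ 1 := Real.exp_le_one_iff.2 (by
    have : 0 ≤ 1 / (p - 1) := one_div_nonneg.2 (by linarith)
    linarith)
  set m := min β β⁻¹ with hm
  have h4 : (m ^ (-(1 / 8) : ℝ)) ^ 2 * m ≤ (m ^ (1 / 16 : ℝ)) ^ 2 := by
    rw [← Real.rpow_natCast, ← Real.rpow_natCast, ← Real.rpow_mul hm0.le, ← Real.rpow_mul hm0.le]
    rw [← Real.rpow_add_one hm0.ne']
    exact rpow_min_self_inv_le hβ (by norm_num)
  have h5 : linkEntropy p β * √(linkVariance p β) = √(linkEntropy p β ^ 2 * linkVariance p β) := by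
    rw [Real.sqrt_mul (sq_nonneg _), Real.sqrt_sq hl.le]
  rw [h5]
  refine Real.sqrt_le_iff.2 ⟨by positivity, ?_⟩
  calc linkEntropy p β ^ 2 * linkVariance p β
      ≤ (16 * min 1 (β ^ p) * m ^ (-(1 / 8) : ℝ)) ^ 2 * (700 * 1 * min 1 (β ^ p) / β ^ 2) := by
        unfold linkVariance
        gcongr
    _ = 179200 * ((min 1 (β ^ p) * (min 1 (β ^ p) / β)) * (min 1 (β ^ p) / β)) *
          (m ^ (-(1 / 8) : ℝ)) ^ 2 := by
        field_simp
        norm_num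
    _ ≤ 179200 * (m * 1) * (m ^ (-(1 / 8) : ℝ)) ^ 2 := by gcongr
    _ = 179200 * ((m ^ (-(1 / 8) : ℝ)) ^ 2 * m) := by ring
    _ ≤ 179200 * (m ^ (1 / 16 : ℝ)) ^ 2 := by gcongr
    _ ≤ (424 * m ^ (1 / 16 : ℝ)) ^ 2 := by
        rw [mul_pow]
        gcongr
        norm_num

theorem linkEntropy_mul_linkTail_le (hp : 1 < p) (hp' : p ≤ 5 / 4) (hβ : 0 < β) :
    linkEntropy p β * linkTail p β ≤
      1024 * (1 / (p - 1)) * (min β β⁻¹) ^ (5 / 8 : ℝ) := by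
  have hw := min_one_rpow_pos (p := p) hβ
  have hm0 := min_self_inv_pos hβ
  have hs : 0 < p - 1 := by linarith
  have hl := linkEntropy_pos (p := p) hβ
  have h1 := linkEntropy_le (p := p) hβ
  have h2 := min_one_rpow_mul_div_le hp (by linarith) hβ
  have h3 := linkTail_le hp hp' hβ
  have h4 := linkTail_pos hp hβ
  set m := min β β⁻¹ with hm
  calc linkEntropy p β * linkTail p β ≤ (16 * min 1 (β ^ p) * m ^ (-(1 / 8) : ℝ)) *
        (64 * (1 / (p - 1)) * (min 1 (β ^ p) / β) * m ^ (-(1 / 4) : ℝ)) := by gcongr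
    _ = 1024 * (1 / (p - 1)) * ((min 1 (β ^ p) * (min 1 (β ^ p) / β)) *
        (m ^ (-(1 / 8) : ℝ) * m ^ (-(1 / 4) : ℝ))) := by ring
    _ ≤ 1024 * (1 / (p - 1)) * (m * (m ^ (-(1 / 8) : ℝ) * m ^ (-(1 / 4) : ℝ))) := by gcongr
    _ = _ := by
        nth_rw 1 [← Real.rpow_one m]
        rw [← Real.rpow_add hm0, ← Real.rpow_add hm0]
        norm_num

theorem linkMass_add_linkTail_le (hp : 1 < p) (hp' : p ≤ 5 / 4) (hβ : 0 < β) :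
    linkMass p β + linkTail p β ≤ 89 * (1 / (p - 1)) * (min β β⁻¹) ^ (-(1 / 2) : ℝ) := by
  have hs : 0 < p - 1 := by linarith
  have h1 := linkTail_le hp hp' hβ
  have h2 := min_one_rpow_div_le_one hp (by linarith) hβ
  have h3 : (min β β⁻¹) ^ (-(1 / 4) : ℝ) ≤ (min β β⁻¹) ^ (-(1 / 2) : ℝ) :=
    rpow_min_self_inv_le hβ (by norm_num)
  have hm0 := min_self_inv_pos hβ
  have h4 : 64 * (1 / (p - 1)) * (min 1 (β ^ p) / β) * (min β β⁻¹) ^ (-(1 / 4) : ℝ) ≤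
      64 * (1 / (p - 1)) * 1 * (min β β⁻¹) ^ (-(1 / 2) : ℝ) := by gcongr
  unfold linkMass
  linarith

theorem linkTail_mul_linkEntropy_le (hp : 1 < p) (hp' : p ≤ 5 / 4) (hβ : 0 < β) :
    linkTail p β * (linkMass p β + linkTail p β) * linkEntropy p β ≤
      91136 * (1 / (p - 1) * (min β β⁻¹) ^ (1 / 16 : ℝ)) ^ 2 := by
  have hm0 := min_self_inv_pos hβ
  have hs : 0 < p - 1 := by linarith
  have h1 := linkEntropy_mul_linkTail_le hp hp' hβ
  have h2 := linkMass_add_linkTail_le hp hp' hβ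
  have h3 := linkTail_pos hp hβ
  have h4 := linkMass_pos hp hβ
  set m := min β β⁻¹ with hm
  calc _ = (linkEntropy p β * linkTail p β) * (linkMass p β + linkTail p β) := by ring
    _ ≤ (1024 * (1 / (p - 1)) * m ^ (5 / 8 : ℝ)) *
        (89 * (1 / (p - 1)) * m ^ (-(1 / 2) : ℝ)) := by gcongr
    _ = 91136 * (1 / (p - 1)) ^ 2 * (m ^ (5 / 8 : ℝ) * m ^ (-(1 / 2) : ℝ)) := by ring
    _ = _ := by
        rw [mul_pow, ← Real.rpow_natCast (m ^ (1 / 16 : ℝ)), ← Real.rpow_mul hm0.le,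
          ← Real.rpow_add hm0]
        norm_num
        ring

theorem linkEntropy_div_log_le (hp : 1 < p) (hp' : p ≤ 5 / 4) (hβ : 0 < β) :
    linkEntropy p β / β / Real.log (1 + (min β β⁻¹) ^ (-(1 / 4) : ℝ)) ≤
      14 * (min β β⁻¹) ^ ((p - 1) / 2) := by
  have hw := min_one_rpow_pos (p := p) hβ
  have hm0 := min_self_inv_pos hβ
  have hlog := log_one_add_rpow_pos hβ
  have h1 := four_add_two_mul_abs_log_le_log hβ
  have h2 := min_one_rpow_div_le (p := p) (by linarith) hβ
  have h3 : (min β β⁻¹) ^ (p - 1) ≤ (min β β⁻¹) ^ ((p - 1) / 2) :=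
    rpow_min_self_inv_le hβ (by linarith)
  rw [div_le_iff₀ hlog]
  calc linkEntropy p β / β = (min 1 (β ^ p) / β) * (4 + 2 * |Real.log β|) := by
        unfold linkEntropy
        ring
    _ ≤ (min β β⁻¹) ^ ((p - 1) / 2) *
        (14 * Real.log (1 + (min β β⁻¹) ^ (-(1 / 4) : ℝ))) := by
        gcongr
        exact h2.trans h3
    _ = _ := by ring

/-- The contribution of one scale to the chaining bound. -/
theorem link_bound_le (hp : 1 < p) (hp' : p ≤ 5 / 4) (hβ : 0 < β) {ε N : ℝ} {d : ℕ} (hε : 0 < ε)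
    (hε1 : ε ≤ 1) (hN : 0 < N) (hdN : d ≤ ε ^ 2 * N) :
    √(8 * (4 * linkVariance p β + 48 * (linkTail p β * (linkMass p β + linkTail p β))) *
        entropyBound p d β / N) + 4 * entropyBound p d β / (N * (linkScale p ε β)⁻¹) ≤
      30000 * ε * (1 / (p - 1)) * (min β β⁻¹) ^ (1 / 16 : ℝ) +
        1000 * ε * (min β β⁻¹) ^ ((p - 1) / 2) := by
  have hm0 := min_self_inv_pos hβ
  have hs : 0 < p - 1 := by linarith
  have hr : 1 ≤ 1 / (p - 1) := by
    rw [le_div_iff₀ hs]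
    linarith
  have hl := linkEntropy_pos (p := p) hβ
  have hv := linkVariance_pos (p := p) hβ
  have hQ := linkTail_pos hp hβ
  have hW := linkMass_pos hp hβ
  have hΛ := linkScale_pos hp hε hβ
  have t1 := linkVariance_mul_linkEntropy_le hp hp' hβ
  have t2 := linkTail_mul_linkEntropy_le hp hp' hβ
  have t3 := linkEntropy_mul_exp_div_le hp hp' hβ
  have t4 := linkEntropy_mul_sqrt_linkVariance_le hp hp' hβ
  have t5 := linkEntropy_mul_linkTail_le hp hp' hβ
  have t6 := linkEntropy_div_log_le hp hp' hβ
  have hL : entropyBound p d β ≤ ε ^ 2 * N * linkEntropy p β := by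
    rw [entropyBound, ← linkEntropy]
    gcongr
  have t7 : (min β β⁻¹) ^ (5 / 8 : ℝ) ≤ (min β β⁻¹) ^ (1 / 16 : ℝ) :=
    rpow_min_self_inv_le hβ (by norm_num)
  have t8 : linkEntropy p β * linkTail p β ≤
      1024 * (1 / (p - 1)) * (min β β⁻¹) ^ (1 / 16 : ℝ) := t5.trans (by gcongr)
  set m := min β β⁻¹ with hm
  set r := 1 / (p - 1) with hrdef
  set X := m ^ (1 / 16 : ℝ) with hX
  set Y := m ^ ((p - 1) / 2) with hY
  have hX0 : 0 < X := by positivity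
  have hY0 : 0 < Y := by positivity
  have h1 : √(8 * (4 * linkVariance p β + 48 * (linkTail p β * (linkMass p β + linkTail p β))) *
        entropyBound p d β / N) ≤ 335 * ε * Y + 6000 * ε * (r * X) := by
    refine Real.sqrt_le_iff.2 ⟨by positivity, ?_⟩
    calc _ ≤ 8 * (4 * linkVariance p β + 48 * (linkTail p β * (linkMass p β + linkTail p β))) *
          (ε ^ 2 * N * linkEntropy p β) / N := by gcongr
      _ = ε ^ 2 * (32 * (linkVariance p β * linkEntropy p β) +
          384 * (linkTail p β * (linkMass p β + linkTail p β) * linkEntropy p β)) := by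
          field_simp
          ring
      _ ≤ ε ^ 2 * (32 * (3500 * Y ^ 2) + 384 * (91136 * (r * X) ^ 2)) := by gcongr
      _ ≤ ε ^ 2 * (335 * Y + 6000 * (r * X)) ^ 2 := by
          gcongr
          have : 0 < r * X := by positivity
          nlinarith [mul_pos hY0 this, sq_nonneg Y, sq_nonneg (r * X)]
      _ = _ := by ring
  have h2 : 4 * entropyBound p d β / (N * (linkScale p ε β)⁻¹) ≤
      4 * ε * (4 * (5 * Y) + 424 * X + 4 * (1024 * r * X) + 4 * (14 * Y)) := by
    calc 4 * entropyBound p d β / (N * (linkScale p ε β)⁻¹)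
        ≤ 4 * (ε ^ 2 * N * linkEntropy p β) / (N * (linkScale p ε β)⁻¹) := by gcongr
      _ = 4 * ε ^ 2 * (linkEntropy p β * linkScale p ε β) := by field_simp
      _ = 4 * ε * (ε * (4 * (linkEntropy p β * (Real.exp (-r) / β)) +
          linkEntropy p β * √(linkVariance p β) + 4 * (linkEntropy p β * linkTail p β)) +
          4 * (linkEntropy p β / β / Real.log (1 + m ^ (-(1 / 4) : ℝ)))) := by
          have := log_one_add_rpow_pos hβ
          rw [linkScale, ← hm, ← hrdef]
          field_simp
      _ ≤ 4 * ε * (1 * (4 * (5 * Y) + 424 * X + 4 * (1024 * r * X)) + 4 * (14 * Y)) := by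
          refine mul_le_mul_of_nonneg_left ?_ (by positivity)
          refine add_le_add (mul_le_mul hε1 (by linarith) (by positivity) one_pos.le) (by linarith)
      _ = _ := by ring
  have h3 : ε * X ≤ ε * (r * X) := by
    gcongr
    nlinarith
  have h4 : 0 < ε * Y := by positivity
  have h5 : 0 < ε * (r * X) := by positivity
  linarith

theorem sum_link_bound_le (hp : 1 < p) (hp' : p ≤ 5 / 4) {ε β₀ : ℝ} (hε : 0 < ε) (hβ₀ : 0 < β₀)
    (n : ℕ) :
    ∑ b ∈ Finset.range n, (30000 * ε * (1 / (p - 1)) *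
        (min (2 ^ b * β₀) (2 ^ b * β₀)⁻¹) ^ (1 / 16 : ℝ) +
      1000 * ε * (min (2 ^ b * β₀) (2 ^ b * β₀)⁻¹) ^ ((p - 1) / 2)) ≤
      2000000 * (1 / (p - 1)) * ε := by
  have hs : 0 < p - 1 := by linarith
  have h1 := sum_min_rpow_le hβ₀ (s := 1 / 16) (by norm_num) (by norm_num) n
  have h2 := sum_min_rpow_le hβ₀ (half_pos hs) (by linarith) n
  rw [Finset.sum_add_distrib, ← Finset.mul_sum, ← Finset.mul_sum]
  calc _ ≤ 30000 * ε * (1 / (p - 1)) * (4 / (1 / 16)) + 1000 * ε * (4 / ((p - 1) / 2)) := by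
        gcongr
    _ = 1928000 * (1 / (p - 1)) * ε := by
        field_simp
        norm_num
    _ ≤ _ := by
        gcongr
        norm_num

end Scalar

theorem IsDyadicStep.card_le_mul_min {p : ℝ} {d b : ℕ} {x x' : Fin d → ℝ} {S : Finset (Fin d)}
    (hS : IsDyadicStep p b x x' S) {D : ℝ} (hD : 0 < D) (hDd : D ^ p = d) :
    (S.card : ℝ) ≤ D ^ p * min 1 ((2 ^ b / D) ^ p) := by
  rw [mul_min_of_nonneg _ _ (by positivity)]
  refine le_min ?_ ?_
  · rw [mul_one, hDd]
    have := S.card_le_univ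
    rw [Fintype.card_fin] at this
    exact_mod_cast this
  · rw [← Real.mul_rpow hD.le (by positivity), mul_div_cancel₀ _ hD.ne']
    exact hS.card_le

theorem mul_inv_le_one_of_le {s t : ℝ} (ht : 0 < t) (h : s ≤ t) : t⁻¹ * s ≤ 1 := by
  rw [inv_mul_le_iff₀ ht, mul_one]
  exact h

theorem IsStableLaw.integral_truncatedForm_link_le {p : ℝ} {μ : Measure ℝ} [IsProbabilityMeasure μ]
    (hμ : IsStableLaw p μ) (hp : 1 < p) (hp' : p ≤ 5 / 4) {ε D : ℝ} (hε : 0 < ε) (hε1 : ε ≤ 1)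
    (hD : 0 < D) {d b : ℕ} (hDd : D ^ p = d) {x x' : Fin d → ℝ} {S : Finset (Fin d)}
    (hS : IsDyadicStep p b x x' S) :
    ∫ a, (truncatedForm (ε⁻¹ * D) (D * Real.exp (-(1 / (p - 1)))) a x' -
        truncatedForm (ε⁻¹ * D) (D * Real.exp (-(1 / (p - 1)))) a x) ^ 2 *
      Real.exp ((linkScale p ε (2 ^ b / D))⁻¹ *
        |truncatedForm (ε⁻¹ * D) (D * Real.exp (-(1 / (p - 1)))) a x' -
          truncatedForm (ε⁻¹ * D) (D * Real.exp (-(1 / (p - 1)))) a x|)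
      ∂(Measure.pi fun _ ↦ μ) ≤ 4 * linkVariance p (2 ^ b / D) + 48 * (linkTail p (2 ^ b / D) *
        (linkMass p (2 ^ b / D) + linkTail p (2 ^ b / D))) := by
  set β : ℝ := 2 ^ b / D with hβdef
  have hβ : 0 < β := by positivity
  have hs : 0 < p - 1 := by linarith
  have hr : 4 ≤ 1 / (p - 1) := by
    rw [le_div_iff₀ hs]
    linarith
  have hδ : ((2 : ℝ) ^ b)⁻¹ = (β * D)⁻¹ := by
    rw [hβdef, div_mul_cancel₀ _ hD.ne']
  have hcard := hS.card_le_mul_min hD hDd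
  rw [← hβdef] at hcard
  have hw := min_one_rpow_pos (p := p) hβ
  have hm0 := min_self_inv_pos hβ
  have hv := linkVariance_pos (p := p) hβ
  have hQ := linkTail_pos hp hβ
  have hΛ := linkScale_pos hp hε hβ
  have hlog := log_one_add_rpow_pos hβ
  have hε' : 1 ≤ ε⁻¹ := (one_le_inv₀ hε).2 hε1
  have hε'' : ε⁻¹ ^ (1 - p) ≤ 1 := Real.rpow_le_one_of_one_le_of_nonpos hε' (by linarith)
  have hE : Real.exp (-(1 / (p - 1))) ≤ 1 := Real.exp_le_one_iff.2 (by linarith)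
  have hK1 : 1 ≤ (min β β⁻¹) ^ (-(1 / 4) : ℝ) := one_le_rpow_min_self_inv hβ (by norm_num)
  have hM1 : 1 ≤ (min β β⁻¹) ^ (-(1 / 2) : ℝ) := one_le_rpow_min_self_inv hβ (by norm_num)
  have hKM : (min β β⁻¹) ^ (-(1 / 4) : ℝ) * (min β β⁻¹) ^ (-(1 / 4) : ℝ) =
      (min β β⁻¹) ^ (-(1 / 2) : ℝ) := by
    rw [← Real.rpow_add hm0]
    norm_num
  have hβs := rpow_le_min_self_inv_rpow hp hp' hβ
  have he3 := Real.exp_one_lt_d9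
  have d1 : 0 < Real.exp (-(1 / (p - 1))) / β := by positivity
  have d2 : 0 ≤ √(linkVariance p β) := Real.sqrt_nonneg _
  have d3 : 0 < ε⁻¹ / β / Real.log (1 + (min β β⁻¹) ^ (-(1 / 4) : ℝ)) := by positivity
  set K := (min β β⁻¹) ^ (-(1 / 4) : ℝ) with hK
  have hΛdef : linkScale p ε β = 4 * (Real.exp (-(1 / (p - 1))) / β) + √(linkVariance p β) +
    4 * linkTail p β + 4 * (ε⁻¹ / β / Real.log (1 + K)) := rfl
  refine hμ.integral_truncatedForm_step_le (K := K) hp (by positivity) ?_ hS (by positivity)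
    (by positivity) ?_ ?_ ?_ ?_ ?_ ?_ ?_
  · rw [mul_comm]
    gcongr
    exact hE.trans hε'
  · rw [← Real.le_log_iff_exp_le (by positivity), hδ]
    have h1 : (linkScale p ε β)⁻¹ * (4 * (ε⁻¹ / β / Real.log (1 + K))) ≤ 1 :=
      mul_inv_le_one_of_le hΛ (by rw [hΛdef]; linarith)
    calc 4 * (linkScale p ε β)⁻¹ * (ε⁻¹ * D * (β * D)⁻¹) =
        (linkScale p ε β)⁻¹ * (4 * (ε⁻¹ / β / Real.log (1 + K))) * Real.log (1 + K) := by
          field_simp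
      _ ≤ 1 * Real.log (1 + K) := by gcongr
      _ = _ := one_mul _
  · rw [hδ]
    have h1 : (linkScale p ε β)⁻¹ * (4 * (Real.exp (-(1 / (p - 1))) / β)) ≤ 1 :=
      mul_inv_le_one_of_le hΛ (by rw [hΛdef]; linarith)
    refine le_trans (le_of_eq ?_) h1
    field_simp
  · rw [hδ]
    have h1 : (D * Real.exp (-(1 / (p - 1)))) ^ (2 - p) =
        D ^ (2 - p) * (Real.exp (-(1 / (p - 1))) * Real.exp 1) := by
      rw [Real.mul_rpow hD.le (Real.exp_pos _).le, ← Real.exp_mul, ← Real.exp_add]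
      congr 2
      field_simp
      ring
    have h2 : D ^ p * D ^ (2 - p) = D ^ 2 := by
      rw [← Real.rpow_add hD]
      norm_num
    rw [h1]
    calc _ ≤ 256 * (β * D)⁻¹ ^ 2 * (D ^ p * min 1 (β ^ p)) *
          (D ^ (2 - p) * (Real.exp (-(1 / (p - 1))) * Real.exp 1)) := by gcongr
      _ = 256 * Real.exp 1 * Real.exp (-(1 / (p - 1))) * min 1 (β ^ p) *
          ((β * D)⁻¹ ^ 2 * (D ^ p * D ^ (2 - p))) := by ring
      _ = 256 * Real.exp 1 * Real.exp (-(1 / (p - 1))) * min 1 (β ^ p) / β ^ 2 := by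
          rw [h2]
          field_simp
      _ ≤ 700 * Real.exp (-(1 / (p - 1))) * min 1 (β ^ p) / β ^ 2 := by
          gcongr
          linarith
  · have h1 : (linkScale p ε β)⁻¹ * √(linkVariance p β) ≤ 1 :=
      mul_inv_le_one_of_le hΛ (by rw [hΛdef]; linarith)
    have h2 : (linkScale p ε β)⁻¹ ^ 2 * linkVariance p β =
        ((linkScale p ε β)⁻¹ * √(linkVariance p β)) ^ 2 := by
      rw [mul_pow, Real.sq_sqrt hv.le]
    rw [h2]
    exact pow_le_one₀ (by positivity) h1
  · rw [hδ]
    have h1 : (D * Real.exp (-(1 / (p - 1)))) ^ (1 - p) = D ^ (1 - p) * Real.exp 1 := by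
      rw [Real.mul_rpow hD.le (Real.exp_pos _).le, ← Real.exp_mul]
      congr 2
      field_simp
      ring
    have h2 : D ^ p * D ^ (1 - p) = D := by
      rw [← Real.rpow_add hD]
      simp
    rw [h1, Real.mul_rpow (by positivity) hD.le]
    calc _ ≤ 16 * (D ^ p * min 1 (β ^ p)) * (β * D)⁻¹ *
          (D ^ (1 - p) * 3 / (p - 1) + K * (1 * D ^ (1 - p))) := by
          gcongr
          linarith
      _ = 16 * min 1 (β ^ p) * (β * D)⁻¹ * (D ^ p * D ^ (1 - p)) * (3 * (1 / (p - 1)) + K) := by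
          ring
      _ = _ := by
          rw [h2, linkTail, ← hK]
          clear_value K
          field_simp
  · have h1 : (linkScale p ε β)⁻¹ * (4 * linkTail p β) ≤ 1 :=
      mul_inv_le_one_of_le hΛ (by rw [hΛdef]; linarith)
    linarith
  · rw [hδ]
    have h1 : (ε⁻¹ * D * (β * D)⁻¹) ^ (1 - p) ≤ K := by
      have : ε⁻¹ * D * (β * D)⁻¹ = ε⁻¹ * β⁻¹ := by field_simp
      rw [this, Real.mul_rpow (by positivity) (by positivity), Real.inv_rpow hβ.le,
        ← Real.rpow_neg hβ.le, neg_sub]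
      calc _ ≤ 1 * K := by gcongr
        _ = K := one_mul K
    have h2 : 16 * K * (ε⁻¹ * D * (β * D)⁻¹) ^ (1 - p) ≤ 16 * K * K := by gcongr
    have h3 : 16 * K * K = 16 * (min β β⁻¹) ^ (-(1 / 2) : ℝ) := by
      rw [mul_assoc, hKM]
    unfold linkMass
    nlinarith

section Bias

variable {p : ℝ} {μ : Measure ℝ} [IsProbabilityMeasure μ]

theorem IsStableLaw.integrable_clip (R : ℝ) : Integrable (clip R) μ := by
  refine Integrable.of_bound (measurable_clip R).aestronglyMeasurable |R|
    (Eventually.of_forall fun t ↦ ?_)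
  rw [Real.norm_eq_abs, clip]
  rcases le_total 0 R with h | h
  · rw [abs_of_nonneg h]
    exact abs_clip_le h t
  · rw [max_eq_left ((min_le_left _ _).trans (by linarith)), abs_neg]

/-- Truncating the entries of a stable linear form at level `R` changes the mean of its absolute
value by a multiple of the `ℓ₁` norm, up to a small error. -/
theorem IsStableLaw.abs_integral_abs_linear_sub_clip_le (hμ : IsStableLaw p μ) (hp : 1 < p)
    {R : ℝ} (hR : 0 < R) {d : ℕ} {x : Fin d → ℝ} (hx : ∑ i, |x i| ^ p ≤ 1) :
    |(∫ a : Fin d → ℝ, |∑ i, a i * x i| ∂(Measure.pi fun _ ↦ μ)) -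
        (∫ a : Fin d → ℝ, |∑ i, clip R (a i) * x i| ∂(Measure.pi fun _ ↦ μ)) -
        (∫ t, max (|t| - R) 0 ∂μ) * (∑ i, |x i|)| ≤
      2 * (d * ((1 + 16 * (1 + 1 / (p - 1))) * (16 * R ^ (-p)))) := by
  have hs : 0 < p - 1 := by linarith
  set c : ℝ → ℝ := {t : ℝ | R ≤ |t|}.indicator fun _ ↦ (1 : ℝ) with hc
  have hmeas : MeasurableSet {t : ℝ | R ≤ |t|} := measurableSet_le measurable_const (by fun_prop)
  have hcm : Measurable c := measurable_const.indicator hmeas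
  have hc0 : ∀ t, 0 ≤ c t := fun t ↦ Set.indicator_nonneg (fun _ _ ↦ zero_le_one) t
  have hc1 : ∀ t, c t ≤ 1 := fun t ↦ Set.indicator_le_self' (fun _ _ ↦ zero_le_one) t
  have hcint : ∫ t, c t ∂μ ≤ 16 * R ^ (-p) := by
    rw [hc, integral_indicator hmeas]
    simpa using hμ.measureReal_le_abs_le (by linarith) hR
  set w : Fin d → Fin d → ℝ → ℝ := fun i l t ↦ if l < i then t * x l else clip R t * x l with hw
  have hclip : ∀ t, |clip R t| ≤ |t| := fun t ↦ by
    rw [abs_clip hR.le]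
    exact min_le_right _ _
  have hwle : ∀ i l t, |w i l t| ≤ |t * x l| := fun i l t ↦ by
    simp only [hw]
    split_ifs
    · exact le_rfl
    · rw [abs_mul, abs_mul]
      exact mul_le_mul_of_nonneg_right (hclip t) (abs_nonneg _)
  have hwm : ∀ i l, Measurable (w i l) := fun i l ↦ by
    simp only [hw]
    split_ifs
    · fun_prop
    · exact (measurable_clip R).mul_const _
  have hwodd : ∀ i l t, w i l (-t) = -w i l t := fun i l t ↦ by
    simp only [hw]
    split_ifs
    · ring
    · rw [clip_neg hR.le]
      ring
  have hwint : ∀ i l, Integrable (w i l) μ := fun i l ↦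
    ((hμ.integrable_id hp).mul_const (x l)).mono (hwm i l).aestronglyMeasurable
      (Eventually.of_forall fun t ↦ hwle i l t)
  have hWint : ∀ i, Integrable (fun a : Fin d → ℝ ↦
      |∑ l ∈ Finset.univ.erase i, w i l (a l)| * c (a i)) (Measure.pi fun _ ↦ μ) := fun i ↦ by
    have h1 : Integrable (fun a : Fin d → ℝ ↦ ∑ l ∈ Finset.univ.erase i, w i l (a l))
        (Measure.pi fun _ ↦ μ) := integrable_finsetSum _ fun l _ ↦ integrable_eval_pi (hwint i l) l
    refine h1.mono (h1.1.norm.mul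
      (hcm.comp (measurable_pi_apply i)).aestronglyMeasurable) (Eventually.of_forall fun a ↦ ?_)
    rw [Real.norm_eq_abs, Real.norm_eq_abs, abs_mul, abs_abs, abs_of_nonneg (hc0 _)]
    exact mul_le_of_le_one_right (abs_nonneg _) (hc1 _)
  have hpoint : ∀ a : Fin d → ℝ,
      |(|∑ i, a i * x i| - |∑ i, clip R (a i) * x i| - ∑ i, max (|a i| - R) 0 * |x i|)| ≤
        2 * ∑ i, |∑ l ∈ Finset.univ.erase i, w i l (a l)| * c (a i) := fun a ↦ by
    have h := abs_abs_sum_add_sub_le (fun i ↦ clip R (a i) * x i)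
      (fun i ↦ (a i - clip R (a i)) * x i) fun i ↦ by
        have := clip_mul_sub_nonneg hR.le (a i)
        have h2 := sq_nonneg (x i)
        calc (0 : ℝ) ≤ (clip R (a i) * (a i - clip R (a i))) * x i ^ 2 := mul_nonneg this h2
          _ = _ := by ring
    have e1 : ∀ i, clip R (a i) * x i + (a i - clip R (a i)) * x i = a i * x i := fun i ↦ by ring
    have e2 : ∀ i, |(a i - clip R (a i)) * x i| = max (|a i| - R) 0 * |x i| := fun i ↦ by
      rw [abs_mul, abs_sub_clip hR.le]
    simp only [e1, e2] at h
    refine h.trans (mul_le_mul_of_nonneg_left (Finset.sum_le_sum fun i _ ↦ ?_) zero_le_two)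
    by_cases hi : R ≤ |a i|
    · have : c (a i) = 1 := Set.indicator_of_mem (s := {t : ℝ | R ≤ |t|}) hi _
      rw [this, mul_one]
      exact min_le_left _ _
    · have : max (|a i| - R) 0 = 0 := max_eq_right (by linarith [not_le.1 hi])
      rw [this, zero_mul]
      exact (min_le_right _ _).trans (mul_nonneg (abs_nonneg _) (hc0 _))
  have hI1 : Integrable (fun a : Fin d → ℝ ↦ |∑ i, a i * x i|) (Measure.pi fun _ ↦ μ) :=
    (hμ.integrable_linear hp x).abs
  have hI2 : Integrable (fun a : Fin d → ℝ ↦ |∑ i, clip R (a i) * x i|) (Measure.pi fun _ ↦ μ) :=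
    (integrable_finsetSum _ fun i _ ↦
      (integrable_eval_pi (IsStableLaw.integrable_clip R) i).mul_const (x i)).abs
  have hI3 : ∀ i ∈ Finset.univ, Integrable (fun a : Fin d → ℝ ↦ max (|a i| - R) 0 * |x i|)
      (Measure.pi fun _ ↦ μ) := fun i _ ↦
    (integrable_eval_pi (hμ.integrable_excess hp hR) i).mul_const _
  have e3 : (∫ t, max (|t| - R) 0 ∂μ) * ∑ i, |x i| =
      ∫ a : Fin d → ℝ, ∑ i, max (|a i| - R) 0 * |x i| ∂(Measure.pi fun _ ↦ μ) := by
    rw [integral_finsetSum _ hI3, Finset.mul_sum]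
    refine Finset.sum_congr rfl fun i _ ↦ ?_
    rw [integral_mul_const, integral_eval_pi (f := fun t ↦ max (|t| - R) 0) (by fun_prop)]
  have hI12 : Integrable (fun a : Fin d → ℝ ↦ |∑ i, a i * x i| - |∑ i, clip R (a i) * x i|)
      (Measure.pi fun _ ↦ μ) := hI1.sub hI2
  rw [e3, ← integral_sub hI1 hI2, ← integral_sub hI12 (integrable_finsetSum _ hI3)]
  refine abs_integral_le_integral_abs.trans ?_
  refine (integral_mono_of_nonneg (Eventually.of_forall fun a ↦ abs_nonneg _)
    ((integrable_finsetSum Finset.univ fun i _ ↦ hWint i).const_mul 2)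
    (Eventually.of_forall hpoint)).trans ?_
  rw [integral_const_mul, integral_finsetSum _ fun i _ ↦ hWint i]
  refine mul_le_mul_of_nonneg_left ?_ zero_le_two
  have hterm : ∀ i ∈ (Finset.univ : Finset (Fin d)),
      ∫ a : Fin d → ℝ, |∑ l ∈ Finset.univ.erase i, w i l (a l)| * c (a i) ∂(Measure.pi fun _ ↦ μ) ≤
        (1 + 16 * (1 + 1 / (p - 1))) * (16 * R ^ (-p)) := fun i _ ↦ by
    have hsum : ∑ l, ∫ t, min (w i l t ^ 2) |w i l t| ∂μ ≤ 16 * (1 + 1 / (p - 1)) := by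
      calc _ ≤ ∑ l, 16 * (1 + 1 / (p - 1)) * |x l| ^ p := by
            refine Finset.sum_le_sum fun l _ ↦ ?_
            refine le_trans ?_ (hμ.integral_min_sq_abs_mul_le hp (x l))
            exact integral_mono_of_nonneg
              (Eventually.of_forall fun t ↦ le_min (sq_nonneg _) (abs_nonneg _))
              (hμ.integrable_min_sq_abs_mul hp (x l))
              (Eventually.of_forall fun t ↦ min_sq_abs_le (hwle i l t))
        _ = 16 * (1 + 1 / (p - 1)) * ∑ l, |x l| ^ p := by rw [Finset.mul_sum]
        _ ≤ 16 * (1 + 1 / (p - 1)) * 1 := by gcongr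
        _ = _ := mul_one _
    refine (integral_abs_sum_erase_mul_le (fun _ ↦ hμ.isSymmetricLaw) (hwm i) (hwodd i) (hwint i) i
      hcm hc0).trans ?_
    have : 0 ≤ ∫ t, c t ∂μ := integral_nonneg hc0
    gcongr
  refine (Finset.sum_le_sum hterm).trans ?_
  simp

end Bias

theorem integral_exp_mul_sub_le_one {μ : Measure ℝ} [IsProbabilityMeasure μ] {ζ : ℝ → ℝ}
    (hζ : Measurable ζ) {R lam ρ : ℝ} (hζ0 : ∀ t, 0 ≤ ζ t) (hζR : ∀ t, ζ t ≤ R) (hlam : 0 ≤ lam)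
    (hlamR : lam * R ≤ 1) (hρ : lam * ∫ t, ζ t ^ 2 ∂μ ≤ ρ) :
    ∫ t, Real.exp (lam * (ζ t - ∫ s, ζ s ∂μ - ρ)) ∂μ ≤ 1 := by
  set m := ∫ s, ζ s ∂μ with hm
  have hb : ∀ t, ‖ζ t‖ ≤ R := fun t ↦ by
    rw [Real.norm_of_nonneg (hζ0 t)]
    exact hζR t
  have h1 : Integrable ζ μ :=
    Integrable.of_bound hζ.aestronglyMeasurable R (Eventually.of_forall hb)
  have h2 : Integrable (fun t ↦ ζ t ^ 2) μ :=
    Integrable.of_bound (hζ.pow_const 2).aestronglyMeasurable (R ^ 2)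
      (Eventually.of_forall fun t ↦ by
        rw [norm_pow]
        exact pow_le_pow_left₀ (norm_nonneg _) (hb t) 2)
  have h3' : Integrable (fun t ↦ 1 + lam * ζ t) μ := (integrable_const 1).add (h1.const_mul lam)
  have h3 : Integrable (fun t ↦ 1 + lam * ζ t + lam ^ 2 * ζ t ^ 2) μ := h3'.add (h2.const_mul _)
  have h4 : ∫ t, (1 + lam * ζ t + lam ^ 2 * ζ t ^ 2) ∂μ =
      1 + lam * m + lam * (lam * ∫ t, ζ t ^ 2 ∂μ) := by
    rw [integral_add h3' (h2.const_mul _),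
      integral_add (integrable_const 1) (h1.const_mul lam), integral_const_mul, integral_const_mul]
    simp only [integral_const, probReal_univ, smul_eq_mul]
    ring
  calc ∫ t, Real.exp (lam * (ζ t - m - ρ)) ∂μ
      ≤ ∫ t, Real.exp (-(lam * m + lam * ρ)) * (1 + lam * ζ t + lam ^ 2 * ζ t ^ 2) ∂μ := by
        refine integral_mono_of_nonneg (Eventually.of_forall fun t ↦ (Real.exp_pos _).le)
          (h3.const_mul _) (Eventually.of_forall fun t ↦ ?_)
        have hu : |lam * ζ t| ≤ 1 := by
          rw [abs_of_nonneg (mul_nonneg hlam (hζ0 t))]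
          exact (mul_le_mul_of_nonneg_left (hζR t) hlam).trans hlamR
        have := (abs_le.1 (Real.abs_exp_sub_one_sub_id_le hu)).2
        calc Real.exp (lam * (ζ t - m - ρ)) =
            Real.exp (-(lam * m + lam * ρ)) * Real.exp (lam * ζ t) := by
              rw [← Real.exp_add]
              ring_nf
          _ ≤ Real.exp (-(lam * m + lam * ρ)) * (1 + lam * ζ t + lam ^ 2 * ζ t ^ 2) := by
              gcongr
              linarith [mul_pow lam (ζ t) 2]
    _ = Real.exp (-(lam * m + lam * ρ)) * (1 + lam * m + lam * (lam * ∫ t, ζ t ^ 2 ∂μ)) := by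
        rw [integral_const_mul, h4]
    _ ≤ Real.exp (-(lam * m + lam * ρ)) * Real.exp (lam * m + lam * ρ) := by
        gcongr
        have := Real.add_one_le_exp (lam * m + lam * ρ)
        have := mul_le_mul_of_nonneg_left hρ hlam
        linarith
    _ = 1 := by rw [← Real.exp_add, neg_add_cancel, Real.exp_zero]

theorem lintegral_sum_exp_sum_le {μ : Measure ℝ} [IsProbabilityMeasure μ] {g : ℝ → ℝ}
    (hg : Measurable g) {M : ℝ} (hgM : ∀ t, g t ≤ M) (hg1 : ∫ t, Real.exp (g t) ∂μ ≤ 1)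
    {d : ℕ} (hd : 1 ≤ d) (N : ℕ) :
    ∫⁻ ω : Fin N → Fin d → ℝ, ENNReal.ofReal ((∑ i, Real.exp (∑ j, g (ω j i))) / (2 * d))
      ∂(Measure.pi fun _ ↦ Measure.pi fun _ ↦ μ) ≤ 1 / 2 := by
  have hd0 : (0 : ℝ) < d := by exact_mod_cast hd
  have hinteg : ∀ i ∈ (Finset.univ : Finset (Fin d)),
      Integrable (fun ω : Fin N → Fin d → ℝ ↦ Real.exp (∑ j, g (ω j i)))
      (Measure.pi fun _ ↦ Measure.pi fun _ ↦ μ) := fun i _ ↦ by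
    refine Integrable.of_bound (Measurable.aestronglyMeasurable ?_) (Real.exp (N * M))
      (Eventually.of_forall fun ω ↦ ?_)
    · exact Real.measurable_exp.comp (Finset.measurable_fun_sum _ fun j _ ↦ hg.comp (by fun_prop))
    · rw [Real.norm_of_nonneg (Real.exp_pos _).le, Real.exp_le_exp]
      calc ∑ j, g (ω j i) ≤ ∑ _j : Fin N, M := Finset.sum_le_sum fun j _ ↦ hgM _
        _ = N * M := by simp
  have hle : ∀ i ∈ (Finset.univ : Finset (Fin d)), ∫ ω : Fin N → Fin d → ℝ,
      Real.exp (∑ j, g (ω j i)) ∂(Measure.pi fun _ ↦ Measure.pi fun _ ↦ μ) ≤ 1 := fun i _ ↦ by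
    simp only [Real.exp_sum]
    rw [integral_fintype_prod_eq_prod (fun (_ : Fin N) (a : Fin d → ℝ) ↦ Real.exp (g (a i)))]
    refine Finset.prod_le_one (fun _ _ ↦ integral_nonneg fun _ ↦ (Real.exp_pos _).le) fun _ _ ↦ ?_
    rwa [integral_eval_pi (f := fun t ↦ Real.exp (g t)) (Real.measurable_exp.comp hg)]
  rw [← ofReal_integral_eq_lintegral_ofReal ((integrable_finsetSum _ hinteg).div_const _)
    (Eventually.of_forall fun ω ↦ by positivity), integral_div, integral_finsetSum _ hinteg,
    show (1 / 2 : ENNReal) = ENNReal.ofReal (1 / 2) by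
      rw [ENNReal.ofReal_div_of_pos two_pos, ENNReal.ofReal_one, ENNReal.ofReal_ofNat]]
  refine ENNReal.ofReal_le_ofReal ?_
  rw [div_le_iff₀ (by positivity)]
  calc _ ≤ ∑ _i : Fin d, (1 : ℝ) := Finset.sum_le_sum hle
    _ = _ := by
        simp

theorem sum_max_mul_abs_le_of_sum_exp_le {p : ℝ} (hp : 1 < p) {d : ℕ} {g x : Fin d → ℝ} {B : ℝ}
    (hg : ∑ i, Real.exp (g i) ≤ B) (hx : ∑ i, |x i| ^ p ≤ 1) :
    ∑ i, max (g i) 0 * |x i| ≤ p / (p - 1) * B ^ ((p - 1) / p) := by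
  have hs : 0 < p - 1 := by linarith
  have hp0 : 0 < p := by linarith
  set q := p / (p - 1) with hq
  have hq0 : 0 < q := by positivity
  have hqp : q.HolderConjugate p := (Real.HolderConjugate.conjExponent hp).symm
  have hB : 0 ≤ B := (Finset.sum_nonneg fun i _ ↦ (Real.exp_pos _).le).trans hg
  refine (Real.inner_le_Lp_mul_Lq_of_nonneg Finset.univ hqp (fun i _ ↦ le_max_right _ _)
    (fun i _ ↦ abs_nonneg _)).trans ?_
  have h1 : (∑ i, |x i| ^ p) ^ (1 / p) ≤ 1 :=
    Real.rpow_le_one (Finset.sum_nonneg fun i _ ↦ by positivity) hx (by positivity)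
  have h2 : ∑ i, (max (g i) 0) ^ q ≤ q ^ q * B := by
    refine le_trans ?_ (mul_le_mul_of_nonneg_left hg (by positivity))
    rw [Finset.mul_sum]
    refine Finset.sum_le_sum fun i _ ↦ ?_
    have h3 : max (g i) 0 ≤ q * Real.exp (g i / q) := by
      refine max_le ?_ (by positivity)
      have := Real.add_one_le_exp (g i / q)
      calc g i = q * (g i / q) := by field_simp
        _ ≤ _ := by
          gcongr
          linarith
    calc (max (g i) 0) ^ q ≤ (q * Real.exp (g i / q)) ^ q :=
          Real.rpow_le_rpow (le_max_right _ _) h3 hq0.le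
      _ = q ^ q * Real.exp (g i) := by
          rw [Real.mul_rpow hq0.le (Real.exp_pos _).le, ← Real.exp_mul, div_mul_cancel₀ _ hq0.ne']
  have h4 : (∑ i, (max (g i) 0) ^ q) ^ (1 / q) ≤ q * B ^ ((p - 1) / p) := by
    calc _ ≤ (q ^ q * B) ^ (1 / q) :=
          Real.rpow_le_rpow (Finset.sum_nonneg fun i _ ↦
            Real.rpow_nonneg (le_max_right _ _) _) h2 (by positivity)
      _ = _ := by
          rw [Real.mul_rpow (by positivity) hB, ← Real.rpow_mul hq0.le, mul_one_div_cancel hq0.ne',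
            Real.rpow_one, hq, one_div_div]
  calc _ ≤ q * B ^ ((p - 1) / p) * 1 := mul_le_mul h4 h1 (by positivity) (by positivity)
    _ = _ := mul_one _

theorem abs_truncatedForm_sub_le {d : ℕ} {R h : ℝ} (hh : 0 ≤ h) (hR : h ≤ R) (a x y : Fin d → ℝ) :
    |truncatedForm R h a x - truncatedForm R h a y| ≤ 2 * R * ∑ i, |x i - y i| := by
  have h1 : |(|∑ i, clip R (a i) * x i| - |∑ i, clip R (a i) * y i|)| ≤
      ∑ i, R * |x i - y i| := by
    refine (abs_abs_sub_abs_le _ _).trans ?_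
    rw [← Finset.sum_sub_distrib]
    refine (Finset.abs_sum_le_sum_abs _ _).trans (Finset.sum_le_sum fun i _ ↦ ?_)
    rw [← mul_sub, abs_mul]
    exact mul_le_mul_of_nonneg_right (abs_clip_le (hh.trans hR) _) (abs_nonneg _)
  have h2 : |(∑ i, |clipExcess R h (a i)| * |x i|) - (∑ i, |clipExcess R h (a i)| * |y i|)| ≤
      ∑ i, R * |x i - y i| := by
    rw [← Finset.sum_sub_distrib]
    refine (Finset.abs_sum_le_sum_abs _ _).trans (Finset.sum_le_sum fun i _ ↦ ?_)
    rw [← mul_sub, abs_mul, abs_abs]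
    exact mul_le_mul (abs_clipExcess_le' hh hR _) (abs_abs_sub_abs_le _ _) (abs_nonneg _)
      (hh.trans hR)
  rw [← Finset.mul_sum] at h1 h2
  unfold truncatedForm
  rw [abs_le] at *
  constructor <;> linarith

theorem measurable_truncatedForm {d : ℕ} (R h : ℝ) (x : Fin d → ℝ) :
    Measurable fun a ↦ truncatedForm R h a x := by
  unfold truncatedForm
  refine Measurable.sub (Measurable.abs ?_) ?_
  · exact Finset.measurable_fun_sum _ fun i _ ↦
      ((measurable_clip R).comp (measurable_pi_apply i)).mul_const _
  · exact Finset.measurable_fun_sum _ fun i _ ↦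
      ((measurable_clipExcess R h).comp (measurable_pi_apply i)).abs.mul_const _

theorem integral_truncatedForm {μ : Measure ℝ} [IsProbabilityMeasure μ] {d : ℕ} {R h : ℝ}
    (x : Fin d → ℝ) :
    ∫ a, truncatedForm R h a x ∂(Measure.pi fun _ ↦ μ) =
      (∫ a : Fin d → ℝ, |∑ i, clip R (a i) * x i| ∂(Measure.pi fun _ ↦ μ)) -
        (∫ t, |clipExcess R h t| ∂μ) * ∑ i, |x i| := by
  have hE : Integrable (fun t ↦ |clipExcess R h t|) μ :=
    ((IsStableLaw.integrable_clip R).sub (IsStableLaw.integrable_clip h)).abs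
  have hI : ∀ i ∈ Finset.univ, Integrable (fun a : Fin d → ℝ ↦ |clipExcess R h (a i)| * |x i|)
      (Measure.pi fun _ ↦ μ) := fun i _ ↦ (integrable_eval_pi hE i).mul_const _
  unfold truncatedForm
  rw [integral_sub (integrable_finsetSum _ fun i _ ↦
      (integrable_eval_pi (IsStableLaw.integrable_clip R) i).mul_const (x i)).abs
    (integrable_finsetSum _ hI), integral_finsetSum _ hI, Finset.mul_sum]
  congr 1
  refine Finset.sum_congr rfl fun i _ ↦ ?_
  rw [integral_mul_const, integral_eval_pi (f := fun t ↦ |clipExcess R h t|)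
    (measurable_clipExcess R h).abs]

/-- The truncated sample average together with diagonal correction rows. -/
theorem exists_linearMap_sum_abs_eq {d N : ℕ} (R h m ρ : ℝ) (ω : Fin N → Fin d → ℝ) :
    ∃ T : (Fin d → ℝ) →ₗ[ℝ] (Fin (N + d) → ℝ), ∀ x : Fin d → ℝ,
      ∑ j, |T x j| = (∑ j, truncatedForm R h (ω j) x) / N + (m + ρ) * ∑ i, |x i| +
        ∑ i, max ((∑ j, |clipExcess R h (ω j i)|) / N - m - ρ) 0 * |x i| := by
  set f : Fin d → ℝ := fun i ↦ (∑ j, |clipExcess R h (ω j i)|) / N - m with hf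
  refine ⟨LinearMap.pi (Fin.addCases
    (fun j ↦ ∑ i, ((N : ℝ)⁻¹ * clip R (ω j i)) • (LinearMap.proj i : (Fin d → ℝ) →ₗ[ℝ] ℝ))
    fun i ↦ max (ρ - f i) 0 • LinearMap.proj i), fun x ↦ ?_⟩
  simp only [Fin.sum_univ_add, LinearMap.pi_apply, Fin.addCases_left, Fin.addCases_right,
    LinearMap.smul_apply, LinearMap.sum_apply, LinearMap.proj_apply, smul_eq_mul]
  have h1 : ∀ j, |∑ i, (N : ℝ)⁻¹ * clip R (ω j i) * x i| =
      (N : ℝ)⁻¹ * truncatedForm R h (ω j) x +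
        ∑ i, (N : ℝ)⁻¹ * |clipExcess R h (ω j i)| * |x i| := fun j ↦ by
    simp only [truncatedForm, mul_assoc, ← Finset.mul_sum]
    rw [abs_mul, abs_of_nonneg (by positivity : (0 : ℝ) ≤ (N : ℝ)⁻¹)]
    ring
  have h2 : ∀ i, |max (ρ - f i) 0 * x i| =
      (m + ρ) * |x i| + max (f i - ρ) 0 * |x i| -
        ∑ j, (N : ℝ)⁻¹ * |clipExcess R h (ω j i)| * |x i| :=
    fun i ↦ by
    have h3 : ∑ j, (N : ℝ)⁻¹ * |clipExcess R h (ω j i)| * |x i| = (f i + m) * |x i| := by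
      rw [← Finset.sum_mul, ← Finset.mul_sum, hf]
      ring
    have h4 : max (ρ - f i) 0 = ρ - f i + max (f i - ρ) 0 := by
      rcases le_total (f i) ρ with hle | hle
      · rw [max_eq_left (by linarith), max_eq_right (by linarith), add_zero]
      · rw [max_eq_right (by linarith), max_eq_left (by linarith)]
        ring
    rw [h3, abs_mul, abs_of_nonneg (le_max_right _ _), h4]
    ring
  simp only [h1, h2, Finset.sum_add_distrib, Finset.sum_sub_distrib]
  rw [Finset.sum_comm, ← Finset.mul_sum, ← Finset.mul_sum]
  simp only [hf]
  ring

theorem sum_max_average_sub_mul_abs_le {p : ℝ} (hp : 1 < p) (hp2 : p ≤ 2) {d N : ℕ} (hd : 1 ≤ d)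
    (hN : 1 ≤ N) {ε D lam m ρ : ℝ} (hε : 0 < ε) (hD : D = (d : ℝ) ^ (1 / p))
    (hdN : (d : ℝ) ≤ ε ^ 2 * N) (hlam : lam = (65536 * (ε⁻¹ * D))⁻¹) {ζ : ℝ → ℝ}
    {ω : Fin N → Fin d → ℝ}
    (hω : ∑ i, Real.exp (∑ j, lam * (ζ (ω j i) - m - ρ)) ≤ 2 * d) {x : Fin d → ℝ}
    (hx : ∑ i, |x i| ^ p ≤ 1) :
    ∑ i, max ((∑ j, ζ (ω j i)) / N - m - ρ) 0 * |x i| ≤ 262144 * (1 / (p - 1)) * ε := by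
  have hp0 : 0 < p := by linarith
  have hs : 0 < p - 1 := by linarith
  have hd0 : (0 : ℝ) < d := by exact_mod_cast hd
  have hN0 : (0 : ℝ) < N := by exact_mod_cast hN
  have hD0 : 0 < D := by
    rw [hD]
    positivity
  have hlam0 : 0 < lam := by
    rw [hlam]
    positivity
  have h2 := sum_max_mul_abs_le_of_sum_exp_le hp hω hx
  have h3 : ∀ i, max ((∑ j, ζ (ω j i)) / N - m - ρ) 0 * |x i| =
      (lam * N)⁻¹ * (max (∑ j, lam * (ζ (ω j i) - m - ρ)) 0 * |x i|) := fun i ↦ by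
    have h4 : ∑ j, lam * (ζ (ω j i) - m - ρ) = (lam * N) * ((∑ j, ζ (ω j i)) / N - m - ρ) := by
      simp only [← Finset.mul_sum, Finset.sum_sub_distrib, Finset.sum_const,
        Finset.card_univ, Fintype.card_fin, nsmul_eq_mul]
      field_simp
    have h5 : 0 < lam * N := by positivity
    rw [h4, ← mul_assoc, mul_max_of_nonneg _ _ (inv_nonneg.2 h5.le), inv_mul_cancel_left₀ h5.ne',
      mul_zero]
  rw [Finset.sum_congr rfl fun i _ ↦ h3 i, ← Finset.mul_sum]
  have h6 : ((2 : ℝ) * d) ^ ((p - 1) / p) ≤ 2 * (d * D⁻¹) := by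
    rw [Real.mul_rpow zero_le_two hd0.le]
    have h7 : (d : ℝ) ^ ((p - 1) / p) = d * D⁻¹ := by
      rw [hD, ← Real.rpow_neg hd0.le]
      nth_rw 2 [← Real.rpow_one (d : ℝ)]
      rw [← Real.rpow_add hd0]
      congr 1
      field_simp
      ring
    rw [h7]
    gcongr
    calc (2 : ℝ) ^ ((p - 1) / p) ≤ 2 ^ (1 : ℝ) := by
          refine Real.rpow_le_rpow_of_exponent_le one_le_two ?_
          rw [div_le_one hp0]
          linarith
      _ = 2 := Real.rpow_one 2
  calc _ ≤ (lam * N)⁻¹ * (p / (p - 1) * (2 * (d * D⁻¹))) := by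
        refine mul_le_mul_of_nonneg_left (h2.trans ?_) (by positivity)
        gcongr
    _ = 131072 * (p * (1 / (p - 1))) * (ε⁻¹ * (d / N)) := by
        rw [hlam]
        field_simp
        norm_num
    _ ≤ 131072 * (2 * (1 / (p - 1))) * (ε⁻¹ * ε ^ 2) := by
        have : (d : ℝ) / N ≤ ε ^ 2 := by rwa [div_le_iff₀ hN0]
        gcongr
    _ = _ := by
        field_simp
        norm_num

/-- A universal-constant approximate embedding for `p` close to `1`. -/
theorem exists_approx_embedding_of_le_five_fourths {p : ℝ} (hp : 1 < p) (hp' : p ≤ 5 / 4)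
    {ε : ℝ} (hε : 0 < ε) (hε1 : ε ≤ 1) {d : ℕ} (hd : 1 ≤ d) :
    ∃ d' : ℕ, (d' : ℝ) ≤ 3 * d / ε ^ 2 ∧ ∃ T : (Fin d → ℝ) →ₗ[ℝ] (Fin d' → ℝ), ∃ κ : ℝ, 0 < κ ∧
      ∀ x : Fin d → ℝ, ∑ i, |x i| ^ p ≤ 1 →
        |∑ j, |T x j| - κ * (∑ i, |x i| ^ p) ^ (1 / p)| ≤ 2300000 * 16384 * κ * ε := by
  obtain ⟨μ, hprob, hμ⟩ := exists_stable_law hp (by linarith)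
  replace hμ : IsStableLaw p μ := hμ
  have hp0 : 0 < p := by linarith
  have hs : 0 < p - 1 := by linarith
  have hr : 4 ≤ 1 / (p - 1) := by
    rw [le_div_iff₀ hs]
    linarith
  have hd0 : (0 : ℝ) < d := by exact_mod_cast hd
  have hd1 : (1 : ℝ) ≤ d := by exact_mod_cast hd
  set D : ℝ := (d : ℝ) ^ (1 / p) with hD
  have hD0 : 0 < D := by positivity
  have hD1 : 1 ≤ D := Real.one_le_rpow hd1 (by positivity)
  have hDd : D ^ p = d := by
    rw [hD, ← Real.rpow_mul hd0.le, one_div_mul_cancel hp0.ne', Real.rpow_one]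
  set N : ℕ := ⌈(d : ℝ) / ε ^ 2⌉₊ with hN
  have hdε : (d : ℝ) ≤ d / ε ^ 2 := by
    rw [le_div_iff₀ (by positivity)]
    exact mul_le_of_le_one_right hd0.le (pow_le_one₀ hε.le hε1)
  have hN1 : 1 ≤ N := Nat.one_le_ceil_iff.2 (by positivity)
  have hN0 : (0 : ℝ) < N := by exact_mod_cast hN1
  have hdN : (d : ℝ) ≤ ε ^ 2 * N := by
    have := Nat.le_ceil ((d : ℝ) / ε ^ 2)
    rwa [div_le_iff₀ (by positivity), mul_comm] at this
  have hNle : ((N + d : ℕ) : ℝ) ≤ 3 * d / ε ^ 2 := by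
    have := Nat.ceil_lt_add_one (show 0 ≤ (d : ℝ) / ε ^ 2 by positivity)
    rw [mul_div_assoc]
    push_cast
    linarith
  set R : ℝ := ε⁻¹ * D with hR
  set h : ℝ := D * Real.exp (-(1 / (p - 1))) with hh
  have hε' : 1 ≤ ε⁻¹ := (one_le_inv₀ hε).2 hε1
  have hR1 : 1 ≤ R := one_le_mul_of_one_le_of_one_le hε' hD1
  have hR0 : 0 < R := by linarith
  have hh0 : 0 < h := by positivity
  have hE : Real.exp (-(1 / (p - 1))) ≤ 1 := Real.exp_le_one_iff.2 (by linarith)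
  have hhR : h ≤ R := by
    rw [hR, hh, mul_comm]
    gcongr
    exact hE.trans hε'
  set ζ : ℝ → ℝ := fun t ↦ |clipExcess R h t| with hζ
  have hζm : Measurable ζ := (measurable_clipExcess R h).abs
  set m : ℝ := ∫ t, ζ t ∂μ with hm
  set ρ : ℝ := ∫ t, max (|t| - R) 0 ∂μ with hρ
  set lam : ℝ := (65536 * R)⁻¹ with hlam
  have hlam0 : 0 < lam := by positivity
  set g : ℝ → ℝ := fun t ↦ lam * (ζ t - m - ρ) with hg
  have hgm : Measurable g := ((hζm.sub_const _).sub_const _).const_mul _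
  have hg1 : ∫ t, Real.exp (g t) ∂μ ≤ 1 := by
    refine integral_exp_mul_sub_le_one hζm (fun t ↦ abs_nonneg _) (abs_clipExcess_le' hh0.le hhR)
      hlam0.le ?_ ?_
    · rw [hlam, inv_mul_le_iff₀ (by positivity)]
      linarith
    · have h1 := hμ.integral_sq_clipExcess_le hp0 hh0 hhR
      have h2 := hμ.le_integral_excess hp hp' hR1
      rw [show (2 : ℝ) - p = 1 + (1 - p) by ring, Real.rpow_add hR0, Real.rpow_one] at h1
      have h3 : ∫ t, ζ t ^ 2 ∂μ = ∫ t, clipExcess R h t ^ 2 ∂μ := by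
        simp only [hζ, sq_abs]
      have hRp : 0 < R ^ (1 - p) := by positivity
      calc lam * ∫ t, ζ t ^ 2 ∂μ ≤ (65536 * R)⁻¹ * (16 * (R * R ^ (1 - p))) := by
            rw [h3]
            gcongr
        _ = 1 / 16384 * (R ^ (1 - p) * 4) := by
            field_simp
            norm_num
        _ ≤ 1 / 16384 * (R ^ (1 - p) * (1 / (p - 1))) := by gcongr
        _ = 1 / 16384 * (R ^ (1 - p) / (p - 1)) := by ring
        _ ≤ ρ := h2
  have hHm : Measurable fun ω : Fin N → Fin d → ℝ ↦
      ENNReal.ofReal ((∑ i, Real.exp (∑ j, g (ω j i))) / (2 * d)) :=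
    ((Finset.measurable_fun_sum _ fun i _ ↦ Real.measurable_exp.comp
      (Finset.measurable_fun_sum _ fun j _ ↦ hgm.comp (by fun_prop))).div_const _).ennreal_ofReal
  obtain ⟨ω, hω1, hω⟩ := exists_sample_abs_average_sub_le
    (ν := Measure.pi fun _ : Fin d ↦ μ) hp.le (by linarith) hd
    (F := truncatedForm R h) (measurable_truncatedForm R h)
    (fun a ↦ by simp [truncatedForm]) (abs_truncatedForm_sub_le hh0.le hhR)
    (V := fun b ↦ 4 * linkVariance p (2 ^ b / D) + 48 * (linkTail p (2 ^ b / D) *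
        (linkMass p (2 ^ b / D) + linkTail p (2 ^ b / D))))
    (lam := fun b ↦ (linkScale p ε (2 ^ b / D))⁻¹)
    (fun b ↦ by
      have hβ : (0 : ℝ) < 2 ^ b / D := by positivity
      have h1 := linkVariance_pos (p := p) hβ
      have h2 := linkTail_pos hp hβ
      have h3 := linkMass_pos hp hβ
      positivity)
    (fun b ↦ inv_pos.2 (linkScale_pos hp hε (by positivity)))
    (fun b x x' S hS ↦ hμ.integral_truncatedForm_link_le hp hp' hε hε1 hD0 hDd hS) hN1 hHm
    (lintegral_sum_exp_sum_le hgm (M := lam * (R - m - ρ))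
      (fun t ↦ by
        have := abs_clipExcess_le' hh0.le hhR t
        simp only [hg, hζ]
        gcongr) hg1 hd N)
  obtain ⟨T, hT⟩ := exists_linearMap_sum_abs_eq R h m ρ ω
  set κ : ℝ := ∫ t, |t| ∂μ with hκ
  have hκr : 1 / (p - 1) ≤ 16384 * κ := by
    have := hμ.le_integral_abs hp hp'
    linarith
  refine ⟨N + d, hNle, T, κ, by linarith, fun x hx ↦ ?_⟩
  have hsample := hω (2000000 * (1 / (p - 1)) * ε) (fun n ↦ by
    refine (Finset.sum_le_sum fun b _ ↦ ?_).trans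
      (sum_link_bound_le hp hp' hε (β₀ := D⁻¹) (by positivity) n)
    have := link_bound_le hp hp' (β := 2 ^ b / D) (by positivity) hε hε1 hN0 hdN
    rwa [← div_eq_mul_inv]) x hx
  have hbias := hμ.abs_integral_abs_linear_sub_clip_le hp hR0 hx
  rw [hμ.integral_abs_linear hp0] at hbias
  rw [integral_truncatedForm] at hsample
  have hbias_le : 2 * (d * ((1 + 16 * (1 + 1 / (p - 1))) * (16 * R ^ (-p)))) ≤
      672 * (1 / (p - 1)) * ε := by
    have h1 : R ^ (-p) ≤ ε / d := by
      rw [hR, Real.mul_rpow (by positivity) hD0.le, Real.rpow_neg hD0.le, hDd,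
        Real.inv_rpow hε.le, Real.rpow_neg hε.le, inv_inv, div_eq_mul_inv]
      gcongr
      calc ε ^ p ≤ ε ^ (1 : ℝ) := Real.rpow_le_rpow_of_exponent_ge hε hε1 hp.le
        _ = ε := Real.rpow_one ε
    calc _ ≤ 2 * (d * ((21 * (1 / (p - 1))) * (16 * (ε / d)))) := by
          gcongr
          linarith
      _ = _ := by
          field_simp
          norm_num
  have hexc : ∑ i, max ((∑ j, |clipExcess R h (ω j i)|) / N - m - ρ) 0 * |x i| ≤
      262144 * (1 / (p - 1)) * ε := by
    refine sum_max_average_sub_mul_abs_le (ζ := ζ) hp (by linarith) hd hN1 hε hD hdN hlam ?_ hx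
    rwa [ENNReal.ofReal_le_one, div_le_one (by positivity)] at hω1
  have hexc0 : 0 ≤ ∑ i, max ((∑ j, |clipExcess R h (ω j i)|) / N - m - ρ) 0 * |x i| :=
    Finset.sum_nonneg fun i _ ↦ mul_nonneg (le_max_right _ _) (abs_nonneg _)
  have htot : 2300000 * (1 / (p - 1)) * ε ≤ 2300000 * 16384 * κ * ε := by
    rw [mul_assoc 2300000 16384 κ]
    gcongr
  have hrε : 0 < 1 / (p - 1) * ε := by positivity
  have h8 := hbias.trans hbias_le
  have hm' : ∫ t, |clipExcess R h t| ∂μ = m := rfl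
  rw [hm'] at hsample
  rw [← hκ, ← hρ] at h8
  rw [hT]
  clear_value m ρ κ
  rw [abs_le] at hsample h8 ⊢
  constructor <;> linarith

theorem exists_approx_embedding :
    ∃ C : ℝ, 0 < C ∧ ∀ p : ℝ, 1 < p → p ≤ 2 → ∀ ε : ℝ, 0 < ε → ε ≤ 1 → ∀ d : ℕ, 1 ≤ d →
      ∃ d' : ℕ, (d' : ℝ) ≤ C * d / ε ^ 2 ∧ ∃ T : (Fin d → ℝ) →ₗ[ℝ] (Fin d' → ℝ), ∃ κ : ℝ, 0 < κ ∧
        ∀ x : Fin d → ℝ, ∑ i, |x i| ^ p ≤ 1 →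
          |∑ j, |T x j| - κ * (∑ i, |x i| ^ p) ^ (1 / p)| ≤ C * κ * ε := by
  obtain ⟨C, hC, h⟩ := exists_approx_embedding_of_five_fourths_le
  refine ⟨C + 2300000 * 16384, by positivity, fun p hp hp2 ε hε hε1 d hd ↦ ?_⟩
  rcases le_total p (5 / 4) with hp' | hp'
  · obtain ⟨d', hd', T, κ, hκ, hT⟩ := exists_approx_embedding_of_le_five_fourths hp hp' hε hε1 hd
    refine ⟨d', hd'.trans ?_, T, κ, hκ, fun x hx ↦ (hT x hx).trans ?_⟩
    · gcongr
      linarith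
    · gcongr
      linarith
  · obtain ⟨d', hd', T, κ, hκ, hT⟩ := h p hp' hp2 ε hε hε1 d hd
    refine ⟨d', hd'.trans ?_, T, κ, hκ, fun x hx ↦ (hT x hx).trans ?_⟩
    · gcongr
      linarith
    · gcongr
      linarith

theorem abs_sum_abs_sub_le_of_homogeneous {p : ℝ} (hp : 0 < p) {d d' : ℕ}
    {T : (Fin d → ℝ) →ₗ[ℝ] (Fin d' → ℝ)} {κ B : ℝ}
    (hT : ∀ x : Fin d → ℝ, ∑ i, |x i| ^ p ≤ 1 →
      |∑ j, |T x j| - κ * (∑ i, |x i| ^ p) ^ (1 / p)| ≤ B) (x : Fin d → ℝ) :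
    |∑ j, |T x j| - κ * (∑ i, |x i| ^ p) ^ (1 / p)| ≤ B * (∑ i, |x i| ^ p) ^ (1 / p) := by
  set s := ∑ i, |x i| ^ p with hs
  have hs0 : 0 ≤ s := Finset.sum_nonneg fun i _ ↦ by positivity
  rcases hs0.eq_or_lt with h0 | h0
  · have hx : x = 0 := by
      funext i
      have := (Finset.sum_eq_zero_iff_of_nonneg fun i _ ↦ by positivity).1 (hs ▸ h0.symm) i
        (Finset.mem_univ i)
      simpa [Real.rpow_eq_zero (abs_nonneg _) hp.ne'] using this
    rw [← h0, hx, Real.zero_rpow (by positivity)]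
    simp
  · set n := s ^ (1 / p) with hn
    have hn0 : 0 < n := by positivity
    have hnp : n ^ p = s := by
      rw [hn, ← Real.rpow_mul hs0, one_div_mul_cancel hp.ne', Real.rpow_one]
    have h1 : ∑ i, |(n⁻¹ • x) i| ^ p = 1 := by
      simp only [Pi.smul_apply, smul_eq_mul, abs_mul, abs_inv, abs_of_pos hn0]
      simp only [Real.mul_rpow (inv_nonneg.2 hn0.le) (abs_nonneg _), ← Finset.mul_sum]
      rw [Real.inv_rpow hn0.le, hnp, ← hs, inv_mul_cancel₀ h0.ne']
    have h2 := hT (n⁻¹ • x) h1.le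
    rw [h1, Real.one_rpow, mul_one] at h2
    have h3 : ∑ j, |T (n⁻¹ • x) j| = n⁻¹ * ∑ j, |T x j| := by
      simp only [map_smul, Pi.smul_apply, smul_eq_mul, abs_mul, abs_inv, abs_of_pos hn0,
        Finset.mul_sum]
    rw [h3] at h2
    calc |∑ j, |T x j| - κ * n| = |n * (n⁻¹ * ∑ j, |T x j| - κ)| := by
          congr 1
          field_simp
      _ = n * |n⁻¹ * ∑ j, |T x j| - κ| := by rw [abs_mul, abs_of_pos hn0]
      _ ≤ n * B := by gcongr
      _ = B * n := mul_comm _ _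

/-- **Johnson–Schechtman embedding of `ℓ_p^d` into `ℓ₁^{d'}`.** There is a universal constant
`C > 0` such that for every `1 < p ≤ 2`, `ε ∈ (0,1)` and `d ≥ 1`, there are `d' ≤ C·d/ε²` and
a linear map `T : ℝ^d → ℝ^{d'}` with `‖x‖_p ≤ ‖T x‖₁ ≤ (1+ε)·‖x‖_p` for all `x`. -/
theorem lp_embeds_into_l1 :
    ∃ C : ℝ, 0 < C ∧
      ∀ (p : ℝ), 1 < p → p ≤ 2 →
        ∀ (ε : ℝ), ε ∈ Set.Ioo (0 : ℝ) 1 →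
          ∀ (d : ℕ), 1 ≤ d →
            ∃ d' : ℕ, (d' : ℝ) ≤ C * d / ε ^ 2 ∧
              ∃ T : (Fin d → ℝ) →ₗ[ℝ] (Fin d' → ℝ),
                ∀ x : Fin d → ℝ,
                  (∑ i, |x i| ^ p) ^ (1 / p) ≤ ∑ j, |T x j| ∧
                  ∑ j, |T x j| ≤ (1 + ε) * (∑ i, |x i| ^ p) ^ (1 / p) := by
  obtain ⟨C, hC, h⟩ := exists_approx_embedding
  refine ⟨C * (4 * C + 4) ^ 2, by positivity, fun p hp hp2 ε ⟨hε, hε1⟩ d hd ↦ ?_⟩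
  obtain ⟨d', hd', T, κ, hκ, hT⟩ := h p hp hp2 (ε / (4 * C + 4)) (by positivity)
    ((div_le_one (by positivity)).2 (by linarith)) d hd
  have hp0 : 0 < p := by linarith
  refine ⟨d', hd'.trans (le_of_eq (by field_simp)), (κ * (1 - ε / 4))⁻¹ • T, fun x ↦ ?_⟩
  have hx := abs_sum_abs_sub_le_of_homogeneous hp0 hT x
  set n := (∑ i, |x i| ^ p) ^ (1 / p) with hn
  have hn0 : 0 ≤ n := Real.rpow_nonneg (Finset.sum_nonneg fun i _ ↦ by positivity) _
  have hε4 : 0 < 1 - ε / 4 := by linarith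
  have hc : 0 < κ * (1 - ε / 4) := by positivity
  have hB : C * κ * (ε / (4 * C + 4)) * n ≤ ε / 4 * (κ * n) := by
    have h1 : C * (ε / (4 * C + 4)) ≤ ε / 4 := by
      rw [← mul_div_assoc, div_le_div_iff₀ (by positivity) (by norm_num)]
      nlinarith
    calc C * κ * (ε / (4 * C + 4)) * n = C * (ε / (4 * C + 4)) * (κ * n) := by ring
      _ ≤ _ := by gcongr
  have hsum : ∑ j, |((κ * (1 - ε / 4))⁻¹ • T) x j| = (κ * (1 - ε / 4))⁻¹ * ∑ j, |T x j| := by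
    simp only [LinearMap.smul_apply, Pi.smul_apply, smul_eq_mul, abs_mul, abs_inv,
      abs_of_pos hκ, abs_of_pos hε4, Finset.mul_sum]
  have h2 := abs_le.1 (hx.trans hB)
  rw [hsum]
  constructor
  · rw [le_inv_mul_iff₀ hc]
    linarith
  · rw [inv_mul_le_iff₀ hc]
    have h3 : 1 + ε / 4 ≤ (1 - ε / 4) * (1 + ε) := by nlinarith
    have h4 := mul_le_mul_of_nonneg_right h3 (mul_nonneg hκ.le hn0)
    linarith
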